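/- Let p be a prime, F a field of characteristic p, and A a central simple F-algebra with exp A = p. Let n be a positive integer and K/F a purely inseparable field extension with K^p ⊆ F and [K:F] = p^n. Assume A_K is Brauer equivalent to a cyclic K-division algebra of degree p. Then λ_p(A) ≤ n + p − 1. More precisely, A is Brauer equivalent to B ⊗_F B' for central simple F-algebras B and B' such that B_K is split and λ_p(B') ≤ p − 1. -/

import Mathlib

open scoped TensorProduct

/-- A finite-dimensional central simple algebra over a field `F`. -/
def IsCSA (F A : Type) [Field F] [Ring A] [Algebra F A] : Prop :=
  Algebra.IsCentral F A ∧ IsSimpleRing A ∧ FiniteDimensional F A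

/-- An `F`-algebra is split if it is isomorphic to a matrix algebra over `F`. -/
def IsSplitAlg (F A : Type) [Field F] [Ring A] [Algebra F A] : Prop :=
  ∃ n : ℕ, 0 < n ∧ Nonempty (A ≃ₐ[F] Matrix (Fin n) (Fin n) F)

/-- Brauer equivalence of two algebras over a field `F`. -/
def IsBrauerEquiv (F A B : Type) [Field F] [Ring A] [Algebra F A] [Ring B] [Algebra F B] :
    Prop :=
  ∃ n m : ℕ, 0 < n ∧ 0 < m ∧
    Nonempty ((Matrix (Fin n) (Fin n) A) ≃ₐ[F] (Matrix (Fin m) (Fin m) B))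

/-- `A` has exponent `e`: `e` is the least positive integer such that the `e`-fold tensor
power of `A` over `F` is split. -/
def HasExponent (F A : Type) [Field F] [Ring A] [Algebra F A] (e : ℕ) : Prop :=
  0 < e ∧ IsSplitAlg F (⨂[F] _ : Fin e, A) ∧
    ∀ k : ℕ, 0 < k → IsSplitAlg F (⨂[F] _ : Fin k, A) → e ≤ k

/-- `A` has (Schur) index `d`: `A` is isomorphic to a matrix algebra over a division
algebra of dimension `d ^ 2` over `F`. -/
def HasIndex (F A : Type) [Field F] [Ring A] [Algebra F A] (d : ℕ) : Prop :=
  ∃ (D : Type) (_ : DivisionRing D) (_ : Algebra F D) (m : ℕ), 0 < m ∧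
    Nonempty (A ≃ₐ[F] Matrix (Fin m) (Fin m) D) ∧ Module.finrank F D = d ^ 2

/-- The (Schur) index of `A` is at most `d`. -/
def IndexLE (F A : Type) [Field F] [Ring A] [Algebra F A] (d : ℕ) : Prop :=
  ∃ e : ℕ, e ≤ d ∧ HasIndex F A e

/-- `A` is the cyclic (symbol) algebra `[a, b)_{p,F}` of degree `p` in characteristic `p`:
it has dimension `p ^ 2` over `F` and is generated by elements `i`, `j` subject to
`i ^ p - i = a`, `j ^ p = b`, `j * i = (i - 1) * j`. -/
def IsCyclicAlgWith (p : ℕ) (F A : Type) [Field F] [Ring A] [Algebra F A] (a b : F) : Prop :=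
  b ≠ 0 ∧ Module.finrank F A = p ^ 2 ∧
    ∃ i j : A, i ^ p - i = algebraMap F A a ∧ j ^ p = algebraMap F A b ∧
      j * i = (i - 1) * j ∧ Algebra.adjoin F {i, j} = ⊤

/-- `A` is a cyclic algebra of degree `p`, i.e. of the form `[a, b)_{p,F}`. -/
def IsCyclicPAlg (p : ℕ) (F A : Type) [Field F] [Ring A] [Algebra F A] : Prop :=
  ∃ a b : F, IsCyclicAlgWith p F A a b

/-- The `p`-symbol length of `A` is at most `m`: `A` is Brauer equivalent to a tensor
product of at most `m` cyclic `F`-algebras of degree `p`. -/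
def SymbolLengthLE (p : ℕ) (F A : Type) [Field F] [Ring A] [Algebra F A] (m : ℕ) : Prop :=
  ∃ k : ℕ, k ≤ m ∧ ∃ (D : Fin k → Type) (_ : ∀ i, Ring (D i)) (_ : ∀ i, Algebra F (D i)),
    (∀ i, IsCyclicPAlg p F (D i)) ∧ IsBrauerEquiv F A (⨂[F] i, D i)

/-- `M` is a compositum `LK` of `L` and `K` over `F`: it is generated as an `F`-algebra by
the images of `L` and `K`. -/
def IsCompositum (F L K M : Type) [Field F] [Field L] [Field K] [Field M]
    [Algebra F L] [Algebra F K] [Algebra F M] [Algebra L M] [Algebra K M]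
    [IsScalarTower F L M] [IsScalarTower F K M] : Prop :=
  (IsScalarTower.toAlgHom F L M).range ⊔ (IsScalarTower.toAlgHom F K M).range = ⊤

/-- A cyclic algebra of degree `m` over `F`: a central simple `F`-algebra of degree `m`
containing a cyclic field extension of `F` of degree `m` (as a maximal subfield). -/
def IsCyclicAlgebra (F A : Type) [Field F] [Ring A] [Algebra F A] (m : ℕ) : Prop :=
  IsCSA F A ∧ Module.finrank F A = m ^ 2 ∧
  ∃ (L : Type) (_ : Field L) (_ : Algebra F L), IsGalois F L ∧ IsCyclic (L ≃ₐ[F] L) ∧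
    Module.finrank F L = m ∧ Nonempty (L →ₐ[F] A)

/-- `L/F` is a `p`-extension: there is a tower of intermediate fields from `F` to `L`
each step of which is a cyclic extension of degree `p`. -/
def IsPExtension (p : ℕ) (F L : Type) [Field F] [Field L] [Algebra F L] : Prop :=
  ∃ (n : ℕ) (T : Fin (n + 1) → IntermediateField F L),
    T 0 = ⊥ ∧ T (Fin.last n) = ⊤ ∧
    ∀ i : Fin n, ∃ h : T i.castSucc ≤ T i.succ,
      IsGalois (T i.castSucc) (IntermediateField.extendScalars h) ∧
      IsCyclic ((IntermediateField.extendScalars h) ≃ₐ[T i.castSucc]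
        (IntermediateField.extendScalars h)) ∧
      Module.finrank (T i.castSucc) (IntermediateField.extendScalars h) = p

/-- `F` is `p`-cyclic reducible: for every central simple `F`-algebra `A` of exponent `p`
and every purely inseparable extension `K/F` with `K ^ p ⊆ F`, either `A_K` is split, or
there is a separable extension `L/F` of degree `ind (A_K) / p` such that `A_{LK}` is
Brauer equivalent to a cyclic `LK`-algebra of degree `p`. -/
def IsPCyclicReducible (p : ℕ) (F : Type) [Field F] : Prop :=
  ∀ (A : Type) [Ring A] [Algebra F A], IsCSA F A → HasExponent F A p →
  ∀ (K : Type) [Field K] [Algebra F K], IsPurelyInseparable F K →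
    (∀ z : K, z ^ p ∈ (algebraMap F K).range) →
    IsSplitAlg K (K ⊗[F] A) ∨
    ∃ d : ℕ, HasIndex K (K ⊗[F] A) (p * d) ∧
      ∃ (L : Type) (_ : Field L) (_ : Algebra F L), Algebra.IsSeparable F L ∧
        Module.finrank F L = d ∧
        ∃ (M : Type) (_ : Field M) (_ : Algebra F M) (_ : Algebra L M) (_ : Algebra K M)
          (_ : IsScalarTower F L M) (_ : IsScalarTower F K M),
          IsCompositum F L K M ∧
          ∃ (C : Type) (_ : Ring C) (_ : Algebra M C),
            IsCyclicPAlg p M C ∧ IsBrauerEquiv M (M ⊗[F] A) C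

/-- `F` is `p`-reducible: for every central simple `F`-algebra `A` of exponent `p`
and every purely inseparable extension `K/F` with `K ^ p ⊆ F`, either `A_K` is split, or
there is a separable extension `L/F` of degree `ind (A_K) / p` with `ind A_{LK} = p`. -/
def IsPReducible (p : ℕ) (F : Type) [Field F] : Prop :=
  ∀ (A : Type) [Ring A] [Algebra F A], IsCSA F A → HasExponent F A p →
  ∀ (K : Type) [Field K] [Algebra F K], IsPurelyInseparable F K →
    (∀ z : K, z ^ p ∈ (algebraMap F K).range) →
    IsSplitAlg K (K ⊗[F] A) ∨
    ∃ d : ℕ, HasIndex K (K ⊗[F] A) (p * d) ∧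
      ∃ (L : Type) (_ : Field L) (_ : Algebra F L), Algebra.IsSeparable F L ∧
        Module.finrank F L = d ∧
        ∃ (M : Type) (_ : Field M) (_ : Algebra F M) (_ : Algebra L M) (_ : Algebra K M)
          (_ : IsScalarTower F L M) (_ : IsScalarTower F K M),
          IsCompositum F L K M ∧ HasIndex M (M ⊗[F] A) p

section Sandwich

variable {F A : Type} [Field F] [Ring A] [Algebra F A]

/-- Central simple algebras are Azumaya. -/
lemma IsCSA.mulLeftRight_bijective (hA : IsCSA F A) :
    Function.Bijective (AlgHom.mulLeftRight F A) := by
  obtain ⟨hc, hs, hf⟩ := hA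
  have hdim : Module.finrank F (A ⊗[F] Aᵐᵒᵖ) = Module.finrank F (Module.End F A) := by
    rw [Module.finrank_tensorProduct, Module.finrank_linearMap,
      (MulOpposite.opLinearEquiv F : A ≃ₗ[F] Aᵐᵒᵖ).finrank_eq]
  suffices hsurj : Function.Surjective (AlgHom.mulLeftRight F A) from
    ⟨(LinearMap.injective_iff_surjective_of_finrank_eq_finrank
      (f := (AlgHom.mulLeftRight F A).toLinearMap) hdim).2 hsurj, hsurj⟩
  intro g
  let R : Subalgebra F (Module.End F A) := (AlgHom.mulLeftRight F A).range
  have hmul : ∀ a b : A, ∃ r : R, ∀ x : A, r • x = a * x * b := fun a b ↦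
    ⟨⟨AlgHom.mulLeftRight F A (a ⊗ₜ MulOpposite.op b), ⟨_, rfl⟩⟩, fun x ↦ by
      change AlgHom.mulLeftRight F A _ x = _
      simp⟩
  have hsimple : IsSimpleModule R A := by
    rw [isSimpleModule_iff, isSimpleOrder_iff]
    refine ⟨⟨⊥, ⊤, ?_⟩, fun N ↦ ?_⟩
    · intro h
      have : (1 : A) ∈ (⊥ : Submodule R A) := h ▸ Submodule.mem_top
      exact one_ne_zero ((Submodule.mem_bot _).1 this)
    · by_cases hN : N = ⊥
      · exact .inl hN
      right
      obtain ⟨x, hxN, hx0⟩ := (Submodule.ne_bot_iff _).1 hN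
      let I : TwoSidedIdeal A := .mk' (N : Set A) N.zero_mem N.add_mem
        (fun {a} ha ↦ by
          obtain ⟨r, hr⟩ := hmul (-1) 1
          simpa [hr] using N.smul_mem r ha)
        (fun {a b} hb ↦ by
          obtain ⟨r, hr⟩ := hmul a 1
          simpa [hr] using N.smul_mem r hb)
        (fun {a b} hb ↦ by
          obtain ⟨r, hr⟩ := hmul 1 b
          simpa [hr] using N.smul_mem r hb)
      have hI : ∀ y, y ∈ I ↔ y ∈ N := fun y ↦ TwoSidedIdeal.mem_mk' ..
      have h1 : I = ⊤ := (eq_bot_or_eq_top I).resolve_left fun h ↦ by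
        have := (hI x).2 hxN
        rw [h] at this
        exact hx0 this
      rw [eq_top_iff]
      intro y _
      rw [← hI, h1]
      trivial
  have hcomm : ∀ h : Module.End R A, ∃ c : F, ∀ x, h x = c • x := by
    intro h
    have hl : ∀ x, h x = x * h 1 := fun x ↦ by
      obtain ⟨r, hr⟩ := hmul x 1
      have := h.map_smul r 1
      simpa [hr] using this
    have hr : ∀ x, h x = h 1 * x := fun x ↦ by
      obtain ⟨r, hr⟩ := hmul 1 x
      have := h.map_smul r 1
      simpa [hr] using this
    have : h 1 ∈ Subalgebra.center F A :=
      Subalgebra.mem_center_iff.2 fun b ↦ by rw [← hl, hr]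
    obtain ⟨c, hc⟩ := Algebra.mem_bot.1 (hc.out this)
    exact ⟨c, fun x ↦ by rw [hr, ← hc, Algebra.smul_def]⟩
  let g' : Module.End (Module.End R A) A :=
    { toFun := g
      map_add' := g.map_add
      map_smul' := fun h x ↦ by
        obtain ⟨c, hc⟩ := hcomm h
        simp [hc] }
  classical
  obtain ⟨r, hr⟩ := jacobson_density (R := R) g'
    (Finset.univ.image (Module.finBasis F A))
  have hrg : (r : Module.End F A) = g := (Module.finBasis F A).ext fun i ↦
    (hr _ (by simp)).symm
  obtain ⟨τ, hτ⟩ := r.2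
  exact ⟨τ, hτ.trans hrg⟩

/-- Every linear endomorphism of a central simple algebra is a sum of two-sided multiplications. -/
lemma IsCSA.exists_sandwich (hA : IsCSA F A) (g : A →ₗ[F] A) :
    ∃ S : Finset (A × A), ∀ x, ∑ s ∈ S, s.1 * x * s.2 = g x := by
  obtain ⟨τ, hτ⟩ := hA.mulLeftRight_bijective.2 g
  obtain ⟨S, rfl⟩ := TensorProduct.exists_finset τ
  refine ⟨S.map ⟨fun s ↦ (s.1, s.2.unop), fun s t h ↦ ?_⟩, fun x ↦ ?_⟩
  · simpa [Prod.ext_iff] using h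
  · rw [← hτ, Finset.sum_map, map_sum, LinearMap.sum_apply]
    exact Finset.sum_congr rfl fun s _ ↦ by rw [AlgHom.mulLeftRight_apply]; rfl

lemma IsCSA.exists_sandwich_functional (hA : IsCSA F A) (l : A →ₗ[F] F) :
    ∃ S : Finset (A × A), ∀ x, ∑ s ∈ S, s.1 * x * s.2 = algebraMap F A (l x) :=
  hA.exists_sandwich ((Algebra.linearMap F A).comp l)

variable {B : Type} [Ring B] [Algebra F B]

lemma sandwich_tensor {l : A →ₗ[F] F} {S : Finset (A × A)}
    (hS : ∀ x, ∑ s ∈ S, s.1 * x * s.2 = algebraMap F A (l x)) (z : A ⊗[F] B) :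
    ∑ s ∈ S, (s.1 ⊗ₜ 1) * z * (s.2 ⊗ₜ 1) = (1 : A) ⊗ₜ[F] TensorProduct.lid F B (l.rTensor B z) := by
  induction z with
  | zero => simp
  | add x y hx hy => simp [mul_add, add_mul, Finset.sum_add_distrib, hx, hy, TensorProduct.tmul_add]
  | tmul a b =>
    simp [← TensorProduct.sum_tmul, hS, Algebra.algebraMap_eq_smul_one, TensorProduct.smul_tmul]

lemma IsCSA.isSimpleRing_tensor (hA : IsCSA F A) [IsSimpleRing B] : IsSimpleRing (A ⊗[F] B) := by
  have hs := hA.2.1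
  have hf := hA.2.2
  refine ⟨⟨fun I ↦ ?_⟩⟩
  by_cases hI : I = ⊥
  · exact .inl hI
  right
  obtain ⟨z, hz, hz0⟩ : ∃ z ∈ I, z ≠ 0 := by
    by_contra! h
    exact hI (le_bot_iff.1 fun x hx ↦ h x hx)
  let b := Module.finBasis F A
  obtain ⟨i, hi⟩ : ∃ i, TensorProduct.lid F B ((b.coord i).rTensor B z) ≠ 0 := by
    by_contra! h
    apply hz0
    apply (TensorProduct.equivFinsuppOfBasisLeft b).injective
    ext i
    rw [TensorProduct.equivFinsuppOfBasisLeft_apply]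
    simp [h]
  obtain ⟨S, hS⟩ := hA.exists_sandwich_functional (b.coord i)
  have h1 : (1 : A) ⊗ₜ[F] TensorProduct.lid F B ((b.coord i).rTensor B z) ∈ I := by
    rw [← sandwich_tensor hS]
    exact sum_mem fun s _ ↦ I.mul_mem_right _ _ (I.mul_mem_left _ _ hz)
  have h2 : I.comap (Algebra.TensorProduct.includeRight : B →ₐ[F] A ⊗[F] B) = ⊤ := by
    refine (eq_bot_or_eq_top _).resolve_left fun h ↦ hi ?_
    have : TensorProduct.lid F B ((b.coord i).rTensor B z) ∈
      I.comap (Algebra.TensorProduct.includeRight : B →ₐ[F] A ⊗[F] B) := by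
      rw [TwoSidedIdeal.mem_comap]
      exact h1
    rw [h] at this
    exact this
  have h3 : (1 : B) ∈ I.comap (Algebra.TensorProduct.includeRight : B →ₐ[F] A ⊗[F] B) := by
    rw [h2]; trivial
  rw [TwoSidedIdeal.mem_comap, map_one] at h3
  exact TwoSidedIdeal.one_mem_iff _ |>.1 h3

/-- The centralizer of `A ⊗ 1` in `A ⊗ B` is `1 ⊗ B`. -/
lemma IsCSA.exists_eq_one_tmul (hA : IsCSA F A) {z : A ⊗[F] B}
    (hz : ∀ a : A, a ⊗ₜ 1 * z = z * a ⊗ₜ 1) : ∃ b : B, z = (1 : A) ⊗ₜ b := by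
  have := hA.2.1
  obtain ⟨l, hl⟩ := Module.Projective.exists_dual_eq_one F (one_ne_zero : (1 : A) ≠ 0)
  obtain ⟨S, hS⟩ := hA.exists_sandwich_functional l
  refine ⟨_, Eq.trans ?_ (sandwich_tensor hS z)⟩
  have h1 := hS 1
  simp only [mul_one, hl, map_one] at h1
  have : ∑ s ∈ S, (s.1 ⊗ₜ[F] (1 : B)) * z * (s.2 ⊗ₜ 1) =
      z * ((∑ s ∈ S, s.1 * s.2) ⊗ₜ[F] (1 : B)) := by
    simp [hz, TensorProduct.sum_tmul, Finset.mul_sum, mul_assoc]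
  rw [this, h1, ← Algebra.TensorProduct.one_def, mul_one]

end Sandwich

section CSA

variable {F A B : Type} [Field F] [Ring A] [Algebra F A] [Ring B] [Algebra F B]

lemma IsCSA.tensor (hA : IsCSA F A) (hB : IsCSA F B) : IsCSA F (A ⊗[F] B) := by
  have := hA.2.1
  have := hB.2.1
  have := hA.2.2
  have := hB.2.2
  refine ⟨⟨fun z hz ↦ ?_⟩, hA.isSimpleRing_tensor, inferInstance⟩
  rw [Subalgebra.mem_center_iff] at hz
  obtain ⟨b, rfl⟩ := hA.exists_eq_one_tmul fun a ↦ hz (a ⊗ₜ 1)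
  have hb : b ∈ Subalgebra.center F B := Subalgebra.mem_center_iff.2 fun c ↦ by
    have := hz (1 ⊗ₜ c)
    simp only [Algebra.TensorProduct.tmul_mul_tmul, mul_one] at this
    exact Algebra.TensorProduct.includeRight_injective
      (FaithfulSMul.algebraMap_injective F A) this
  obtain ⟨c, rfl⟩ := Algebra.mem_bot.1 (hB.1.out hb)
  refine Algebra.mem_bot.2 ⟨c, ?_⟩
  simp [Algebra.algebraMap_eq_smul_one, Algebra.TensorProduct.one_def]

lemma IsCSA.baseChange (hA : IsCSA F A) (E : Type) [Field E] [Algebra F E] :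
    IsCSA E (E ⊗[F] A) := by
  have := hA.2.1
  have := hA.2.2
  have : IsSimpleRing (A ⊗[F] E) := hA.isSimpleRing_tensor
  refine ⟨⟨fun z hz ↦ ?_⟩, .of_ringEquiv (Algebra.TensorProduct.comm F A E).toRingEquiv this,
    inferInstance⟩
  rw [Subalgebra.mem_center_iff] at hz
  obtain ⟨b, hb⟩ := hA.exists_eq_one_tmul (z := Algebra.TensorProduct.comm F E A z) fun a ↦ by
    have := congr(Algebra.TensorProduct.comm F E A $(hz (1 ⊗ₜ a)))
    simpa only [map_mul, Algebra.TensorProduct.comm_tmul] using this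
  refine Algebra.mem_bot.2 ⟨b, (Algebra.TensorProduct.comm F E A).injective ?_⟩
  rw [hb]
  simp [Algebra.TensorProduct.algebraMap_apply]

lemma IsCSA.of_algEquiv (hA : IsCSA F A) (e : A ≃ₐ[F] B) : IsCSA F B :=
  have := hA.1
  have := hA.2.2
  ⟨.of_algEquiv F A B e, .of_ringEquiv e.toRingEquiv hA.2.1, .equiv e.toLinearEquiv⟩

lemma IsCSA.matrix (hA : IsCSA F A) (n : ℕ) (hn : 0 < n) : IsCSA F (Matrix (Fin n) (Fin n) A) :=
  have := hA.1
  have := hA.2.1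
  have := hA.2.2
  have : Nonempty (Fin n) := ⟨⟨0, hn⟩⟩
  ⟨inferInstance, inferInstance, inferInstance⟩

lemma IsCSA.mulOpposite (hA : IsCSA F A) : IsCSA F Aᵐᵒᵖ :=
  have := hA.1
  have := hA.2.1
  have := hA.2.2
  ⟨inferInstance, inferInstance, inferInstance⟩

lemma IsCSA.self (F : Type) [Field F] : IsCSA F F :=
  ⟨inferInstance, inferInstance, inferInstance⟩

lemma AlgHom.bijective_of_finrank_le [IsSimpleRing A] [Nontrivial B] [FiniteDimensional F B]
    (f : A →ₐ[F] B) (h : Module.finrank F B ≤ Module.finrank F A) : Function.Bijective f := by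
  have hinj : Function.Injective f := RingHom.injective f.toRingHom
  have : FiniteDimensional F A := .of_injective f.toLinearMap hinj
  have := LinearMap.finrank_le_finrank_of_injective (f := f.toLinearMap) hinj
  exact ⟨hinj, (LinearMap.injective_iff_surjective_of_finrank_eq_finrank
    (f := f.toLinearMap) (by omega)).1 hinj⟩

lemma isSplitAlg_of_algHom_end [IsSimpleRing A] {V : Type} [AddCommGroup V] [Module F V]
    [FiniteDimensional F V] [Nontrivial V] (f : A →ₐ[F] Module.End F V)
    (h : Module.finrank F V ^ 2 ≤ Module.finrank F A) : IsSplitAlg F A :=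
  ⟨Module.finrank F V, Module.finrank_pos,
    ⟨(AlgEquiv.ofBijective f (f.bijective_of_finrank_le (by
        rwa [Module.finrank_linearMap, ← pow_two]))).trans
      (algEquivMatrix (Module.finBasis F V))⟩⟩

lemma IsSplitAlg.of_algEquiv (hA : IsSplitAlg F A) (e : A ≃ₐ[F] B) : IsSplitAlg F B :=
  let ⟨n, hn, ⟨f⟩⟩ := hA
  ⟨n, hn, ⟨e.symm.trans f⟩⟩

/-- The double centralizer decomposition: a central simple subalgebra is a tensor factor. -/
lemma IsCSA.exists_tensor_centralizer_equiv (hA : IsCSA F A) [Nontrivial B] [FiniteDimensional F B]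
    (f : A →ₐ[F] B) :
    Nonempty (A ⊗[F] Subalgebra.centralizer F (f.range : Set B) ≃ₐ[F] B) := by
  have := hA.2.1
  have := hA.2.2
  set C := Subalgebra.centralizer F (f.range : Set B) with hC
  have hCmem : ∀ c : B, c ∈ C ↔ ∀ a, f a * c = c * f a := fun c ↦ by
    simp [hC, Subalgebra.mem_centralizer_iff]
  let g : A ⊗[F] C →ₐ[F] B := Algebra.TensorProduct.lift f C.val fun a c ↦ (hCmem c).1 c.2 a
  have hg : ∀ a c, g (a ⊗ₜ c) = f a * c := fun a c ↦ Algebra.TensorProduct.lift_tmul ..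
  let b := Module.finBasis F A
  refine ⟨AlgEquiv.ofBijective g ⟨?_, ?_⟩⟩
  · rw [injective_iff_map_eq_zero]
    intro z hz
    apply (TensorProduct.equivFinsuppOfBasisLeft b).injective
    ext i
    rw [TensorProduct.equivFinsuppOfBasisLeft_apply]
    obtain ⟨S, hS⟩ := hA.exists_sandwich_functional (b.coord i)
    have := congr(g $(sandwich_tensor hS z))
    rw [map_sum, Finset.sum_eq_zero (by simp [hz])] at this
    rw [hg, map_one, one_mul] at this
    simpa using this.symm
  · intro x
    let T : A ⊗[F] Aᵐᵒᵖ →ₐ[F] Module.End F B :=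
      (AlgHom.mulLeftRight F B).comp (Algebra.TensorProduct.map f (AlgHom.op f))
    have hT : ∀ a c y, T (a ⊗ₜ c) y = f a * y * f c.unop := fun a c y ↦ by simp [T]
    choose τ hτ using fun i ↦ hA.mulLeftRight_bijective.2
      ((Algebra.linearMap F A).comp (b.coord i))
    have hcen : ∀ i, T (τ i) x ∈ C := fun i ↦ (hCmem _).2 fun a ↦ by
      have : (a ⊗ₜ[F] (1 : Aᵐᵒᵖ)) * τ i = ((1 : A) ⊗ₜ[F] MulOpposite.op a) * τ i := by
        apply hA.mulLeftRight_bijective.1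
        ext y
        simp only [map_mul, hτ, Module.End.mul_apply, AlgHom.mulLeftRight_apply]
        simp [Algebra.commutes]
      have := congr(T $this x)
      simpa only [map_mul, Module.End.mul_apply, hT, MulOpposite.unop_one, map_one, mul_one,
        one_mul, MulOpposite.unop_op] using this
    have hsum : ∑ i, (b i ⊗ₜ[F] (1 : Aᵐᵒᵖ)) * τ i = 1 := by
      apply hA.mulLeftRight_bijective.1
      ext y
      simp only [map_sum, map_mul, hτ, LinearMap.sum_apply, Module.End.mul_apply,
        AlgHom.mulLeftRight_apply, map_one, Module.End.one_apply]
      conv_rhs => rw [← b.sum_repr y]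
      simp [Algebra.smul_def, Algebra.commutes]
    refine ⟨∑ i, b i ⊗ₜ ⟨T (τ i) x, hcen i⟩, ?_⟩
    have := congr(T $hsum x)
    simpa [hg, hT] using this

end CSA

section Brauer

variable {F A B : Type} [Field F] [Ring A] [Algebra F A] [Ring B] [Algebra F B]

lemma isSimpleRing_right_of_tensor [IsSimpleRing (A ⊗[F] B)] [Nontrivial A] : IsSimpleRing B := by
  have hB : Nontrivial B := by
    by_contra h
    rw [not_nontrivial_iff_subsingleton] at h
    have : (1 : A ⊗[F] B) = 0 := by
      rw [Algebra.TensorProduct.one_def, Subsingleton.elim (1 : B) 0, TensorProduct.tmul_zero]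
    exact one_ne_zero this
  refine ⟨⟨fun I ↦ ?_⟩⟩
  by_cases hI : I = ⊤
  · exact .inr hI
  left
  let q : B →ₐ[F] I.ringCon.Quotient := I.ringCon.mkₐ F
  have hq : Function.Surjective q := Quot.mk_surjective
  have hnt : Nontrivial I.ringCon.Quotient := by
    by_contra h
    rw [not_nontrivial_iff_subsingleton] at h
    apply hI
    rw [eq_top_iff]
    intro x _
    exact (RingCon.eq _).1 (Subsingleton.elim (q x) (q 0))
  let g : A ⊗[F] B →ₐ[F] A ⊗[F] I.ringCon.Quotient := Algebra.TensorProduct.map (.id F A) q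
  have hg : Function.Injective g := RingHom.injective g.toRingHom
  have hq' : Function.Injective q := fun x y h ↦ by
    have : (1 : A) ⊗ₜ[F] x = 1 ⊗ₜ y := hg (by simp [g, h])
    exact Algebra.TensorProduct.includeRight_injective
      (FaithfulSMul.algebraMap_injective F A) this
  rw [eq_bot_iff]
  intro x hx
  exact hq' ((RingCon.eq _).2 hx)

lemma IsCSA.right_of_tensor (hA : IsCSA F A) (h : IsCSA F (A ⊗[F] B)) : IsCSA F B := by
  have := hA.2.1
  have := h.1
  have := h.2.1
  have := h.2.2
  have hB : IsSimpleRing B := isSimpleRing_right_of_tensor (F := F) (A := A)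
  refine ⟨.right_of_tensor_of_field F A B, hB, ?_⟩
  exact .of_injective (Algebra.TensorProduct.includeRight : B →ₐ[F] A ⊗[F] B).toLinearMap
    (Algebra.TensorProduct.includeRight_injective (FaithfulSMul.algebraMap_injective F A))

/-- The Brauer group of `F`. -/
def Br (F : Type) [Field F] : Type 1 := BrauerGroup.{0, 0} F

/-- The Brauer class of a central simple algebra. -/
def IsCSA.br (hA : IsCSA F A) : Br F :=
  letI := hA.1
  letI := hA.2.1
  letI := hA.2.2
  Quotient.mk (Brauer.CSA_Setoid F) { toAlgCat := AlgCat.of F A }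

lemma IsCSA.br_eq_iff (hA : IsCSA F A) (hB : IsCSA F B) :
    hA.br = hB.br ↔ IsBrauerEquiv F A B := by
  refine Quotient.eq.trans ⟨?_, ?_⟩
  · rintro ⟨n, m, hn, hm, h⟩
    exact ⟨n, m, by omega, by omega, h⟩
  · rintro ⟨n, m, hn, hm, h⟩
    exact ⟨n, m, by omega, by omega, h⟩

lemma IsCSA.br_eq_of_algEquiv (hA : IsCSA F A) (hB : IsCSA F B) (e : A ≃ₐ[F] B) :
    hA.br = hB.br :=
  (hA.br_eq_iff hB).2 ⟨1, 1, one_pos, one_pos, ⟨e.mapMatrix⟩⟩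

lemma Br.exists_rep (x : Br F) :
    ∃ (A : Type) (_ : Ring A) (_ : Algebra F A) (hA : IsCSA F A), hA.br = x := by
  obtain ⟨A, rfl⟩ := Quotient.exists_rep x
  exact ⟨A, inferInstance, inferInstance, ⟨A.isCentral, A.isSimple, A.fin_dim⟩, rfl⟩

lemma IsCSA.matrix_self (F : Type) [Field F] (n : ℕ) (hn : 0 < n) :
    IsCSA F (Matrix (Fin n) (Fin n) F) := (IsCSA.self F).matrix n hn

lemma IsBrauerEquiv.tensor {A' B' : Type} [Ring A'] [Algebra F A'] [Ring B'] [Algebra F B']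
    (hA : IsBrauerEquiv F A A') (hB : IsBrauerEquiv F B B') :
    IsBrauerEquiv F (A ⊗[F] B) (A' ⊗[F] B') := by
  obtain ⟨n, m, hn, hm, ⟨e⟩⟩ := hA
  obtain ⟨n', m', hn', hm', ⟨e'⟩⟩ := hB
  have key : ∀ (n n' : ℕ) (A B : Type) [Ring A] [Algebra F A] [Ring B] [Algebra F B],
      Nonempty (Matrix (Fin (n * n')) (Fin (n * n')) (A ⊗[F] B) ≃ₐ[F]
        Matrix (Fin n) (Fin n) A ⊗[F] Matrix (Fin n') (Fin n') B) := by
    intro n n' A B _ _ _ _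
    exact ⟨(Matrix.reindexAlgEquiv F _ finProdFinEquiv).symm.trans
      (Matrix.kroneckerTMulAlgEquiv (Fin n) (Fin n') F F A B).symm⟩
  obtain ⟨k1⟩ := key n n' A B
  obtain ⟨k2⟩ := key m m' A' B'
  exact ⟨n * n', m * m', by positivity, by positivity,
    ⟨k1.trans ((Algebra.TensorProduct.congr e e').trans k2.symm)⟩⟩

lemma IsBrauerEquiv.baseChange (h : IsBrauerEquiv F A B) (E : Type) [Field E] [Algebra F E] :
    IsBrauerEquiv E (E ⊗[F] A) (E ⊗[F] B) := by
  obtain ⟨n, m, hn, hm, ⟨e⟩⟩ := h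
  have key : ∀ (n : ℕ) (A : Type) [Ring A] [Algebra F A],
      Nonempty (E ⊗[F] Matrix (Fin n) (Fin n) A ≃ₐ[E] Matrix (Fin n) (Fin n) (E ⊗[F] A)) := by
    intro n A _ _
    exact ⟨(Algebra.TensorProduct.congr (Matrix.uniqueAlgEquiv (m := Unit) (R := E)).symm
      AlgEquiv.refl).trans ((Matrix.kroneckerTMulAlgEquiv Unit (Fin n) F E E A).trans
        (Matrix.reindexAlgEquiv E _ (Equiv.punitProd _)))⟩
  obtain ⟨k1⟩ := key n A
  obtain ⟨k2⟩ := key m B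
  exact ⟨n, m, hn, hm, ⟨k1.symm.trans ((Algebra.TensorProduct.congr AlgEquiv.refl e).trans k2)⟩⟩

lemma IsSplitAlg.isBrauerEquiv (h : IsSplitAlg F A) : IsBrauerEquiv F A F := by
  obtain ⟨n, hn, ⟨e⟩⟩ := h
  exact ⟨1, n, one_pos, hn, ⟨(Matrix.reindexAlgEquiv F A (Equiv.ofUnique (Fin 1) Unit)).trans
    ((Matrix.uniqueAlgEquiv (m := Unit) (R := F)).trans e)⟩⟩

/-- A representation of a matrix algebra over `A` comes from a representation of `A`. -/
lemma exists_corner_representation {n : ℕ} (hn : 0 < n) {V : Type} [AddCommGroup V] [Module F V]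
    [FiniteDimensional F V] (φ : Matrix (Fin n) (Fin n) A →ₐ[F] Module.End F V) :
    ∃ W : Submodule F V, n * Module.finrank F W = Module.finrank F V ∧
      Nonempty (A →ₐ[F] Module.End F W) := by
  let o : Fin n := ⟨0, hn⟩
  let W : Submodule F V := LinearMap.range (φ (Matrix.single o o 1))
  have hW : ∀ i (a : A) (v : V), φ (Matrix.single o i a) v ∈ W := fun i a v ↦ by
    have : Matrix.single o i a = Matrix.single o o 1 * Matrix.single o i a := by simp
    rw [this, map_mul]
    exact ⟨_, rfl⟩
  have hWid : ∀ w ∈ W, φ (Matrix.single o o 1) w = w := by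
    rintro _ ⟨v, rfl⟩
    rw [← Module.End.mul_apply, ← map_mul]
    simp
  let L : (Fin n → W) ≃ₗ[F] V := LinearEquiv.ofLinearMap
    (∑ i, (φ (Matrix.single i o 1)).comp (W.subtype.comp (LinearMap.proj i)))
    (LinearMap.pi fun i ↦ (φ (Matrix.single o i 1)).codRestrict W (hW i 1))
    (by
      refine LinearMap.ext fun v ↦ ?_
      simp only [LinearMap.comp_apply, LinearMap.sum_apply, LinearMap.pi_apply,
        LinearMap.proj_apply, Submodule.subtype_apply, LinearMap.codRestrict_apply,
        LinearMap.id_apply]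
      simp only [← Module.End.mul_apply, ← map_mul, Matrix.single_mul_single_same, mul_one]
      rw [← LinearMap.sum_apply, ← map_sum, Matrix.sum_single_eq_diagonal]
      simp)
    (by
      refine LinearMap.ext fun w ↦ funext fun i ↦ Subtype.ext ?_
      simp only [LinearMap.comp_apply, LinearMap.sum_apply, LinearMap.pi_apply,
        LinearMap.proj_apply, Submodule.subtype_apply, LinearMap.id_apply, map_sum]
      simp only [Submodule.coe_sum, LinearMap.codRestrict_apply, ← Module.End.mul_apply, ← map_mul]
      rw [Finset.sum_eq_single i]
      · simp [hWid]
      · intro j _ hj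
        rw [Matrix.single_mul_single_of_ne _ _ _ _ hj.symm, map_zero, LinearMap.zero_apply]
      · simp)
  refine ⟨W, ?_, ⟨AlgHom.ofLinearMap
    { toFun := fun a ↦ ((φ (Matrix.single o o a)).comp W.subtype).codRestrict W fun w ↦ hW o a w
      map_add' := fun a b ↦ by
        refine LinearMap.ext fun w ↦ Subtype.ext ?_
        change φ (Matrix.single o o (a + b)) w =
          φ (Matrix.single o o a) w + φ (Matrix.single o o b) w
        rw [Matrix.single_add, map_add, LinearMap.add_apply]
      map_smul' := fun c a ↦ by
        refine LinearMap.ext fun w ↦ Subtype.ext ?_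
        change φ (Matrix.single o o (c • a)) w = c • φ (Matrix.single o o a) w
        rw [← Matrix.smul_single, map_smul, LinearMap.smul_apply] }
    (by
      refine LinearMap.ext fun w ↦ Subtype.ext ?_
      exact hWid _ w.2)
    (fun a b ↦ by
      refine LinearMap.ext fun w ↦ Subtype.ext ?_
      change φ (Matrix.single o o (a * b)) w =
        φ (Matrix.single o o a) (φ (Matrix.single o o b) w)
      rw [← Module.End.mul_apply, ← map_mul, Matrix.single_mul_single_same])⟩⟩
  have := L.finrank_eq
  simpa [Module.finrank_pi_fintype] using this

/-- If a matrix algebra over `A` is split then so is `A`. -/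
lemma IsBrauerEquiv.isSplitAlg [IsSimpleRing A] (h : IsBrauerEquiv F A F) : IsSplitAlg F A := by
  obtain ⟨n, m, hn, hm, ⟨e⟩⟩ := h
  have hdim : n ^ 2 * Module.finrank F A = m ^ 2 := by
    have := e.toLinearEquiv.finrank_eq
    rw [Module.finrank_matrix, Module.finrank_matrix] at this
    simpa [pow_two, mul_comm] using this
  obtain ⟨W, hW, ⟨ψ⟩⟩ := exists_corner_representation hn
    ((Matrix.toLinAlgEquiv' : _ ≃ₐ[F] _).toAlgHom.comp e.toAlgHom)
  rw [Module.finrank_fin_fun] at hW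
  have hWpos : 0 < Module.finrank F W := by
    by_contra h
    rw [Nat.eq_zero_of_not_pos h] at hW
    omega
  have : Nontrivial W := Module.finrank_pos_iff.1 hWpos
  refine isSplitAlg_of_algHom_end ψ (le_of_eq ?_)
  have : n ^ 2 * Module.finrank F W ^ 2 = n ^ 2 * Module.finrank F A := by
    rw [hdim, ← mul_pow, hW]
  exact Nat.eq_of_mul_eq_mul_left (by positivity) this

lemma IsCSA.br_eq_br_self_iff (hA : IsCSA F A) : hA.br = (IsCSA.self F).br ↔ IsSplitAlg F A := by
  have := hA.2.1
  rw [IsCSA.br_eq_iff]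
  exact ⟨fun h ↦ h.isSplitAlg, fun h ↦ h.isBrauerEquiv⟩

lemma CSA.isCSA (A : CSA.{0, 0} F) : IsCSA F A := ⟨A.isCentral, A.isSimple, A.fin_dim⟩

/-- A central simple algebra representing a Brauer class. -/
noncomputable def Br.out (x : Br F) : CSA.{0, 0} F := Quotient.out (s := Brauer.CSA_Setoid F) x

lemma Br.out_br (x : Br F) : x.out.isCSA.br = x := Quotient.out_eq (s := Brauer.CSA_Setoid F) x

noncomputable instance : Mul (Br F) :=
  ⟨fun x y ↦ (x.out.isCSA.tensor y.out.isCSA).br⟩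

lemma IsCSA.tensor_br (hA : IsCSA F A) (hB : IsCSA F B) :
    (hA.tensor hB).br = hA.br * hB.br := by
  refine (IsCSA.br_eq_iff _ _).2 (.tensor ((hA.br_eq_iff (CSA.isCSA _)).1 ?_)
    ((hB.br_eq_iff (CSA.isCSA _)).1 ?_))
  · exact (Br.out_br _).symm
  · exact (Br.out_br _).symm

noncomputable instance : CommMonoid (Br F) where
  one := (IsCSA.self F).br
  mul_assoc x y z := by
    obtain ⟨A, _, _, hA, rfl⟩ := x.exists_rep
    obtain ⟨B, _, _, hB, rfl⟩ := y.exists_rep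
    obtain ⟨C, _, _, hC, rfl⟩ := z.exists_rep
    simp only [← IsCSA.tensor_br]
    exact IsCSA.br_eq_of_algEquiv _ _ (Algebra.TensorProduct.assoc F F F A B C)
  one_mul x := by
    obtain ⟨A, _, _, hA, rfl⟩ := x.exists_rep
    refine ((IsCSA.self F).tensor_br hA).symm.trans ?_
    exact IsCSA.br_eq_of_algEquiv _ _ (Algebra.TensorProduct.lid F A)
  mul_one x := by
    obtain ⟨A, _, _, hA, rfl⟩ := x.exists_rep
    refine (hA.tensor_br (IsCSA.self F)).symm.trans ?_
    exact IsCSA.br_eq_of_algEquiv _ _ (Algebra.TensorProduct.rid F F A)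
  mul_comm x y := by
    obtain ⟨A, _, _, hA, rfl⟩ := x.exists_rep
    obtain ⟨B, _, _, hB, rfl⟩ := y.exists_rep
    simp only [← IsCSA.tensor_br]
    exact IsCSA.br_eq_of_algEquiv _ _ (Algebra.TensorProduct.comm F A B)

lemma IsCSA.br_eq_one_iff (hA : IsCSA F A) : hA.br = 1 ↔ IsSplitAlg F A := hA.br_eq_br_self_iff

lemma IsCSA.mulOpposite_br_mul (hA : IsCSA F A) : hA.mulOpposite.br * hA.br = 1 := by
  rw [mul_comm, ← hA.tensor_br, IsCSA.br_eq_one_iff]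
  have := hA.2.1
  have := hA.2.2
  have := (hA.tensor hA.mulOpposite).2.1
  refine isSplitAlg_of_algHom_end (V := A) (AlgHom.mulLeftRight F A) (le_of_eq ?_)
  rw [Module.finrank_tensorProduct, (MulOpposite.opLinearEquiv F : A ≃ₗ[F] Aᵐᵒᵖ).finrank_eq, pow_two]

lemma Br.exists_mul_eq_one (x : Br F) : ∃ y, y * x = 1 := by
  obtain ⟨A, _, _, hA, rfl⟩ := x.exists_rep
  exact ⟨_, hA.mulOpposite_br_mul⟩

noncomputable instance : CommGroup (Br F) where
  inv x := x.exists_mul_eq_one.choose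
  inv_mul_cancel x := x.exists_mul_eq_one.choose_spec

lemma IsCSA.mulOpposite_br (hA : IsCSA F A) : hA.mulOpposite.br = hA.br⁻¹ :=
  eq_inv_of_mul_eq_one_left hA.mulOpposite_br_mul

/-- `X ⊗[E] (E ⊗[F] B) ≃ X ⊗[F] B` for a possibly noncommutative `E`-algebra `X`. -/
noncomputable def cancelBaseChangeAlgEquiv (F E L X B : Type) [Field F] [Field E] [Field L]
    [Algebra F E] [Algebra F L] [Algebra E L] [Ring X] [Algebra F X] [Algebra E X] [Algebra L X]
    [IsScalarTower F E X] [IsScalarTower F L X] [IsScalarTower E L X] [Ring B] [Algebra F B] :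
    X ⊗[E] (E ⊗[F] B) ≃ₐ[L] X ⊗[F] B :=
  AlgEquiv.symm <| AlgEquiv.ofLinearEquiv
    (TensorProduct.AlgebraTensorModule.cancelBaseChange F E L X B).symm
    (by simp [Algebra.TensorProduct.one_def]) <|
      LinearMap.map_mul_of_map_mul_tmul (fun _ _ _ _ ↦ by simp)

/-- Extension of scalars on Brauer groups. -/
noncomputable def Br.res (E : Type) [Field E] [Algebra F E] : Br F →* Br E where
  toFun x := (x.out.isCSA.baseChange E).br
  map_one' := by
    refine (IsCSA.br_eq_one_iff _).2 ?_
    have h := (1 : Br F).out.isCSA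
    have hs : IsBrauerEquiv F (1 : Br F).out F :=
      (h.br_eq_iff (IsCSA.self F)).1 (Br.out_br _)
    have h2 := (h.baseChange E)
    have := h2.2.1
    obtain ⟨n, m, hn, hm, ⟨e⟩⟩ := hs.baseChange E
    exact IsBrauerEquiv.isSplitAlg
      ⟨n, m, hn, hm, ⟨e.trans (Algebra.TensorProduct.rid F E E).mapMatrix⟩⟩
  map_mul' x y := by
    rw [← IsCSA.tensor_br]
    refine (IsCSA.br_eq_iff _ _).2 ?_
    have : IsBrauerEquiv F (x * y).out (x.out ⊗[F] y.out) := by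
      refine ((CSA.isCSA _).br_eq_iff ((CSA.isCSA _).tensor (CSA.isCSA _))).1 ?_
      exact Br.out_br _
    obtain ⟨n, m, hn, hm, ⟨e⟩⟩ := this.baseChange E
    exact ⟨n, m, hn, hm, ⟨e.trans (((Algebra.TensorProduct.assoc F F E E x.out y.out).symm.trans
      (cancelBaseChangeAlgEquiv F E E (E ⊗[F] x.out) y.out).symm).mapMatrix)⟩⟩

lemma Br.res_br (hA : IsCSA F A) (E : Type) [Field E] [Algebra F E] :
    Br.res E hA.br = (hA.baseChange E).br :=
  (IsCSA.br_eq_iff ((CSA.isCSA _).baseChange E) _).2 (IsBrauerEquiv.baseChange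
    (((CSA.isCSA _).br_eq_iff hA).1 (Br.out_br _)) E)

lemma Br.res_br_eq_one_iff (hA : IsCSA F A) (E : Type) [Field E] [Algebra F E] :
    Br.res E hA.br = 1 ↔ IsSplitAlg E (E ⊗[F] A) := by
  rw [Br.res_br, IsCSA.br_eq_one_iff]

lemma Br.res_res (E L : Type) [Field E] [Field L] [Algebra F E] [Algebra F L] [Algebra E L]
    [IsScalarTower F E L] (x : Br F) : Br.res L (Br.res E x) = Br.res L x := by
  obtain ⟨A, _, _, hA, rfl⟩ := x.exists_rep
  simp only [Br.res_br]
  exact IsCSA.br_eq_of_algEquiv _ _ (cancelBaseChangeAlgEquiv F E L L A)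

lemma Br.res_eq_one_of_algHom {E L : Type} [Field E] [Field L] [Algebra F E] [Algebra F L]
    (f : E →ₐ[F] L) {x : Br F} (hx : Br.res E x = 1) : Br.res L x = 1 := by
  let := f.toRingHom.toAlgebra
  have : IsScalarTower F E L := .of_algHom f
  rw [← Br.res_res E L, hx, map_one]

/-- The centralizer of a central simple subalgebra of a central simple algebra. -/
lemma IsCSA.centralizer (hA : IsCSA F A) (hB : IsCSA F B) (f : A →ₐ[F] B) :
    ∃ h : IsCSA F (Subalgebra.centralizer F (f.range : Set B)), hA.br * h.br = hB.br ∧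
      Module.finrank F A * Module.finrank F (Subalgebra.centralizer F (f.range : Set B)) =
        Module.finrank F B := by
  have := hB.2.1
  have := hB.2.2
  obtain ⟨e⟩ := hA.exists_tensor_centralizer_equiv f
  have h := hA.right_of_tensor (hB.of_algEquiv e.symm)
  refine ⟨h, ?_, ?_⟩
  · rw [← hA.tensor_br, IsCSA.br_eq_of_algEquiv _ _ e]
  · rw [← e.toLinearEquiv.finrank_eq, Module.finrank_tensorProduct]

end Brauer

section PiTensor

variable {F : Type} [Field F]

lemma finrank_piTensorProduct {k : ℕ} (D : Fin k → Type) [∀ i, Ring (D i)]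
    [∀ i, Algebra F (D i)] [∀ i, FiniteDimensional F (D i)] :
    FiniteDimensional F (⨂[F] i, D i) ∧
    Module.finrank F (⨂[F] i, D i) = ∏ i, Module.finrank F (D i) := by
  have b := Basis.piTensorProduct fun i ↦ Module.finBasis F (D i)
  exact ⟨.of_basis b, by simp [Module.finrank_eq_card_basis b]⟩

/-- The inclusion of the tensor product of all factors but the first one. -/
noncomputable def piTensorTail {k : ℕ} (D : Fin (k + 1) → Type) [∀ i, Ring (D i)]
    [∀ i, Algebra F (D i)] : (⨂[F] i : Fin k, D i.succ) →ₐ[F] ⨂[F] i, D i :=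
  PiTensorProduct.liftAlgHom ((PiTensorProduct.tprod F).curryLeft 1)
    (by
      rw [MultilinearMap.curryLeft_apply, PiTensorProduct.one_def]
      congr 1
      ext i
      refine Fin.cases ?_ (fun i ↦ ?_) i <;> simp)
    (fun x y ↦ by
      simp only [MultilinearMap.curryLeft_apply, PiTensorProduct.tprod_mul_tprod]
      congr 1
      ext i
      refine Fin.cases ?_ (fun i ↦ ?_) i <;> simp)

lemma piTensorTail_tprod {k : ℕ} (D : Fin (k + 1) → Type) [∀ i, Ring (D i)]
    [∀ i, Algebra F (D i)] (x : ∀ i : Fin k, D i.succ) :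
    piTensorTail (F := F) D (PiTensorProduct.tprod F x) =
      PiTensorProduct.tprod F (Fin.cons 1 x : ∀ i, D i) := by
  simp [piTensorTail]

lemma IsCSA.exists_piTensor_br {k : ℕ} (D : Fin k → Type) [∀ i, Ring (D i)]
    [∀ i, Algebra F (D i)] (hD : ∀ i, IsCSA F (D i)) :
    ∃ h : IsCSA F (⨂[F] i, D i), h.br = ∏ i, (hD i).br := by
  have hfin := fun i ↦ (hD i).2.2
  have hsim := fun i ↦ (hD i).2.1
  induction k with
  | zero =>
    obtain ⟨h1, h2⟩ := finrank_piTensorProduct (F := F) D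
    have : Nontrivial (⨂[F] i, D i) := Module.nontrivial_of_finrank_pos (R := F) (by simp [h2])
    let e := AlgEquiv.ofBijective (Algebra.ofId F (⨂[F] i, D i))
      (AlgHom.bijective_of_finrank_le _ (by simp [h2]))
    exact ⟨(IsCSA.self F).of_algEquiv e, by
      rw [Finset.univ_eq_empty, Finset.prod_empty]
      exact (IsCSA.br_eq_of_algEquiv (IsCSA.self F) _ e).symm⟩
  | succ k ih =>
    obtain ⟨h1, h2⟩ := finrank_piTensorProduct (F := F) D
    obtain ⟨h, hbr⟩ := ih (fun i ↦ D i.succ) (fun i ↦ hD _) (fun i ↦ hfin _) (fun i ↦ hsim _)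
    obtain ⟨h1', h2'⟩ := finrank_piTensorProduct (F := F) fun i : Fin k ↦ D i.succ
    have : Nontrivial (⨂[F] i, D i) := Module.nontrivial_of_finrank_pos (R := F) (by
      rw [h2]; exact Finset.prod_pos fun i _ ↦ Module.finrank_pos)
    let f : D 0 ⊗[F] (⨂[F] i : Fin k, D i.succ) →ₐ[F] ⨂[F] i, D i :=
      Algebra.TensorProduct.lift (PiTensorProduct.singleAlgHom 0) (piTensorTail D) (fun a z ↦ by
        induction z using PiTensorProduct.induction_on with
        | smul_tprod r x =>
          rw [map_smul, piTensorTail_tprod]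
          refine Commute.smul_right ?_ r
          rw [PiTensorProduct.singleAlgHom_apply]
          apply Commute.tprod
          funext i
          refine Fin.cases ?_ (fun i ↦ ?_) i <;> simp
        | add x y hx hy => rw [map_add]; exact hx.add_right hy)
    have ht := (hD 0).tensor h
    have := ht.2.1
    let e := AlgEquiv.ofBijective f (f.bijective_of_finrank_le (by
      rw [h2, Module.finrank_tensorProduct, h2', Fin.prod_univ_succ]))
    refine ⟨ht.of_algEquiv e, ?_⟩
    rw [← IsCSA.br_eq_of_algEquiv ht _ e, (hD 0).tensor_br h, hbr, Fin.prod_univ_succ]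

end PiTensor

section Symbol

open Polynomial

lemma Polynomial.le_natDegree_of_comp_X_sub_one {F : Type*} [Field F] {p : ℕ} [CharP F p] {f : F[X]}
    (hf : f.natDegree ≠ 0) (h : f.comp (X - 1) = f) : p ≤ f.natDegree := by
  let g := f.map (algebraMap F (AlgebraicClosure F))
  have hg : g.natDegree = f.natDegree := natDegree_map _
  have hg0 : g ≠ 0 := fun h0 ↦ hf (by rw [← hg, h0, natDegree_zero])
  have hgc : g.comp (X - 1) = g := by
    have := congrArg (Polynomial.map (algebraMap F (AlgebraicClosure F))) h
    simpa [map_comp] using this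
  obtain ⟨x, hx⟩ := IsAlgClosed.exists_root g (fun h0 ↦ hf (by
    rw [← hg]; exact natDegree_eq_zero_iff_degree_le_zero.2 h0.le))
  have hk : ∀ k : ℕ, g.eval (x - k) = 0 := by
    intro k
    induction k with
    | zero => simpa using hx
    | succ k ih =>
      rw [← hgc] at ih
      simpa [sub_sub] using ih
  have hchar : CharP (AlgebraicClosure F) p :=
    charP_of_injective_algebraMap (algebraMap F (AlgebraicClosure F)).injective p
  classical
  have hinj : Set.InjOn (fun k : ℕ ↦ x - (k : AlgebraicClosure F)) (Finset.range p) := by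
    intro k hk l hl hkl
    exact CharP.natCast_injOn_Iio (AlgebraicClosure F) p (by simpa using hk) (by simpa using hl)
      (sub_right_injective hkl)
  calc p = (Finset.image (fun k : ℕ ↦ x - (k : AlgebraicClosure F)) (Finset.range p)).card := by
        rw [Finset.card_image_of_injOn hinj, Finset.card_range]
    _ ≤ g.roots.toFinset.card := Finset.card_le_card fun y hy ↦ by
        obtain ⟨k, -, rfl⟩ := Finset.mem_image.1 hy
        simp [hg0, hk]
    _ ≤ g.natDegree := (Multiset.toFinset_card_le _).trans (card_roots' g)
    _ = f.natDegree := hg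

variable {F A B : Type} [Field F] [Ring A] [Algebra F A] [Ring B] [Algebra F B]

/-- The defining relations of the symbol algebra `[a, b)`. -/
structure SymRel (p : ℕ) (a b : F) (i j : A) : Prop where
  pow_sub : i ^ p - i = algebraMap F A a
  pow_eq : j ^ p = algebraMap F A b
  comm : j * i = (i - 1) * j

/-- The linear combinations of the monomials `i ^ k * j ^ l` with `k, l < p`. -/
noncomputable def symMap (p : ℕ) (i j : A) : (Fin p → degreeLT F p) →ₗ[F] A :=
  ∑ l : Fin p, (LinearMap.mulRight F (j ^ (l : ℕ))) ∘ₗ (aeval i).toLinearMap ∘ₗ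
    (degreeLT F p).subtype ∘ₗ LinearMap.proj l

lemma symMap_apply (p : ℕ) (i j : A) (g : Fin p → degreeLT F p) :
    symMap p i j g = ∑ l, aeval i (g l : F[X]) * j ^ (l : ℕ) := by
  simp [symMap]

lemma finrank_symMap_source (F : Type) [Field F] (p : ℕ) :
    Module.finrank F (Fin p → degreeLT F p) = p ^ 2 := by
  rw [Module.finrank_pi_fintype, Finset.sum_const, (degreeLTEquiv F p).finrank_eq]
  simp [sq]

namespace SymRel

variable {p : ℕ} {a b : F} {i j : A}

lemma map (h : SymRel p a b i j) (f : A →ₐ[F] B) : SymRel p a b (f i) (f j) where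
  pow_sub := by rw [← map_pow, ← map_sub, h.pow_sub, AlgHom.commutes]
  pow_eq := by rw [← map_pow, h.pow_eq, AlgHom.commutes]
  comm := by rw [← map_mul, h.comm]; simp

lemma mul_aeval (h : SymRel p a b i j) (f : F[X]) : j * aeval i f = aeval i (f.comp (X - 1)) * j := by
  induction f using Polynomial.induction_on' with
  | add f g hf hg => simp only [map_add, mul_add, add_comp, add_mul, hf, hg]
  | monomial n c =>
    rw [← C_mul_X_pow_eq_monomial]
    have : ∀ n : ℕ, j * i ^ n = (i - 1) ^ n * j := by
      intro n
      induction n with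
      | zero => simp
      | succ n ih => rw [pow_succ, ← mul_assoc, ih, mul_assoc, h.comm, ← mul_assoc, ← pow_succ]
    simp only [map_mul, aeval_C, map_pow, aeval_X, mul_comp, C_comp, pow_comp, X_comp, map_sub, map_one]
    rw [← mul_assoc, ← Algebra.commutes, mul_assoc, this, mul_assoc]

lemma comm_pow (h : SymRel p a b i j) (l : ℕ) : i * j ^ l = j ^ l * i + (l : A) * j ^ l := by
  induction l with
  | zero => simp
  | succ l ih =>
    have := h.comm
    rw [pow_succ, ← mul_assoc, ih, add_mul, mul_assoc, mul_assoc, mul_assoc (j ^ l) j i, this]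
    push_cast
    noncomm_ring

lemma aeval_pow_mem_range (h : SymRel p a b i j) (hp : 1 < p) (f : F[X]) (l : ℕ) :
    aeval i f * j ^ l ∈ LinearMap.range (symMap (F := F) p i j) := by
  have hq : (X ^ p - X - C a : F[X]).Monic := by
    rw [sub_sub]
    apply monic_X_pow_sub
    rw [degree_X_add_C]
    exact_mod_cast hp
  have hd : (X ^ p - X - C a : F[X]).degree = p := by
    rw [sub_sub, degree_sub_eq_left_of_degree_lt] <;> rw [degree_X_pow]
    rw [degree_X_add_C]
    exact_mod_cast hp
  let r := f %ₘ (X ^ p - X - C a)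
  have hr : r ∈ degreeLT F p := by
    rw [mem_degreeLT, ← hd]
    exact degree_modByMonic_lt _ hq
  have hf : aeval i f = aeval i r := by
    have hz : aeval i (X ^ p - X - C a : F[X]) = 0 := by simp [h.pow_sub]
    conv_lhs => rw [← modByMonic_add_div f (X ^ p - X - C a)]
    rw [map_add, map_mul, hz, zero_mul, add_zero]
  have hj : j ^ l = b ^ (l / p) • j ^ (l % p) := by
    conv_lhs => rw [← Nat.div_add_mod l p]
    rw [pow_add, pow_mul, h.pow_eq, ← map_pow, Algebra.smul_def]
  rw [hf, hj, mul_smul_comm]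
  refine Submodule.smul_mem _ _ ⟨Pi.single ⟨l % p, Nat.mod_lt _ (by omega)⟩ ⟨r, hr⟩, ?_⟩
  rw [symMap_apply, Finset.sum_eq_single ⟨l % p, Nat.mod_lt _ (by omega)⟩]
  · simp
  · intro k _ hk
    simp [Pi.single_eq_of_ne hk]
  · simp

lemma adjoin_le_range (h : SymRel p a b i j) (hp : 1 < p) :
    Subalgebra.toSubmodule (Algebra.adjoin F {i, j}) ≤ LinearMap.range (symMap (F := F) p i j) := by
  have key : ∀ x ∈ Algebra.adjoin F {i, j}, ∀ y ∈ LinearMap.range (symMap (F := F) p i j),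
      x * y ∈ LinearMap.range (symMap (F := F) p i j) := by
    intro x hx
    induction hx using Algebra.adjoin_induction with
    | algebraMap r =>
      intro y hy
      rw [← Algebra.smul_def]
      exact Submodule.smul_mem _ _ hy
    | add x y _ _ hx hy => exact fun z hz ↦ by rw [add_mul]; exact add_mem (hx z hz) (hy z hz)
    | mul x y _ _ hx hy => exact fun z hz ↦ by rw [mul_assoc]; exact hx _ (hy z hz)
    | mem x hx =>
      rintro _ ⟨g, rfl⟩
      rw [symMap_apply, Finset.mul_sum]
      refine sum_mem fun l _ ↦ ?_
      rcases hx with rfl | rfl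
      · have : x * (aeval x (g l : F[X]) * j ^ (l : ℕ)) = aeval x (X * (g l : F[X])) * j ^ (l : ℕ) := by
          simp [mul_assoc]
        rw [this]
        exact h.aeval_pow_mem_range hp _ _
      · rw [← mul_assoc, h.mul_aeval, mul_assoc, ← pow_succ']
        exact h.aeval_pow_mem_range hp _ _
  intro x hx
  have h1 : (1 : A) ∈ LinearMap.range (symMap (F := F) p i j) := by
    simpa using h.aeval_pow_mem_range hp 1 0
  simpa using key x hx 1 h1

lemma aeval_eq_zero [CharP F p] [Nontrivial A] (h : SymRel p a b i j) (hp : 1 < p) (hb : b ≠ 0) {f : F[X]}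
    (hf : f ∈ degreeLT F p) (hfi : aeval i f = 0) : f = 0 := by
  have hInt : IsIntegral F i := by
    refine ⟨X ^ p - X - C a, ?_, by simp [h.pow_sub]⟩
    rw [sub_sub]
    apply monic_X_pow_sub
    rw [degree_X_add_C]
    exact_mod_cast hp
  have hju : IsUnit j := by
    rw [← isUnit_pow_iff (n := p) (by omega), h.pow_eq]
    exact (IsUnit.mk0 b hb).map (algebraMap F A)
  have hmono := minpoly.monic hInt
  have hmono' : ((minpoly F i).comp (X - 1)).Monic := by
    rw [← C_1]
    exact hmono.comp (monic_X_sub_C 1) (by rw [natDegree_X_sub_C]; simp)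
  have hdeg : ((minpoly F i).comp (X - 1)).natDegree = (minpoly F i).natDegree := by
    rw [natDegree_comp, ← C_1, natDegree_X_sub_C, mul_one]
  have hroot : aeval i ((minpoly F i).comp (X - 1)) = 0 := by
    have := h.mul_aeval (minpoly F i)
    rw [minpoly.aeval, mul_zero] at this
    exact (hju.mul_left_eq_zero).1 this.symm
  have heq : (minpoly F i).comp (X - 1) = minpoly F i :=
    eq_of_monic_of_dvd_of_natDegree_le hmono hmono' (minpoly.dvd F i hroot) hdeg.le
  have hle := le_natDegree_of_comp_X_sub_one (p := p) (minpoly.natDegree_pos hInt).ne' heq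
  refine eq_zero_of_dvd_of_degree_lt (minpoly.dvd F i hfi) ?_
  rw [degree_eq_natDegree hmono.ne_zero]
  exact (mem_degreeLT.1 hf).trans_le (by exact_mod_cast hle)

lemma symMap_injective [CharP F p] [Nontrivial A] (h : SymRel p a b i j) (hp : 1 < p) (hb : b ≠ 0) :
    Function.Injective (symMap (F := F) p i j) := by
  rw [injective_iff_map_eq_zero]
  intro g hg
  rw [symMap_apply] at hg
  have hju : IsUnit j := by
    rw [← isUnit_pow_iff (n := p) (by omega), h.pow_eq]
    exact (IsUnit.mk0 b hb).map (algebraMap F A)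
  let T : Module.End F A := LinearMap.mulLeft F i - LinearMap.mulRight F i
  have hind := (Module.End.eigenspaces_iSupIndep T).comp (f := fun l : Fin p ↦ ((l : ℕ) : F))
    (fun k l hkl ↦ Fin.ext (CharP.natCast_injOn_Iio F p k.2 l.2 hkl))
  rw [iSupIndep_iff_finsetSum_eq_zero_imp_eq_zero] at hind
  funext l
  have h0 := hind Finset.univ (fun l ↦ aeval i (g l : F[X]) * j ^ (l : ℕ)) (fun l _ ↦ by
    rw [Function.comp, Module.End.mem_eigenspace_iff]
    have hc : i * aeval i (g l : F[X]) = aeval i (g l : F[X]) * i := by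
      have := congrArg (aeval i) (mul_comm X (g l : F[X]))
      simpa using this
    simp only [T, LinearMap.sub_apply, LinearMap.mulLeft_apply, LinearMap.mulRight_apply]
    rw [← mul_assoc, hc, mul_assoc, h.comm_pow, mul_assoc, mul_add, add_sub_cancel_left,
      Algebra.smul_def, map_natCast, ← mul_assoc, ← mul_assoc, Nat.cast_comm]) hg l (Finset.mem_univ l)
  exact Subtype.ext (h.aeval_eq_zero hp hb (g l).2 (((hju.pow _).mul_left_eq_zero).1 h0))

lemma sq_le_finrank [CharP F p] [Nontrivial A] [FiniteDimensional F A] (h : SymRel p a b i j) (hp : 1 < p)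
    (hb : b ≠ 0) : p ^ 2 ≤ Module.finrank F A := by
  rw [← finrank_symMap_source F p]
  exact LinearMap.finrank_le_finrank_of_injective (h.symMap_injective hp hb)

lemma finrank_adjoin_le (h : SymRel p a b i j) (hp : 1 < p) :
    FiniteDimensional F (Algebra.adjoin F {i, j}) ∧
      Module.finrank F (Algebra.adjoin F {i, j}) ≤ p ^ 2 := by
  have hle := h.adjoin_le_range hp
  have : FiniteDimensional F (degreeLT F p) := (degreeLTEquiv F p).symm.finiteDimensional
  refine ⟨Submodule.finiteDimensional_of_le hle, ?_⟩
  rw [← finrank_symMap_source F p]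
  exact (Submodule.finrank_mono hle).trans (LinearMap.finrank_range_le _)

end SymRel
end Symbol

section CyclicAlg

open Polynomial

variable {F A B : Type} [Field F] [Ring A] [Algebra F A] [Ring B] [Algebra F B]
  {p : ℕ} {a b : F}

lemma IsCyclicAlgWith.exists_symRel (h : IsCyclicAlgWith p F A a b) :
    ∃ i j : A, SymRel p a b i j ∧ Algebra.adjoin F {i, j} = ⊤ := by
  obtain ⟨-, -, i, j, h1, h2, h3, h4⟩ := h
  exact ⟨i, j, ⟨h1, h2, h3⟩, h4⟩

lemma IsCyclicAlgWith.finiteDimensional (h : IsCyclicAlgWith p F A a b) (hp : 1 < p) :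
    FiniteDimensional F A :=
  .of_finrank_pos (h.2.1 ▸ by positivity)

lemma IsCyclicAlgWith.nontrivial (h : IsCyclicAlgWith p F A a b) (hp : 1 < p) :
    Nontrivial A :=
  Module.nontrivial_of_finrank_pos (R := F) (h.2.1 ▸ by positivity)

lemma IsCyclicAlgWith.isCSA [CharP F p] (h : IsCyclicAlgWith p F A a b) (hp : 1 < p) : IsCSA F A := by
  have := h.nontrivial hp
  have := h.finiteDimensional hp
  obtain ⟨i, j, hr, hgen⟩ := h.exists_symRel
  refine ⟨⟨fun z hz ↦ ?_⟩, ?_, this⟩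
  · rw [Subalgebra.mem_center_iff] at hz
    obtain ⟨g, rfl⟩ := hr.adjoin_le_range hp (x := z) (by simp [hgen])
    have hp0 : 0 < p := by omega
    have hg : ∀ l : Fin p, l ≠ ⟨0, hp0⟩ → g l = 0 := by
      have h0 : symMap (F := F) p i j (fun l ↦ ((l : ℕ) : F) • g l) = 0 := by
        have := hz i
        rw [symMap_apply, Finset.mul_sum, Finset.sum_mul, ← sub_eq_zero, ← Finset.sum_sub_distrib] at this
        rw [symMap_apply, ← this]
        refine Finset.sum_congr rfl fun l _ ↦ ?_
        have hc : i * aeval i (g l : F[X]) = aeval i (g l : F[X]) * i := by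
          have := congrArg (aeval i) (mul_comm X (g l : F[X]))
          simpa using this
        rw [← mul_assoc i, hc, mul_assoc, hr.comm_pow, mul_assoc, mul_add, add_sub_cancel_left,
          Submodule.coe_smul, map_smul, Algebra.smul_def, map_natCast, ← mul_assoc, Nat.cast_comm]
      have h1 := hr.symMap_injective hp h.1 (h0.trans (map_zero _).symm)
      intro l hl
      refine (smul_eq_zero.1 (congrFun h1 l)).resolve_left fun hl0 ↦ hl ?_
      exact Fin.ext (CharP.natCast_injOn_Iio F p l.2 hp0 (by simpa using hl0))
    have hz' : symMap (F := F) p i j g = aeval i (g ⟨0, hp0⟩ : F[X]) := by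
      rw [symMap_apply, Finset.sum_eq_single ⟨0, hp0⟩]
      · simp
      · intro l _ hl
        simp [hg l hl]
      · simp
    rw [hz'] at hz ⊢
    have hju : IsUnit j := by
      rw [← isUnit_pow_iff (n := p) (by omega), hr.pow_eq]
      exact (IsUnit.mk0 b h.1).map (algebraMap F A)
    set f : F[X] := (g ⟨0, hp0⟩ : F[X]) with hf
    have hfd : f ∈ degreeLT F p := (g ⟨0, hp0⟩).2
    have hcomp : f.comp (X - 1) = f := by
      rw [← sub_eq_zero]
      refine hr.aeval_eq_zero hp h.1 (sub_mem ?_ hfd) ?_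
      · rw [mem_degreeLT] at hfd ⊢
        rcases eq_or_ne f 0 with h0 | h0
        · simp [h0]
        · have h1 : (f.comp (X - 1)).natDegree = f.natDegree := by
            rw [natDegree_comp, ← C_1, natDegree_X_sub_C, mul_one]
          rw [degree_eq_natDegree h0] at hfd
          exact (degree_le_natDegree.trans_eq (by rw [h1])).trans_lt hfd
      · rw [map_sub, sub_eq_zero]
        have := hz j
        rw [hr.mul_aeval] at this
        exact hju.mul_left_injective this
    have hdeg : f.natDegree = 0 := by
      by_contra h0
      have h1 := le_natDegree_of_comp_X_sub_one (p := p) h0 hcomp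
      have h2 := mem_degreeLT.1 hfd
      rw [degree_lt_iff_coeff_zero] at h2
      have h3 := h2 _ h1
      rw [coeff_natDegree, leadingCoeff_eq_zero] at h3
      exact h0 (by rw [h3, natDegree_zero])
    rw [eq_C_of_natDegree_eq_zero hdeg, aeval_C]
    exact Subalgebra.algebraMap_mem _ _
  · refine ⟨⟨fun I ↦ ?_⟩⟩
    by_cases hI : I = ⊤
    · exact .inr hI
    left
    let q : A →ₐ[F] I.ringCon.Quotient := I.ringCon.mkₐ F
    have hq : Function.Surjective q := Quot.mk_surjective
    have hnt : Nontrivial I.ringCon.Quotient := by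
      by_contra h
      rw [not_nontrivial_iff_subsingleton] at h
      apply hI
      rw [eq_top_iff]
      intro x _
      exact (RingCon.eq _).1 (Subsingleton.elim (q x) (q 0))
    have : FiniteDimensional F I.ringCon.Quotient := .of_surjective q.toLinearMap hq
    have hle := (hr.map q).sq_le_finrank hp h.1
    have hq' : Function.Injective q := by
      have := LinearMap.injective_iff_surjective_of_finrank_eq_finrank (f := q.toLinearMap)
        (le_antisymm (h.2.1 ▸ hle) (LinearMap.finrank_le_finrank_of_surjective (f := q.toLinearMap) hq))
      exact this.2 hq
    rw [eq_bot_iff]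
    intro x hx
    exact hq' ((RingCon.eq _).2 hx)

lemma IsCyclicAlgWith.exists_algHom [CharP F p] (h : IsCyclicAlgWith p F A a b) (hp : 1 < p)
    {i j : B} (hr : SymRel p a b i j) : Nonempty (A →ₐ[F] B) := by
  have := h.finiteDimensional hp
  obtain ⟨i', j', hr', hgen⟩ := h.exists_symRel
  have hr2 : SymRel p a b ((i', i) : A × B) (j', j) :=
    ⟨Prod.ext hr'.pow_sub hr.pow_sub, Prod.ext hr'.pow_eq hr.pow_eq, Prod.ext hr'.comm hr.comm⟩
  obtain ⟨hfin, hle⟩ := hr2.finrank_adjoin_le hp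
  let S := Algebra.adjoin F {((i', i) : A × B), (j', j)}
  let π : S →ₐ[F] A := (AlgHom.fst F A B).comp S.val
  have hπ : Function.Surjective π := by
    rw [← AlgHom.range_eq_top, eq_top_iff, ← hgen, Algebra.adjoin_le_iff]
    rintro x (rfl | rfl)
    · exact ⟨⟨(x, i), Algebra.subset_adjoin (by simp)⟩, rfl⟩
    · exact ⟨⟨(x, j), Algebra.subset_adjoin (by simp)⟩, rfl⟩
  have hπ' : Function.Injective π := by
    have := LinearMap.injective_iff_surjective_of_finrank_eq_finrank (f := π.toLinearMap)
      (le_antisymm (h.2.1 ▸ hle) (LinearMap.finrank_le_finrank_of_surjective (f := π.toLinearMap) hπ))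
    exact this.2 hπ
  exact ⟨((AlgHom.snd F A B).comp S.val).comp (AlgEquiv.ofBijective π ⟨hπ', hπ⟩).symm.toAlgHom⟩

lemma isCyclicAlgWith_of_symRel [CharP F p] [Nontrivial A] [FiniteDimensional F A] (hp : 1 < p) {i j : A}
    (hr : SymRel p a b i j) (hb : b ≠ 0) (hd : Module.finrank F A ≤ p ^ 2) : IsCyclicAlgWith p F A a b := by
  obtain ⟨hfin, hle⟩ := hr.finrank_adjoin_le hp
  let S := Algebra.adjoin F {i, j}
  have hiS : i ∈ S := Algebra.subset_adjoin (by simp)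
  have hjS : j ∈ S := Algebra.subset_adjoin (by simp)
  have hrS : SymRel p a b (⟨i, hiS⟩ : S) ⟨j, hjS⟩ :=
    ⟨Subtype.ext hr.pow_sub, Subtype.ext hr.pow_eq, Subtype.ext hr.comm⟩
  have h1 := hrS.sq_le_finrank hp hb
  have h2 := hr.sq_le_finrank hp hb
  refine ⟨hb, le_antisymm hd h2, i, j, hr.pow_sub, hr.pow_eq, hr.comm, ?_⟩
  rw [← Algebra.toSubmodule_eq_top]
  apply Submodule.eq_top_of_finrank_eq
  exact le_antisymm (Submodule.finrank_le _) (hd.trans h1)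

lemma IsCyclicAlgWith.br_eq [CharP F p] (hp : 1 < p) (h : IsCyclicAlgWith p F A a b) (h' : IsCyclicAlgWith p F B a b) :
    (h.isCSA hp).br = (h'.isCSA hp).br := by
  obtain ⟨i, j, hr, -⟩ := h'.exists_symRel
  obtain ⟨f⟩ := h.exists_algHom hp hr
  have := (h.isCSA hp).2.1
  have := h'.nontrivial hp
  have := h'.finiteDimensional hp
  exact IsCSA.br_eq_of_algEquiv _ _ (AlgEquiv.ofBijective f
    (AlgHom.bijective_of_finrank_le f (by rw [h.2.1, h'.2.1])))

lemma exists_isCyclicAlgWith (p : ℕ) [Fact p.Prime] [CharP F p] (a : F) {b : F} (hb : b ≠ 0) :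
    ∃ (S : Type) (_ : Ring S) (_ : Algebra F S), IsCyclicAlgWith p F S a b := by
  have hp : 1 < p := (Fact.out : p.Prime).one_lt
  let K := AlgebraicClosure F
  have hchar : CharP K p := charP_of_injective_algebraMap (algebraMap F K).injective p
  obtain ⟨x, hx⟩ : ∃ x : K, x ^ p - x = algebraMap F K a := by
    have hd : (X ^ p - X - C (algebraMap F K a) : K[X]).degree = p := by
      rw [sub_sub, degree_sub_eq_left_of_degree_lt] <;> rw [degree_X_pow]
      rw [degree_X_add_C]
      exact_mod_cast hp
    obtain ⟨x, hx⟩ := IsAlgClosed.exists_root (X ^ p - X - C (algebraMap F K a) : K[X]) (by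
      rw [hd]
      exact_mod_cast (by omega : p ≠ 0))
    exact ⟨x, by simpa [sub_eq_zero] using hx⟩
  obtain ⟨y, hy⟩ := IsAlgClosed.exists_pow_nat_eq (algebraMap F K b) (n := p) (by omega)
  let c : ZMod p →+* K := ZMod.castHom dvd_rfl K
  let i : Module.End K (ZMod p → K) :=
    { toFun := fun f k ↦ (x + c k) * f k
      map_add' := fun f g ↦ by funext k; simp [mul_add]
      map_smul' := fun r f ↦ by funext k; simp; ring }
  let j : Module.End K (ZMod p → K) :=
    { toFun := fun f k ↦ y * f (k - 1)
      map_add' := fun f g ↦ by funext k; simp [mul_add]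
      map_smul' := fun r f ↦ by funext k; simp; ring }
  have hi : ∀ (n : ℕ) f k, (i ^ n) f k = (x + c k) ^ n * f k := by
    intro n
    induction n with
    | zero => simp
    | succ n ih =>
      intro f k
      rw [pow_succ', Module.End.mul_apply]
      change (x + c k) * (i ^ n) f k = _
      rw [ih]
      ring
  have hj : ∀ (n : ℕ) f k, (j ^ n) f k = y ^ n * f (k - n) := by
    intro n
    induction n with
    | zero => simp
    | succ n ih =>
      intro f k
      rw [pow_succ', Module.End.mul_apply]
      change y * (j ^ n) f (k - 1) = _
      rw [ih, Nat.cast_succ, sub_sub, add_comm (n : ZMod p)]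
      ring
  have hr : SymRel p a b i j := by
    refine ⟨?_, ?_, ?_⟩
    · refine LinearMap.ext fun f ↦ funext fun k ↦ ?_
      have : c k ^ p = c k := by rw [← map_pow, ZMod.pow_card]
      rw [LinearMap.sub_apply, Pi.sub_apply, hi, add_pow_char, this, Module.algebraMap_end_apply, Pi.smul_apply,
        Algebra.smul_def, ← hx]
      change _ - (x + c k) * f k = _
      ring
    · refine LinearMap.ext fun f ↦ funext fun k ↦ ?_
      rw [hj, hy, Module.algebraMap_end_apply, Pi.smul_apply, Algebra.smul_def]
      simp
    · refine LinearMap.ext fun f ↦ funext fun k ↦ ?_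
      change y * ((x + c (k - 1)) * f (k - 1)) = (x + c k) * (y * f (k - 1)) - y * f (k - 1)
      rw [map_sub, map_one]
      ring
  obtain ⟨hfin, hle⟩ := hr.finrank_adjoin_le hp
  have hiS : i ∈ Algebra.adjoin F {i, j} := Algebra.subset_adjoin (by simp)
  have hjS : j ∈ Algebra.adjoin F {i, j} := Algebra.subset_adjoin (by simp)
  have hrS : SymRel p a b (⟨i, hiS⟩ : Algebra.adjoin F {i, j}) ⟨j, hjS⟩ :=
    ⟨Subtype.ext hr.pow_sub, Subtype.ext hr.pow_eq, Subtype.ext hr.comm⟩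
  exact ⟨Algebra.adjoin F {i, j}, inferInstance, inferInstance, isCyclicAlgWith_of_symRel hp hrS hb hle⟩

open Classical in
/-- The Brauer class of the symbol algebra `[a, b)`; by convention trivial if `b = 0`. -/
noncomputable def sym (p : ℕ) [Fact p.Prime] [CharP F p] (a b : F) : Br F :=
  if hb : b ≠ 0 then
    let _ := (exists_isCyclicAlgWith p a hb).choose_spec.choose
    let _ := (exists_isCyclicAlgWith p a hb).choose_spec.choose_spec.choose
    ((exists_isCyclicAlgWith p a hb).choose_spec.choose_spec.choose_spec.isCSA
      (Fact.out : p.Prime).one_lt).br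
  else 1

lemma IsCyclicAlgWith.br_eq_sym [Fact p.Prime] [CharP F p] (h : IsCyclicAlgWith p F A a b)
    (hA : IsCSA F A) : hA.br = sym p a b := by
  rw [sym, dif_pos h.1]
  let _ := (exists_isCyclicAlgWith p a h.1).choose_spec.choose
  let _ := (exists_isCyclicAlgWith p a h.1).choose_spec.choose_spec.choose
  exact h.br_eq (Fact.out : p.Prime).one_lt
    (exists_isCyclicAlgWith p a h.1).choose_spec.choose_spec.choose_spec

lemma sym_zero_right [Fact p.Prime] [CharP F p] (a : F) : sym p a 0 = 1 := by
  simp [sym]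

lemma SymRel.br_eq_sym [Fact p.Prime] [CharP F p] {i j : A} (hr : SymRel p a b i j) (hb : b ≠ 0)
    (hA : IsCSA F A) (hd : Module.finrank F A ≤ p ^ 2) : hA.br = sym p a b := by
  have := hA.2.1
  have := hA.2.2
  exact (isCyclicAlgWith_of_symRel (Fact.out : p.Prime).one_lt hr hb hd).br_eq_sym hA

lemma exists_sym_rep (p : ℕ) [Fact p.Prime] [CharP F p] (a : F) {b : F} (hb : b ≠ 0) :
    ∃ (S : Type) (_ : Ring S) (_ : Algebra F S) (hS : IsCSA F S) (i j : S),
      IsCyclicAlgWith p F S a b ∧ SymRel p a b i j ∧ hS.br = sym p a b := by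
  obtain ⟨S, _, _, h⟩ := exists_isCyclicAlgWith p a hb
  obtain ⟨i, j, hr, -⟩ := h.exists_symRel
  exact ⟨S, _, _, h.isCSA (Fact.out : p.Prime).one_lt, i, j, h, hr, h.br_eq_sym _⟩

lemma Br.res_sym [Fact p.Prime] [CharP F p] (E : Type) [Field E] [Algebra F E] [CharP E p] (a b : F) :
    Br.res E (sym p a b) = sym p (algebraMap F E a) (algebraMap F E b) := by
  by_cases hb : b = 0
  · simp [hb, sym_zero_right]
  obtain ⟨S, _, _, hS, i, j, h, hr, hs⟩ := exists_sym_rep p a hb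
  rw [← hs, Br.res_br]
  have hr' : SymRel p (algebraMap F E a) (algebraMap F E b) ((1 : E) ⊗ₜ[F] i) ((1 : E) ⊗ₜ[F] j) := by
    have hr2 := hr.map (Algebra.TensorProduct.includeRight : S →ₐ[F] E ⊗[F] S)
    refine ⟨?_, ?_, hr2.comm⟩
    · rw [← IsScalarTower.algebraMap_apply]
      exact hr2.pow_sub
    · rw [← IsScalarTower.algebraMap_apply]
      exact hr2.pow_eq
  refine hr'.br_eq_sym (by simpa using hb) _ ?_
  rw [Module.finrank_baseChange, h.2.1]

lemma sym_add_pow_sub [Fact p.Prime] [CharP F p] (a b c : F) : sym p (a + (c ^ p - c)) b = sym p a b := by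
  by_cases hb : b = 0
  · simp [hb, sym_zero_right]
  obtain ⟨S, _, _, hS, i, j, h, hr, hs⟩ := exists_sym_rep p a hb
  rw [← hs]
  have hS' := hS.2.1
  have : CharP S p := charP_of_injective_algebraMap (algebraMap F S).injective p
  refine (SymRel.br_eq_sym (i := i + algebraMap F S c) (j := j) ⟨?_, hr.pow_eq, ?_⟩ hb hS h.2.1.le).symm
  · rw [add_pow_char_of_commute _ (Algebra.commutes c i).symm, map_add, ← hr.pow_sub, map_sub, map_pow]
    abel
  · rw [mul_add, hr.comm, ← Algebra.commutes c j]
    noncomm_ring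

lemma sym_neg [Fact p.Prime] [CharP F p] (a b : F) : sym p (-a) b = (sym p a b)⁻¹ := by
  by_cases hb : b = 0
  · simp [hb, sym_zero_right]
  obtain ⟨S, _, _, hS, i, j, h, hr, hs⟩ := exists_sym_rep p a hb
  rw [← hs, ← hS.mulOpposite_br]
  have hS' := hS.2.1
  have : CharP S p := charP_of_injective_algebraMap (algebraMap F S).injective p
  refine (SymRel.br_eq_sym (i := MulOpposite.op (-i)) (j := MulOpposite.op j) ⟨?_, ?_, ?_⟩ hb hS.mulOpposite
    ?_).symm
  · apply MulOpposite.unop_injective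
    have h1 : (-i) ^ p = - i ^ p := by
      have := add_pow_char_of_commute p (Commute.neg_left (Commute.refl i))
      rw [neg_add_cancel, zero_pow (Fact.out : p.Prime).ne_zero] at this
      exact eq_neg_of_add_eq_zero_left this.symm
    simp [h1, ← hr.pow_sub, add_comm, sub_eq_add_neg]
  · apply MulOpposite.unop_injective
    simp [hr.pow_eq]
  · apply MulOpposite.unop_injective
    simp only [MulOpposite.unop_mul, MulOpposite.unop_op, MulOpposite.unop_sub, MulOpposite.unop_one,
      mul_sub, mul_neg, hr.comm]
    noncomm_ring
  · rw [← (MulOpposite.opLinearEquiv F : S ≃ₗ[F] Sᵐᵒᵖ).finrank_eq, h.2.1]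

lemma sym_eq_one [Fact p.Prime] [CharP F p] {V : Type} [AddCommGroup V] [Module F V] [FiniteDimensional F V]
    [Nontrivial V] {I J : Module.End F V} (hr : SymRel p a b I J) (hd : Module.finrank F V ≤ p) :
    sym p a b = 1 := by
  by_cases hb : b = 0
  · simp [hb, sym_zero_right]
  obtain ⟨S, _, _, hS, i, j, h, -, hs⟩ := exists_sym_rep p a hb
  obtain ⟨f⟩ := h.exists_algHom (Fact.out : p.Prime).one_lt hr
  have := hS.2.1
  rw [← hs, hS.br_eq_one_iff]
  exact isSplitAlg_of_algHom_end f (by rw [h.2.1]; gcongr)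

lemma exists_symRel_of_sym_eq_one [Fact p.Prime] [CharP F p] (hb : b ≠ 0) (h : sym p a b = 1) :
    ∃ I J : Module.End F (Fin p → F), SymRel p a b I J := by
  obtain ⟨S, _, _, hS, i, j, hc, hr, hs⟩ := exists_sym_rep p a hb
  rw [← hs, hS.br_eq_one_iff] at h
  obtain ⟨m, hm, ⟨e⟩⟩ := h
  have hmp : m = p := by
    have := e.toLinearEquiv.finrank_eq
    rw [hc.2.1, Module.finrank_matrix] at this
    simp only [Fintype.card_fin, Module.finrank_self, mul_one, ← sq] at this
    exact (Nat.pow_left_injective two_ne_zero this).symm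
  subst hmp
  exact ⟨_, _, (hr.map e.toAlgHom).map (Matrix.toLinAlgEquiv' : _ ≃ₐ[F] _).toAlgHom⟩

end CyclicAlg

section Albert

open Polynomial

variable {F L : Type} [Field F] [Field L] [Algebra F L] {p : ℕ} {c : F} {x : L}

lemma exists_aeval_eq_of_pow_eq (hp : p ≠ 0) (hx : Algebra.adjoin F {x} = ⊤)
    (hxc : x ^ p = algebraMap F L c) (l : L) : ∃ g ∈ degreeLT F p, aeval x g = l := by
  have hl : l ∈ Algebra.adjoin F {x} := by simp [hx]
  rw [Algebra.adjoin_singleton_eq_range_aeval] at hl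
  obtain ⟨f, rfl⟩ := hl
  have hq : (X ^ p - C c : F[X]).Monic := monic_X_pow_sub_C c hp
  refine ⟨f %ₘ (X ^ p - C c), ?_, ?_⟩
  · rw [mem_degreeLT, ← degree_X_pow_sub_C (Nat.pos_of_ne_zero hp) c]
    exact degree_modByMonic_lt _ hq
  · have hz : aeval x (X ^ p - C c : F[X]) = 0 := by simp [hxc]
    change _ = aeval x f
    conv_rhs => rw [← modByMonic_add_div f (X ^ p - C c)]
    rw [map_add, map_mul, hz, zero_mul, add_zero]

lemma eq_zero_of_aeval_eq_zero_of_pow_eq (hp : p ≠ 0) (hx : Algebra.adjoin F {x} = ⊤)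
    (hxc : x ^ p = algebraMap F L c) (hd : Module.finrank F L = p) {g : F[X]} (hg : g ∈ degreeLT F p)
    (h : aeval x g = 0) : g = 0 := by
  have : FiniteDimensional F L := .of_finrank_pos (by omega)
  have : FiniteDimensional F (degreeLT F p) := (degreeLTEquiv F p).symm.finiteDimensional
  let φ : degreeLT F p →ₗ[F] L := (aeval x).toLinearMap ∘ₗ (degreeLT F p).subtype
  have hφ : Function.Surjective φ := fun l ↦ by
    obtain ⟨g, hg, rfl⟩ := exists_aeval_eq_of_pow_eq hp hx hxc l
    exact ⟨⟨g, hg⟩, rfl⟩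
  have hφ' : Function.Injective φ :=
    (LinearMap.injective_iff_surjective_of_finrank_eq_finrank (by
      rw [(degreeLTEquiv F p).finrank_eq, hd]; simp)).2 hφ
  have := @hφ' ⟨g, hg⟩ 0 (by simpa [φ] using h)
  simpa using congrArg Subtype.val this

lemma exists_symRel_of_centralizer [Fact p.Prime] [CharP F p] {C : Type} [Ring C] [Algebra F C]
    [Nontrivial C] [FiniteDimensional F C]
    (hx : Algebra.adjoin F {x} = ⊤) (hxc : x ^ p = algebraMap F L c) (hd : Module.finrank F L = p)
    (ι : L →ₐ[F] C) (hC : Module.finrank F C = p ^ 2)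
    (hι : ∀ y : C, y * ι x = ι x * y → ∃ l, y = ι l) :
    ∃ (a : F) (i : C), SymRel p a c i (ι x) := by
  have hp : p.Prime := Fact.out
  have hcharC : CharP C p := charP_of_injective_algebraMap (algebraMap F C).injective p
  have hx0 : x ≠ 0 := by
    rintro rfl
    have h1 : Module.finrank F (⊥ : Subalgebra F L) = 1 := Subalgebra.finrank_bot
    have h2 : (⊥ : Subalgebra F L) = ⊤ := by rw [← hx]; simp
    rw [h2] at h1
    have h3 : Module.finrank F (⊤ : Subalgebra F L) = Module.finrank F L :=
      Subalgebra.topEquiv.toLinearEquiv.finrank_eq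
    have := hp.one_lt
    omega
  set j := ι x with hj
  let T : Module.End F C := LinearMap.mulRight F j - LinearMap.mulLeft F j
  have hT : ∀ y, T y = y * j - j * y := fun y ↦ rfl
  have hTp : T ^ p = 0 := by
    have hch : CharP (Module.End F C) p :=
      charP_of_injective_algebraMap (algebraMap F (Module.End F C)).injective p
    rw [sub_pow_char_of_commute p (LinearMap.commute_mulLeft_right j j).symm]
    refine LinearMap.ext fun y ↦ ?_
    rw [LinearMap.sub_apply, LinearMap.pow_mulRight, LinearMap.pow_mulLeft, hj, ← map_pow, hxc, AlgHom.commutes,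
      LinearMap.mulRight_apply, LinearMap.mulLeft_apply, Algebra.commutes, sub_self, LinearMap.zero_apply]
  obtain ⟨y0, hy0⟩ : ∃ y0, T y0 ≠ 0 := by
    by_contra! h
    have hsurj : Function.Surjective ι.toLinearMap := fun y ↦ by
      obtain ⟨l, hl⟩ := hι y (sub_eq_zero.1 (h y))
      exact ⟨l, hl.symm⟩
    have : FiniteDimensional F L := .of_finrank_pos (hd ▸ hp.pos)
    have := LinearMap.finrank_le_finrank_of_surjective hsurj
    rw [hC, hd] at this
    nlinarith [hp.one_lt]
  obtain ⟨y, hy, hy2⟩ : ∃ y, T y ≠ 0 ∧ T (T y) = 0 := by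
    classical
    have hex : ∃ k, (T ^ k) y0 = 0 := ⟨p, by rw [hTp]; rfl⟩
    obtain ⟨k, hk⟩ : ∃ k, Nat.find hex = k + 2 := by
      have h0 : Nat.find hex ≠ 0 := fun h ↦ by
        have h2 := Nat.find_spec hex
        rw [h] at h2
        apply hy0
        simp only [pow_zero, Module.End.one_apply] at h2
        rw [h2, map_zero]
      have h1 : Nat.find hex ≠ 1 := fun h ↦ by
        have h2 := Nat.find_spec hex
        rw [h] at h2
        exact hy0 (by simpa using h2)
      exact ⟨Nat.find hex - 2, by omega⟩
    refine ⟨(T ^ k) y0, ?_, ?_⟩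
    · rw [← Module.End.mul_apply, ← pow_succ']
      exact Nat.find_min hex (by omega)
    · have := Nat.find_spec hex
      rw [hk] at this
      rw [← Module.End.mul_apply T (T ^ k), ← pow_succ', ← Module.End.mul_apply, ← pow_succ']
      exact this
  obtain ⟨l, hl⟩ := hι (T y) (sub_eq_zero.1 hy2)
  have hl0 : l ≠ 0 := by
    rintro rfl
    exact hy (by rw [hl, map_zero])
  have hcomm : ∀ l', ι l' * j = j * ι l' := fun l' ↦ by rw [hj, ← map_mul, ← map_mul, mul_comm]
  obtain ⟨i, hij⟩ : ∃ i : C, i * j - j * i = j := by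
    refine ⟨ι (l⁻¹ * x) * y, ?_⟩
    have : ι (l⁻¹ * x) * y * j - j * (ι (l⁻¹ * x) * y) = ι (l⁻¹ * x) * T y := by
      rw [hT, mul_sub, ← mul_assoc _ j, hcomm, mul_assoc, mul_assoc]
    rw [this, hl, ← map_mul, mul_comm, ← mul_assoc, mul_inv_cancel₀ hl0, one_mul]
  have hij' : i * j = j * (i + 1) := by
    rw [mul_add, mul_one, ← sub_eq_iff_eq_add']
    exact hij
  have hpow : ∀ n : ℕ, i ^ n * j = j * (i + 1) ^ n := by
    intro n
    induction n with
    | zero => simp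
    | succ n ih => rw [pow_succ, mul_assoc, hij', ← mul_assoc, ih, mul_assoc, ← pow_succ]
  obtain ⟨l', hl'⟩ := hι (i ^ p - i) (by
    rw [sub_mul, hpow, hij', add_pow_char_of_commute p (Commute.one_right i), one_pow]
    noncomm_ring)
  obtain ⟨g, hg, rfl⟩ := exists_aeval_eq_of_pow_eq hp.ne_zero hx hxc l'
  have hder : ∀ f : F[X], i * aeval j f - aeval j f * i = j * aeval j (derivative f) := by
    have hjn : ∀ n : ℕ, i * j ^ n - j ^ n * i = n * j ^ n := by
      intro n
      induction n with
      | zero => simp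
      | succ n ih =>
        have e : i * j ^ (n + 1) - j ^ (n + 1) * i = (i * j ^ n - j ^ n * i) * j + j ^ n * (i * j - j * i) := by
          rw [pow_succ]; noncomm_ring
        rw [e, ih, hij, mul_assoc, ← pow_succ]
        push_cast
        rw [add_mul, one_mul]
    intro f
    induction f using Polynomial.induction_on' with
    | add f g hf hg => rw [map_add, derivative_add, map_add, mul_add, mul_add, add_mul, ← hf, ← hg]; abel
    | monomial n r =>
      rw [derivative_monomial, aeval_monomial, aeval_monomial, ← Algebra.smul_def, ← Algebra.smul_def,
        mul_smul_comm, mul_smul_comm, smul_mul_assoc, ← smul_sub, hjn, mul_smul, ← pow_succ', Nat.cast_smul_eq_nsmul,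
        nsmul_eq_mul]
      cases n with
      | zero => simp
      | succ n => rfl
  have hg0 : derivative g = 0 := by
    refine eq_zero_of_aeval_eq_zero_of_pow_eq hp.ne_zero hx hxc hd ?_ ?_
    · rw [mem_degreeLT] at hg ⊢
      exact (degree_derivative_le).trans_lt hg
    · have h1 := hder g
      rw [hj, Polynomial.aeval_algHom_apply, Polynomial.aeval_algHom_apply, ← hl', ← map_mul] at h1
      have h2 : i * (i ^ p - i) - (i ^ p - i) * i = 0 := by
        rw [mul_sub, sub_mul, ← pow_succ, ← pow_succ', sub_self]
      rw [h2] at h1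
      have h3 := (map_eq_zero_iff ι ι.toRingHom.injective).1 h1.symm
      exact (mul_eq_zero.1 h3).resolve_left hx0
  have hgC : g = Polynomial.C (g.coeff 0) := by
    ext n
    rw [coeff_C]
    split_ifs with hn
    · rw [hn]
    by_cases hnp : n < p
    · obtain ⟨m, rfl⟩ := Nat.exists_eq_succ_of_ne_zero hn
      have h1 : (derivative g).coeff m = 0 := by rw [hg0, coeff_zero]
      rw [coeff_derivative] at h1
      refine (mul_eq_zero.1 h1).resolve_right fun h2 ↦ ?_
      have h3 : ((m + 1 : ℕ) : F) = 0 := by exact_mod_cast h2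
      rw [CharP.cast_eq_zero_iff F p] at h3
      exact absurd (Nat.le_of_dvd (by omega) h3) (by omega)
    · exact coeff_eq_zero_of_degree_lt ((mem_degreeLT.1 hg).trans_le (by exact_mod_cast not_lt.1 hnp))
  refine ⟨g.coeff 0, i, ?_, ?_, ?_⟩
  · rw [hl', hgC, aeval_C, AlgHom.commutes, coeff_C_zero]
  · rw [hj, ← map_pow, hxc, AlgHom.commutes]
  · rw [sub_mul, one_mul, hij', mul_add, mul_one, add_sub_cancel_right]

end Albert

section Albert

open Polynomial

variable {F : Type} [Field F] {p : ℕ}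

lemma IsCSA.end (V : Type) [AddCommGroup V] [Module F V] [FiniteDimensional F V] [Nontrivial V] :
    IsCSA F (Module.End F V) :=
  (IsCSA.matrix_self F (Module.finrank F V) Module.finrank_pos).of_algEquiv
    (algEquivMatrix (Module.finBasis F V)).symm

lemma IsCSA.end_br (V : Type) [AddCommGroup V] [Module F V] [FiniteDimensional F V] [Nontrivial V] :
    (IsCSA.end (F := F) V).br = 1 := by
  rw [IsCSA.br_eq_one_iff]
  exact ⟨_, Module.finrank_pos, ⟨algEquivMatrix (Module.finBasis F V)⟩⟩

/-- A class split by a purely inseparable extension generated by a `p`-th root of `c` is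
a symbol with slot `c`. -/
lemma exists_eq_sym_of_res_eq_one [Fact p.Prime] [CharP F p] {L : Type} [Field L] [Algebra F L]
    {c : F} {x : L} (hx : Algebra.adjoin F {x} = ⊤)
    (hxc : x ^ p = algebraMap F L c) (hd : Module.finrank F L = p) {α : Br F} (h : Br.res L α = 1) :
    ∃ a, α = sym p a c := by
  have hp : p.Prime := Fact.out
  obtain ⟨A, _, _, hA, rfl⟩ := Br.exists_rep α
  rw [Br.res_br_eq_one_iff] at h
  obtain ⟨d, hdpos, ⟨e⟩⟩ := h
  have hAfin := hA.2.2
  have hLfin : FiniteDimensional F L := .of_finrank_pos (hd ▸ hp.pos)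
  have hAd : Module.finrank F A = d ^ 2 := by
    have := e.toLinearEquiv.finrank_eq
    rw [Module.finrank_baseChange, Module.finrank_matrix] at this
    simpa [sq] using this
  have : Nonempty (Fin d) := ⟨⟨0, hdpos⟩⟩
  let W := Fin d → L
  let r : Module.End L W →ₐ[F] Module.End F W :=
    { toFun := fun g ↦ g.restrictScalars F
      map_one' := rfl
      map_mul' := fun _ _ ↦ rfl
      map_zero' := rfl
      map_add' := fun _ _ ↦ rfl
      commutes' := fun a ↦ by
        refine LinearMap.ext fun w ↦ ?_
        rw [LinearMap.restrictScalars_apply, Module.algebraMap_end_apply, Module.algebraMap_end_apply] }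
  let ε : L ⊗[F] A ≃ₐ[L] Module.End L W := e.trans Matrix.toLinAlgEquiv'
  let ψ : L ⊗[F] A →ₐ[F] Module.End F W := r.comp (ε.toAlgHom.restrictScalars F)
  let f : A →ₐ[F] Module.End F W := ψ.comp Algebra.TensorProduct.includeRight
  obtain ⟨hC, hbr, hfr⟩ := hA.centralizer (IsCSA.end (F := F) W) f
  rw [IsCSA.end_br] at hbr
  have hCp : Module.finrank F (Subalgebra.centralizer F (f.range : Set (Module.End F W))) = p ^ 2 := by
    rw [hAd, Module.finrank_linearMap] at hfr
    have hW : Module.finrank F W = d * p := by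
      rw [Module.finrank_pi_fintype, hd]; simp
    rw [hW] at hfr
    have : d ^ 2 * Module.finrank F (Subalgebra.centralizer F (f.range : Set (Module.End F W))) = d ^ 2 * p ^ 2 := by
      rw [hfr]; ring
    exact Nat.eq_of_mul_eq_mul_left (by positivity) this
  have hcomm : ∀ (l : L) (g : Module.End L W), r g * Algebra.lsmul F F W l = Algebra.lsmul F F W l * r g :=
    fun l g ↦ LinearMap.ext fun w ↦ map_smul g l w
  let ι : L →ₐ[F] Subalgebra.centralizer F (f.range : Set (Module.End F W)) :=
    (Algebra.lsmul F F W).codRestrict _ (fun l ↦ by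
      rw [Subalgebra.mem_centralizer_iff]
      rintro _ ⟨a, rfl⟩
      exact hcomm l _)
  have := hC.2.1
  have := hC.2.2
  have hι : ∀ y : Subalgebra.centralizer F (f.range : Set (Module.End F W)),
      y * ι x = ι x * y → ∃ l, y = ι l := by
    rintro ⟨y, hy⟩ hyx
    have hyx' : y * Algebra.lsmul F F W x = Algebra.lsmul F F W x * y := congrArg Subtype.val hyx
    have hyl : ∀ l : L, y * Algebra.lsmul F F W l = Algebra.lsmul F F W l * y := by
      intro l
      have hl : l ∈ Algebra.adjoin F {x} := by simp [hx]
      induction hl using Algebra.adjoin_induction with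
      | mem z hz => rw [hz]; exact hyx'
      | algebraMap r => rw [AlgHom.commutes, Algebra.commutes]
      | add u v _ _ hu hv => rw [map_add, mul_add, add_mul, hu, hv]
      | mul u v _ _ hu hv => rw [map_mul, ← mul_assoc, hu, mul_assoc, hv, mul_assoc]
    let y' : Module.End L W :=
      { toFun := y
        map_add' := y.map_add
        map_smul' := fun l w ↦ LinearMap.congr_fun (hyl l) w }
    have hy' : r y' = y := rfl
    rw [Subalgebra.mem_centralizer_iff] at hy
    have hcen : ∀ z : L ⊗[F] A, ψ z * y = y * ψ z := by
      intro z
      induction z with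
      | zero => simp
      | add u v hu hv => rw [map_add, mul_add, add_mul, hu, hv]
      | tmul l a =>
        have h1 : (l ⊗ₜ[F] a : L ⊗[F] A) = l • ((1 : L) ⊗ₜ a) := by rw [TensorProduct.smul_tmul', smul_eq_mul, mul_one]
        have h2 : ψ (l ⊗ₜ[F] a) = Algebra.lsmul F F W l * f a := by
          rw [h1]
          refine LinearMap.ext fun w ↦ ?_
          change (ε (l • ((1 : L) ⊗ₜ[F] a))) w = l • (ε ((1 : L) ⊗ₜ[F] a)) w
          rw [map_smul, LinearMap.smul_apply]
        rw [h2, mul_assoc, hy (f a) ⟨a, rfl⟩, ← mul_assoc, ← mul_assoc, hyl]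
    have hmem : y' ∈ Subalgebra.center L (Module.End L W) := by
      rw [Subalgebra.mem_center_iff]
      intro g
      obtain ⟨z, rfl⟩ := ε.surjective g
      exact LinearMap.ext fun w ↦ LinearMap.congr_fun (hcen z) w
    obtain ⟨l, hl⟩ := (IsCSA.end (F := L) W).1.out hmem
    refine ⟨l, Subtype.ext (LinearMap.ext fun w ↦ ?_)⟩
    exact (LinearMap.congr_fun hl w).symm
  obtain ⟨a, i, hr⟩ := exists_symRel_of_centralizer
    (C := Subalgebra.centralizer F (f.range : Set (Module.End F W))) hx hxc hd ι hCp hι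
  have hc : c ≠ 0 := by
    rintro rfl
    have hx0 : x = 0 := by
      rw [map_zero] at hxc
      exact pow_eq_zero_iff hp.ne_zero |>.1 hxc
    have h1 : Module.finrank F (⊥ : Subalgebra F L) = 1 := Subalgebra.finrank_bot
    have h2 : (⊥ : Subalgebra F L) = ⊤ := by rw [← hx, hx0]; simp
    rw [h2] at h1
    have h3 : Module.finrank F (⊤ : Subalgebra F L) = Module.finrank F L :=
      Subalgebra.topEquiv.toLinearEquiv.finrank_eq
    have := hp.one_lt
    omega
  refine ⟨-a, ?_⟩
  rw [sym_neg, ← hr.br_eq_sym hc hC hCp.le]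
  exact eq_inv_of_mul_eq_one_left hbr

end Albert

section PurelyInseparable

open Polynomial IntermediateField

variable {F E : Type} [Field F] [Field E] [Algebra F E] {p : ℕ} [Fact p.Prime] [CharP F p]

lemma Br.res_self (x : Br F) : Br.res F x = x := by
  obtain ⟨A, _, _, hA, rfl⟩ := Br.exists_rep x
  rw [Br.res_br]
  exact IsCSA.br_eq_of_algEquiv _ _ (Algebra.TensorProduct.lid F A)

omit [CharP F p] in
lemma minpoly_eq_X_pow_sub_C [CharP E p] {x : E} {c : F} (hxc : x ^ p = algebraMap F E c)
    (hx : x ∉ (algebraMap F E).range) : minpoly F x = X ^ p - C c := by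
  have hp : p.Prime := Fact.out
  refine (minpoly.eq_of_irreducible_of_monic (X_pow_sub_C_irreducible_of_prime hp fun b hb ↦ hx ⟨b, ?_⟩)
    (by simp [hxc]) (monic_X_pow_sub_C c hp.ne_zero)).symm
  rw [← hb, map_pow] at hxc
  exact (frobenius_inj E p hxc).symm

/-- `x` is a product of the classes of `k` symbols. -/
def IsSymProd (p : ℕ) [Fact p.Prime] [CharP F p] (k : ℕ) (x : Br F) : Prop :=
  ∃ l : List (F × F), l.length = k ∧ x = (l.map fun q ↦ sym p q.1 q.2).prod

lemma IsSymProd.mul {k m : ℕ} {x y : Br F} (hx : IsSymProd p k x) (hy : IsSymProd p m y) :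
    IsSymProd p (k + m) (x * y) := by
  obtain ⟨l, rfl, rfl⟩ := hx
  obtain ⟨l', rfl, rfl⟩ := hy
  exact ⟨l ++ l', by simp, by simp⟩

lemma isSymProd_sym (a b : F) : IsSymProd p 1 (sym p a b) := ⟨[(a, b)], rfl, by simp⟩

lemma isSymProd_one : IsSymProd p 0 (1 : Br F) := ⟨[], rfl, by simp⟩

variable (hE : ∀ z : E, z ^ p ∈ (algebraMap F E).range)

include hE in
lemma exists_sym_of_res_adjoin_eq_one (M : IntermediateField F E) (x : E) {α : Br F}
    (h : Br.res (M ⊔ F⟮x⟯ : IntermediateField F E) α = 1) :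
    ∃ a c : F, Br.res M (α * (sym p a c)⁻¹) = 1 := by
  have hp : p.Prime := Fact.out
  have hMchar : CharP M p := charP_of_injective_algebraMap (algebraMap F M).injective p
  have hEchar : CharP E p := charP_of_injective_algebraMap (algebraMap F E).injective p
  by_cases hx : x ∈ M
  · refine ⟨0, 0, ?_⟩
    rw [sym_zero_right, inv_one, mul_one]
    have : M ⊔ F⟮x⟯ = M := by simpa using hx
    rw [this] at h
    exact h
  obtain ⟨c, hc⟩ := hE x
  have hxc : x ^ p = algebraMap M E (algebraMap F M c) := by
    rw [← IsScalarTower.algebraMap_apply, hc]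
  have hmin : minpoly M x = X ^ p - C (algebraMap F M c) :=
    minpoly_eq_X_pow_sub_C hxc (by rintro ⟨y, rfl⟩; exact hx y.2)
  have hInt : IsIntegral M x := by
    by_contra h
    have := minpoly.eq_zero h
    rw [hmin] at this
    exact (monic_X_pow_sub_C (algebraMap F M c) hp.ne_zero).ne_zero this
  have hfin : Module.finrank M M⟮x⟯ = p := by
    rw [adjoin.finrank hInt, hmin, natDegree_X_pow_sub_C]
  have htop : Algebra.adjoin M {AdjoinSimple.gen M x} = ⊤ := by
    rw [← adjoin.powerBasis_gen hInt, PowerBasis.adjoin_gen_eq_top]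
  have hgen : AdjoinSimple.gen M x ^ p = algebraMap M M⟮x⟯ (algebraMap F M c) := Subtype.ext hxc
  have hle : M ⊔ F⟮x⟯ ≤ restrictScalars F M⟮x⟯ := (restrictScalars_adjoin_eq_sup F M {x}).ge
  have hres : Br.res M⟮x⟯ (Br.res M α) = 1 := by
    rw [Br.res_res]
    exact Br.res_eq_one_of_algHom (inclusion hle) h
  obtain ⟨a, ha⟩ := exists_eq_sym_of_res_eq_one htop hgen hfin hres
  obtain ⟨a0, ha0⟩ := hE a
  have ha0' : a ^ p = algebraMap F M a0 := Subtype.ext ha0.symm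
  refine ⟨a0, c, ?_⟩
  rw [map_mul, map_inv, Br.res_sym, ← ha0', ha, mul_inv_eq_one, ← sym_add_pow_sub a _ a]
  congr 1
  ring

include hE in
lemma exists_isSymProd_of_res_adjoin_eq_one (l : List E) :
    ∀ (M : IntermediateField F E) {α : Br F},
      Br.res (M ⊔ adjoin F {y | y ∈ l} : IntermediateField F E) α = 1 →
      ∃ s, IsSymProd p l.length s ∧ Br.res M (α * s⁻¹) = 1 := by
  induction l with
  | nil =>
    intro M α h
    refine ⟨1, isSymProd_one, ?_⟩
    rw [inv_one, mul_one]
    have : M ⊔ adjoin F {y : E | y ∈ []} = M := by simp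
    rw [this] at h
    exact h
  | cons x l ih =>
    intro M α h
    have hsup : M ⊔ adjoin F {y : E | y ∈ x :: l} = (M ⊔ F⟮x⟯) ⊔ adjoin F {y | y ∈ l} := by
      rw [sup_assoc, ← adjoin_union]
      congr 2
      ext y
      simp
    rw [hsup] at h
    obtain ⟨s, hs, hs'⟩ := ih _ h
    obtain ⟨a, c, hac⟩ := exists_sym_of_res_adjoin_eq_one hE M x hs'
    refine ⟨s * sym p a c, hs.mul (isSymProd_sym a c), ?_⟩
    rwa [mul_inv, ← mul_assoc]

omit [CharP F p] in
include hE in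
lemma exists_list_adjoin_eq_top [CharP E p] {n : ℕ} (hd : Module.finrank F E = p ^ n) :
    ∃ l : List E, l.length = n ∧ adjoin F {y | y ∈ l} = ⊤ := by
  have hp : p.Prime := Fact.out
  have hEfin : FiniteDimensional F E := .of_finrank_pos (hd ▸ pow_pos hp.pos n)
  have key : ∀ m ≤ n, ∃ l : List E, l.length = m ∧ Module.finrank F (adjoin F {y | y ∈ l}) = p ^ m := by
    intro m
    induction m with
    | zero =>
      refine fun _ ↦ ⟨[], rfl, ?_⟩
      have : adjoin F {y : E | y ∈ []} = ⊥ := by simp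
      rw [this, IntermediateField.finrank_bot, pow_zero]
    | succ m ih =>
      intro hm
      obtain ⟨l, hl, hl'⟩ := ih (by omega)
      set M := adjoin F {y | y ∈ l} with hM
      obtain ⟨x, hx⟩ : ∃ x, x ∉ M := by
        by_contra! h
        have : M = ⊤ := by rw [eq_top_iff]; exact fun y _ ↦ h y
        rw [this, IntermediateField.finrank_top', hd] at hl'
        have := Nat.pow_right_injective hp.two_le hl'
        omega
      obtain ⟨c, hc⟩ := hE x
      have hxc : x ^ p = algebraMap M E (algebraMap F M c) := by
        rw [← IsScalarTower.algebraMap_apply, hc]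
      have hmin : minpoly M x = X ^ p - C (algebraMap F M c) :=
        minpoly_eq_X_pow_sub_C hxc (by rintro ⟨y, rfl⟩; exact hx y.2)
      have hInt : IsIntegral M x := .of_finite M x
      have hfin : Module.finrank M M⟮x⟯ = p := by
        rw [adjoin.finrank hInt, hmin, natDegree_X_pow_sub_C]
      refine ⟨x :: l, by simp [hl], ?_⟩
      have hsup : adjoin F {y : E | y ∈ x :: l} = restrictScalars F M⟮x⟯ := by
        rw [restrictScalars_adjoin_eq_sup, hM, ← adjoin_union]
        congr 1
        ext y
        simp
      rw [hsup, pow_succ, ← hl', ← hfin]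
      exact (Module.finrank_mul_finrank F M M⟮x⟯).symm
  obtain ⟨l, hl, hl'⟩ := key n le_rfl
  refine ⟨l, hl, ?_⟩
  rw [← finrank_eq_one_iff_eq_top]
  have h1 := Module.finrank_mul_finrank F (adjoin F {y | y ∈ l}) E
  rw [hl', hd] at h1
  exact Nat.eq_of_mul_eq_mul_left (pow_pos hp.pos n) (by rw [h1, mul_one])

include hE in
lemma isSymProd_of_res_eq_one {n : ℕ} (hd : Module.finrank F E = p ^ n) {α : Br F}
    (h : Br.res E α = 1) : IsSymProd p n α := by
  have hEchar : CharP E p := charP_of_injective_algebraMap (algebraMap F E).injective p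
  obtain ⟨l, hl, hl'⟩ := exists_list_adjoin_eq_top hE hd
  have h1 : Br.res ((⊥ : IntermediateField F E) ⊔ adjoin F {y | y ∈ l} : IntermediateField F E) α = 1 := by
    rw [bot_sup_eq, hl']
    exact Br.res_eq_one_of_algHom (topEquiv (F := F) (E := E)).symm.toAlgHom h
  obtain ⟨s, hs, hs'⟩ := exists_isSymProd_of_res_adjoin_eq_one hE l ⊥ h1
  have h2 : Br.res F (α * s⁻¹) = 1 := Br.res_eq_one_of_algHom (botEquiv F E).toAlgHom hs'
  rw [Br.res_self, mul_inv_eq_one] at h2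
  rw [h2, ← hl]
  exact hs

end PurelyInseparable

section SymbolLength

variable {F A : Type} [Field F] [Ring A] [Algebra F A] {p : ℕ} [Fact p.Prime] [CharP F p]

lemma exists_list_sym_prod_eq (l : List (F × F)) :
    ∃ l' : List (F × F), l'.length ≤ l.length ∧ (∀ q ∈ l', q.2 ≠ 0) ∧
      (l'.map fun q ↦ sym p q.1 q.2).prod = (l.map fun q ↦ sym p q.1 q.2).prod := by
  induction l with
  | nil => exact ⟨[], by simp⟩
  | cons q l ih =>
    obtain ⟨l', h1, h2, h3⟩ := ih
    by_cases hq : q.2 = 0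
    · exact ⟨l', by simp; omega, h2, by simp [h3, hq, sym_zero_right]⟩
    · exact ⟨q :: l', by simpa using h1, by simpa [hq] using fun a b ↦ h2 (a, b), by simp [h3]⟩

lemma IsSymProd.symbolLengthLE {k : ℕ} (hA : IsCSA F A) (h : IsSymProd p k hA.br) :
    SymbolLengthLE p F A k := by
  obtain ⟨l, rfl, hl⟩ := h
  obtain ⟨l', h1, h2, h3⟩ := exists_list_sym_prod_eq (p := p) l
  choose D i1 i2 hD _ _ hc _ hs using fun i : Fin l'.length ↦
    exists_sym_rep p (l'.get i).1 (h2 (l'.get i) (l'.get_mem i))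
  refine ⟨l'.length, h1, D, i1, i2, fun i ↦ ⟨_, _, hc i⟩, ?_⟩
  obtain ⟨hT, hT'⟩ := IsCSA.exists_piTensor_br D hD
  rw [← hA.br_eq_iff hT, hT', hl, ← h3]
  simp_rw [hs]
  rw [← List.prod_ofFn]
  congr 1
  exact (List.ext_get (by simp) (by simp))

omit [Fact p.Prime] [CharP F p] in
lemma SymbolLengthLE.mono {k m : ℕ} (h : SymbolLengthLE p F A k) (hkm : k ≤ m) : SymbolLengthLE p F A m := by
  obtain ⟨r, hr, h⟩ := h
  exact ⟨r, hr.trans hkm, h⟩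

end SymbolLength

section ArtinSchreier

open Polynomial

variable {E : Type} [Field E] {p : ℕ} [Fact p.Prime] [CharP E p]

omit [CharP E p] in
lemma natDegree_artinSchreier (a : E) : (X ^ p - X - C a : E[X]).natDegree = p := by
  have hp : 1 < p := (Fact.out : p.Prime).one_lt
  rw [natDegree_sub_C, natDegree_sub_eq_left_of_natDegree_lt (by simpa using hp), natDegree_X_pow]

omit [CharP E p] in
lemma monic_artinSchreier (a : E) : (X ^ p - X - C a : E[X]).Monic := by
  have hp : 1 < p := (Fact.out : p.Prime).one_lt
  rw [sub_sub]
  exact monic_X_pow_sub (by rw [degree_X_add_C]; exact_mod_cast hp)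

lemma irreducible_artinSchreier {a : E} (ha : ∀ z : E, z ^ p - z ≠ a) :
    Irreducible (X ^ p - X - C a : E[X]) := by
  have hp : p.Prime := Fact.out
  have hm := monic_artinSchreier (p := p) a
  rw [hm.irreducible_iff_natDegree']
  refine ⟨fun h ↦ ?_, ?_⟩
  · have := natDegree_artinSchreier (p := p) a
    rw [h, natDegree_one] at this
    exact hp.ne_zero this.symm
  intro f g hf hg hfg hgd
  rw [natDegree_artinSchreier, Finset.mem_Ioc] at hgd
  let Ω := AlgebraicClosure E
  have hΩ : CharP Ω p := charP_of_injective_algebraMap (algebraMap E Ω).injective p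
  have hsplit : (g.map (algebraMap E Ω)).Splits := IsAlgClosed.splits _
  have hsum := hsplit.nextCoeff_eq_neg_sum_roots_of_monic (hg.map _)
  have hcard : (g.map (algebraMap E Ω)).roots.card = g.natDegree := by
    rw [← hsplit.natDegree_eq_card_roots, natDegree_map]
  have hroot : ∀ r ∈ (g.map (algebraMap E Ω)).roots, r ^ p - r = algebraMap E Ω a := by
    intro r hr
    have h1 := (mem_roots'.1 hr).2
    have h2 : ((X ^ p - X - C a : E[X]).map (algebraMap E Ω)).eval r = 0 := by
      rw [← hfg, Polynomial.map_mul, eval_mul, h1.eq_zero, mul_zero]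
    simpa [sub_eq_zero] using h2
  have key : ∀ s : Multiset Ω, (∀ r ∈ s, r ^ p - r = algebraMap E Ω a) →
      s.sum ^ p - s.sum = s.card * algebraMap E Ω a := by
    intro s
    induction s using Multiset.induction with
    | empty => simp [hp.ne_zero]
    | cons r s ih =>
      intro h
      have h1 := ih fun x hx ↦ h x (by simp [hx])
      have h2 := h r (by simp)
      rw [Multiset.sum_cons, add_pow_char, Multiset.card_cons, Nat.cast_add, Nat.cast_one]
      linear_combination h1 + h2
  have h1 := key _ hroot
  rw [hcard] at h1
  rw [nextCoeff_map (algebraMap E Ω).injective] at hsum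
  have h2 : (-g.nextCoeff) ^ p - (-g.nextCoeff) = g.natDegree * a := by
    apply (algebraMap E Ω).injective
    rw [map_sub, map_pow, map_neg, hsum, neg_neg, h1, map_mul, map_natCast]
  have h3 : (g.natDegree : E) ≠ 0 := by
    rw [Ne, CharP.cast_eq_zero_iff E p]
    exact fun h ↦ by
      have := Nat.le_of_dvd hgd.1 h
      have := hp.two_le
      omega
  have h4 : (g.natDegree : E) ^ p = g.natDegree := by
    rw [← frobenius_def, map_natCast]
  apply ha (-g.nextCoeff / g.natDegree)
  rw [div_pow, h4, ← sub_div, h2]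
  field_simp

/-- If the symbol `[a, b)` is trivial, then `b` is a norm from the Artin–Schreier extension
given by `a`. -/
lemma exists_norm_of_sym_eq_one {a b : E} (ha : ∀ z : E, z ^ p - z ≠ a) (hb : b ≠ 0)
    (h : sym p a b = 1) :
    ∃ (N : Type) (_ : Field N) (_ : Algebra E N) (θ v : N) (σ : N →ₐ[E] N),
      θ ^ p - θ = algebraMap E N a ∧ Algebra.adjoin E {θ} = ⊤ ∧ σ θ = θ - 1 ∧
      (∀ x, σ^[p] x = x) ∧ (∀ x, σ x = x → x ∈ (algebraMap E N).range) ∧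
      ∏ m ∈ Finset.range p, σ^[m] v = algebraMap E N b := by
  have hp : p.Prime := Fact.out
  obtain ⟨I, J, hr⟩ := exists_symRel_of_sym_eq_one hb h
  set f : E[X] := X ^ p - X - C a with hf
  have hfm : f.Monic := monic_artinSchreier a
  have hfd : f.natDegree = p := natDegree_artinSchreier a
  have hfirr : Fact (Irreducible f) := ⟨irreducible_artinSchreier ha⟩
  let N := AdjoinRoot f
  let θ : N := AdjoinRoot.root f
  have hN : CharP N p := charP_of_injective_algebraMap (algebraMap E N).injective p
  have hθ : θ ^ p - θ = algebraMap E N a := by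
    have := AdjoinRoot.eval₂_root f
    rw [hf, eval₂_sub, eval₂_sub, eval₂_X_pow, eval₂_X, eval₂_C, sub_eq_zero] at this
    exact this
  have hmk : ∀ g : E[X], AdjoinRoot.mk f g = aeval θ g := fun g ↦ (AdjoinRoot.aeval_eq g).symm
  let σ : N →ₐ[E] N := AdjoinRoot.liftAlgHom f (Algebra.ofId E N) (θ - 1) (by
    have : (aeval (θ - 1)) f = 0 := by
      simp only [hf, map_sub, map_pow, aeval_X, aeval_C, ← hθ, sub_pow_char]
      ring
    exact this)
  have hσθ : σ θ = θ - 1 := AdjoinRoot.liftAlgHom_root ..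
  have hσ : ∀ g : E[X], σ (aeval θ g) = aeval θ (g.comp (X - 1)) := by
    intro g
    rw [← aeval_algHom_apply, hσθ, aeval_comp]
    simp
  have htop : Algebra.adjoin E {θ} = ⊤ := AdjoinRoot.adjoinRoot_eq_top
  have hσit : ∀ m : ℕ, σ^[m] θ = θ - m := by
    intro m
    induction m with
    | zero => simp
    | succ m ih =>
      rw [Function.iterate_succ_apply', ih, map_sub, hσθ, map_natCast]
      push_cast
      ring
  have hσp : ∀ x, σ^[p] x = x := by
    have hc : ∀ m : ℕ, ∀ x, (σ ^ m) x = σ^[m] x := fun m x ↦ by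
      rw [AlgHom.coe_pow]
    have : σ ^ p = AlgHom.id E N := by
      refine AdjoinRoot.algHom_ext ?_
      change (σ ^ p) θ = θ
      rw [hc, hσit, CharP.cast_eq_zero, sub_zero]
    intro x
    rw [← hc, this, AlgHom.id_apply]
  have hI : aeval I f = 0 := by
    simp [hf, hr.pow_sub]
  let φ : N →ₐ[E] Module.End E (Fin p → E) := Ideal.Quotient.liftₐ _ (aeval I) (by
    intro g hg
    rw [Ideal.mem_span_singleton] at hg
    obtain ⟨g, rfl⟩ := hg
    rw [map_mul, hI, zero_mul])
  have hφ : ∀ g : E[X], φ (aeval θ g) = aeval I g := by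
    intro g
    rw [← hmk]
    rfl
  have hrep : ∀ x : N, ∃ g : E[X], g.natDegree < p ∧ x = aeval θ g := by
    intro x
    obtain ⟨g, rfl⟩ := AdjoinRoot.mk_surjective x
    refine ⟨g %ₘ f, ?_, ?_⟩
    · rw [← hfd]
      exact natDegree_modByMonic_lt _ hfm (fun h ↦ hfirr.out.not_isUnit (h ▸ isUnit_one))
    · rw [← hmk, AdjoinRoot.mk_eq_mk]
      exact ⟨g /ₘ f, by linear_combination -(modByMonic_add_div g f)⟩
  have hJ : ∀ x : N, J * φ x = φ (σ x) * J := by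
    intro x
    obtain ⟨g, -, rfl⟩ := hrep x
    rw [hφ, hσ, hφ, hr.mul_aeval]
  let v0 : Fin p → E := fun _ ↦ 1
  have hv0 : v0 ≠ 0 := fun h ↦ one_ne_zero (congrFun h ⟨0, hp.pos⟩)
  let ev : N →ₗ[E] (Fin p → E) := LinearMap.applyₗ v0 ∘ₗ φ.toLinearMap
  have hev : ∀ x, ev x = φ x v0 := fun x ↦ rfl
  have hinj : Function.Injective ev := by
    rw [injective_iff_map_eq_zero]
    intro x hx
    by_contra hx0
    apply hv0
    have : φ x⁻¹ (φ x v0) = v0 := by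
      rw [← Module.End.mul_apply, ← map_mul, inv_mul_cancel₀ hx0, map_one, Module.End.one_apply]
    rw [← this, ← hev, hx, map_zero]
  have hfin : FiniteDimensional E N := (AdjoinRoot.powerBasis' hfm).finite
  have hdim : Module.finrank E N = Module.finrank E (Fin p → E) := by
    rw [(AdjoinRoot.powerBasis' hfm).finrank, AdjoinRoot.powerBasis'_dim, hfd]
    simp
  obtain ⟨v, hv⟩ := (LinearMap.injective_iff_surjective_of_finrank_eq_finrank hdim).1 hinj (J v0)
  have hpow : ∀ k : ℕ, (J ^ k) v0 = φ (∏ m ∈ Finset.range k, σ^[m] v) v0 := by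
    intro k
    induction k with
    | zero => simp
    | succ k ih =>
      rw [pow_succ', Module.End.mul_apply, ih, ← Module.End.mul_apply, hJ, Module.End.mul_apply, ← hv,
        hev, ← Module.End.mul_apply, ← map_mul, map_prod, Finset.prod_range_succ']
      simp only [Function.iterate_succ_apply', Function.iterate_zero, id]
  refine ⟨N, inferInstance, inferInstance, θ, v, σ, hθ, htop, hσθ, hσp, ?_, ?_⟩
  · intro x hx
    obtain ⟨g, hgd, rfl⟩ := hrep x
    rw [hσ, ← hmk, ← hmk, AdjoinRoot.mk_eq_mk] at hx
    have h0 : g.comp (X - 1) - g = 0 := by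
      refine eq_zero_of_dvd_of_natDegree_lt hx ?_
      rw [hfd]
      refine (natDegree_sub_le _ _).trans_lt (max_lt ?_ hgd)
      rw [natDegree_comp]
      have : (X - 1 : E[X]).natDegree = 1 := natDegree_X_sub_C (1 : E)
      rwa [this, mul_one]
    have hg0 : g.natDegree = 0 := by
      by_contra hne
      exact absurd (le_natDegree_of_comp_X_sub_one (p := p) hne (sub_eq_zero.1 h0)) (by omega)
    rw [eq_C_of_natDegree_eq_zero hg0, aeval_C]
    exact ⟨_, rfl⟩
  · apply hinj
    rw [hev, ← hpow, hr.pow_eq, hev, AlgHom.commutes]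

end ArtinSchreier

section Descent

open Polynomial IntermediateField

variable {F E : Type} [Field F] [Field E] [Algebra F E] {p : ℕ} [Fact p.Prime] [CharP F p]

/-- The operators `x ↦ θ x` and `x ↦ v σ(x)` on a subfield `M(θ)` show that `[a, b)` splits over
`M`, where `b` is the norm of `v`. -/
lemma sym_eq_one_of_norm {M N : Type} [Field M] [Field N] [Algebra M N] [CharP M p] {a b : M}
    {θ v : N} (σ : N →ₐ[M] N) (hθ : θ ^ p - θ = algebraMap M N a) (hσθ : σ θ = θ - 1)
    (hσp : ∀ x, σ^[p] x = x) (hv : v ∈ M⟮θ⟯)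
    (hb : ∏ m ∈ Finset.range p, σ^[m] v = algebraMap M N b) : sym p a b = 1 := by
  have hroot : aeval θ (X ^ p - X - C a : M[X]) = 0 := by simp [hθ]
  have hInt : IsIntegral M θ := ⟨_, monic_artinSchreier (p := p) a, hroot⟩
  have hfin : FiniteDimensional M M⟮θ⟯ := adjoin.finiteDimensional hInt
  have hdim : Module.finrank M M⟮θ⟯ ≤ p := by
    rw [adjoin.finrank hInt, ← natDegree_artinSchreier (p := p) a]
    exact natDegree_le_of_dvd (minpoly.dvd M θ hroot) (monic_artinSchreier a).ne_zero
  have hσT : ∀ x ∈ M⟮θ⟯, σ x ∈ M⟮θ⟯ := by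
    have hle : M⟮θ⟯ ≤ M⟮θ⟯.comap σ := by
      rw [adjoin_simple_le_iff]
      change σ θ ∈ M⟮θ⟯
      rw [hσθ]
      exact sub_mem (mem_adjoin_simple_self M θ) (one_mem _)
    exact fun x hx ↦ hle hx
  let I : Module.End M M⟮θ⟯ := LinearMap.mulLeft M (AdjoinSimple.gen M θ)
  let J : Module.End M M⟮θ⟯ :=
    { toFun := fun x ↦ ⟨v * σ x, mul_mem hv (hσT x x.2)⟩
      map_add' := fun x y ↦ Subtype.ext (by simp [mul_add])
      map_smul' := fun c x ↦ Subtype.ext (by simp) }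
  have hJ : ∀ x, (J x : N) = v * σ x := fun x ↦ rfl
  have hI : ∀ x, (I x : N) = θ * x := fun x ↦ rfl
  have hIpow : ∀ (k : ℕ) x, ((I ^ k) x : N) = θ ^ k * x := by
    intro k
    induction k with
    | zero => simp
    | succ k ih =>
      intro x
      rw [pow_succ', Module.End.mul_apply, hI, ih]
      ring
  have hJpow : ∀ (k : ℕ) x, ((J ^ k) x : N) = (∏ m ∈ Finset.range k, σ^[m] v) * σ^[k] x := by
    intro k
    induction k with
    | zero => simp
    | succ k ih =>
      intro x
      rw [pow_succ', Module.End.mul_apply, hJ, ih, map_mul, map_prod, Finset.prod_range_succ']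
      simp only [Function.iterate_succ_apply', Function.iterate_zero, id]
      ring
  refine sym_eq_one (I := I) (J := J) ⟨?_, ?_, ?_⟩ hdim
  · refine LinearMap.ext fun x ↦ Subtype.ext ?_
    rw [LinearMap.sub_apply, AddSubgroupClass.coe_sub, hIpow, hI, ← sub_mul, hθ, Module.algebraMap_end_apply,
      IntermediateField.coe_smul, Algebra.smul_def]
  · refine LinearMap.ext fun x ↦ Subtype.ext ?_
    rw [hJpow, hb, hσp, Module.algebraMap_end_apply, IntermediateField.coe_smul, Algebra.smul_def]
  · refine LinearMap.ext fun x ↦ Subtype.ext ?_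
    rw [Module.End.mul_apply, Module.End.mul_apply, LinearMap.sub_apply, AddSubgroupClass.coe_sub,
      Module.End.one_apply, hJ, hI, hI, hJ, map_mul, hσθ]
    ring

omit [CharP F p] in
lemma Br.res_eq_sym_of_le {K₀ M : IntermediateField F E} (hle : K₀ ≤ M) [CharP K₀ p] [CharP M p] {α : Br F}
    {a : F} {b : K₀} (h : Br.res K₀ α = sym p (algebraMap F K₀ a) b) :
    Br.res M α = sym p (algebraMap F M a) (inclusion hle b) := by
  let _ : Algebra K₀ M := (inclusion hle).toRingHom.toAlgebra
  have : IsScalarTower F K₀ M := .of_algebraMap_eq' rfl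
  rw [← Br.res_res K₀ M, h, Br.res_sym]
  rfl

/-- If `α` becomes the symbol `[a, b)` over `K₀` and splits over `E`, then it can be split over `K₀`
up to at most `p - 1` symbols over `F`. -/
lemma exists_isSymProd_of_res_eq_sym (hE : ∀ z : E, z ^ p ∈ (algebraMap F E).range)
    (K₀ : IntermediateField F E) [CharP K₀ p] {α : Br F} (hα : Br.res E α = 1) {a : F} {b : K₀} (hb : b ≠ 0)
    (h : Br.res K₀ α = sym p (algebraMap F K₀ a) b) (ha : ∀ z : F, z ^ p - z ≠ a) :
    ∃ k ≤ p - 1, ∃ s, IsSymProd p k s ∧ Br.res K₀ (α * s⁻¹) = 1 := by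
  have hp : p.Prime := Fact.out
  have hEchar : CharP E p := charP_of_injective_algebraMap (algebraMap F E).injective p
  have haE : ∀ z : E, z ^ p - z ≠ algebraMap F E a := by
    intro z hz
    obtain ⟨c, hc⟩ := hE z
    refine ha (c - a) ((algebraMap F E).injective ?_)
    have : algebraMap F E (c - a) = z := by
      rw [map_sub, hc, ← hz]
      ring
    rw [map_sub, map_pow, this, hz]
  have hsymE : sym p (algebraMap F E a) (b : E) = 1 := by
    rw [← hα, ← Br.res_res K₀ E, h, Br.res_sym, ← IsScalarTower.algebraMap_apply]
    rfl
  obtain ⟨N, _, _, θ, v, σ, hθ, htop, hσθ, hσp, hfix, hnorm⟩ :=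
    exists_norm_of_sym_eq_one haE (b := (b : E)) (by simpa using hb) hsymE
  have hNchar : CharP N p := charP_of_injective_algebraMap (algebraMap E N).injective p
  by_cases hvE : v ∈ (algebraMap E N).range
  · obtain ⟨w, rfl⟩ := hvE
    obtain ⟨b₀, hb₀⟩ := hE w
    have hit : ∀ m, σ^[m] (algebraMap E N w) = algebraMap E N w := fun m ↦
      Function.iterate_fixed (σ.commutes w) m
    have hbb : algebraMap F E b₀ = b := by
      apply (algebraMap E N).injective
      rw [hb₀, ← hnorm]
      simp [hit]
    refine ⟨1, by have := hp.two_le; omega, sym p a b₀, isSymProd_sym a b₀, ?_⟩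
    rw [map_mul, map_inv, h, Br.res_sym, mul_inv_eq_one]
    congr 1
    exact Subtype.ext hbb.symm
  set P : N[X] := ∏ m ∈ Finset.range p, (X - C (σ^[m] v)) with hP
  have hPm : P.Monic := monic_prod_X_sub_C _ _
  have hPd : P.natDegree = p := by
    rw [hP, natDegree_prod_of_monic _ _ fun m _ ↦ monic_X_sub_C _]
    simp
  have hPσ : P.map σ.toRingHom = P := by
    have h1 : P.map σ.toRingHom = ∏ m ∈ Finset.range p, (X - C (σ^[m + 1] v)) := by
      rw [hP, Polynomial.map_prod]
      refine Finset.prod_congr rfl fun m _ ↦ ?_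
      rw [Polynomial.map_sub, map_X, map_C, Function.iterate_succ_apply']
      rfl
    have h2 := Finset.prod_range_succ (fun m ↦ (X - C (σ^[m] v) : N[X])) p
    rw [Finset.prod_range_succ', ← h1, ← hP, hσp] at h2
    exact mul_right_cancel₀ (X_sub_C_ne_zero v) h2
  have hcoeff : ∀ m, ∃ c : E, algebraMap E N c = P.coeff m := by
    intro m
    refine hfix _ ?_
    conv_rhs => rw [← hPσ]
    rw [coeff_map]
    rfl
  choose γ hγ using hcoeff
  have hγ0 : γ 0 = (-1) ^ p * b := by
    apply (algebraMap E N).injective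
    rw [hγ, map_mul, ← hnorm, hP, coeff_zero_prod]
    simp [Finset.prod_neg]
  let l : List E := (List.range (p - 1)).map fun m ↦ γ (m + 1)
  have hl : l.length = p - 1 := by simp [l]
  set M : IntermediateField F E := K₀ ⊔ adjoin F {y | y ∈ l} with hM
  have hMchar : CharP M p := charP_of_injective_algebraMap (algebraMap F M).injective p
  have hle : K₀ ≤ M := le_sup_left
  have hγM : ∀ m, γ m ∈ M := by
    intro m
    rcases lt_trichotomy m p with hm | rfl | hm
    · rcases Nat.eq_zero_or_pos m with rfl | hm0
      · rw [hγ0]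
        exact mul_mem (pow_mem (neg_mem (one_mem _)) _) (hle b.2)
      · refine (le_sup_right : adjoin F {y | y ∈ l} ≤ M) (subset_adjoin F _ ?_)
        simp only [l, Set.mem_ofPred_eq, List.mem_map, List.mem_range]
        exact ⟨m - 1, by omega, by congr; omega⟩
    · have : γ m = 1 := by
        apply (algebraMap E N).injective
        rw [hγ, map_one, ← hPm.coeff_natDegree, hPd]
      rw [this]
      exact one_mem _
    · have : γ m = 0 := by
        apply (algebraMap E N).injective
        rw [hγ, map_zero, coeff_eq_zero_of_natDegree_lt (by rwa [hPd])]
      rw [this]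
      exact zero_mem _
  have hEN : ∀ x : E, x ∈ M → algebraMap E N x ∈ M⟮θ⟯ := fun x hx ↦
    (M⟮θ⟯).algebraMap_mem (⟨x, hx⟩ : M)
  have hpow : ∀ x : N, x ^ p ∈ M⟮θ⟯ := by
    intro x
    have hv : x ∈ Algebra.adjoin E {θ} := htop ▸ Algebra.mem_top
    induction hv using Algebra.adjoin_induction with
    | mem x hx =>
      rw [Set.mem_singleton_iff.1 hx]
      exact pow_mem (mem_adjoin_simple_self M θ) p
    | algebraMap r =>
      obtain ⟨c, hc⟩ := hE r
      rw [← map_pow, ← hc]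
      exact hEN _ (M.algebraMap_mem c)
    | add x y _ _ hx hy =>
      rw [add_pow_char]
      exact add_mem hx hy
    | mul x y _ _ hx hy =>
      rw [mul_pow]
      exact mul_mem hx hy
  have hvp := hpow v
  have hvT : v ∈ M⟮θ⟯ := by
    by_contra hvT
    have hmin : minpoly M⟮θ⟯ v = X ^ p - C ⟨v ^ p, hvp⟩ :=
      minpoly_eq_X_pow_sub_C rfl (by rintro ⟨y, rfl⟩; exact hvT y.2)
    have hlift : P ∈ lifts (algebraMap M⟮θ⟯ N) := by
      rw [lifts_iff_coeff_lifts]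
      exact fun m ↦ ⟨⟨_, hEN _ (hγM m)⟩, hγ m⟩
    obtain ⟨Q, hQ, hQd, hQm⟩ := lifts_and_natDegree_eq_and_monic hlift hPm
    have hroot : ∀ m < p, P.eval (σ^[m] v) = 0 := by
      intro m hm
      rw [hP, eval_prod]
      exact Finset.prod_eq_zero (Finset.mem_range.2 hm) (by simp)
    have hdvd : minpoly M⟮θ⟯ v ∣ Q := by
      apply minpoly.dvd
      rw [aeval_def, ← eval_map, hQ]
      exact hroot 0 hp.pos
    have hQeq : Q = minpoly M⟮θ⟯ v := by
      refine eq_of_monic_of_dvd_of_natDegree_le ?_ hQm hdvd ?_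
      · rw [hmin]
        exact monic_X_pow_sub_C _ hp.ne_zero
      · rw [hQd, hPd, hmin, natDegree_X_pow_sub_C]
    have hPeq : P = X ^ p - C (v ^ p) := by
      rw [← hQ, hQeq, hmin]
      simp
    have h1 := hroot 1 hp.one_lt
    rw [hPeq, eval_sub, eval_X_pow, eval_C, sub_eq_zero] at h1
    exact hvE (hfix v (frobenius_inj N p h1))
  have hsymM : sym p (algebraMap F M a) (inclusion hle b) = 1 := by
    refine sym_eq_one_of_norm (σ.restrictScalars M) ?_ hσθ hσp hvT hnorm
    rw [hθ]
    rfl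
  obtain ⟨s, hs, hs'⟩ := exists_isSymProd_of_res_adjoin_eq_one hE l K₀
    ((Br.res_eq_sym_of_le hle h).trans hsymM)
  exact ⟨p - 1, le_rfl, s, hl ▸ hs, hs'⟩

end Descent

section MatrixFacts

open Polynomial Matrix

lemma Matrix.trace_pow_char {R n : Type} [Field R] {p : ℕ} [Fact p.Prime] [CharP R p] [Fintype n] [DecidableEq n]
    [Nonempty n] (M : Matrix n n R) : trace (M ^ p) = trace M ^ p := by
  have hp : p.Prime := Fact.out
  have h1 : expand R p (M ^ p).charpoly = M.charpoly ^ p := by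
    unfold charpoly
    rw [AlgHom.map_det, ← coe_detMonoidHom, ← (detMonoidHom : Matrix n n R[X] →* R[X]).map_pow]
    apply congr_arg det
    refine matPolyEquiv.injective ?_
    rw [map_pow, matPolyEquiv_charmatrix, sub_pow_char_of_commute _ (C M).commute_X, ← C_pow]
    exact (id (matPolyEquiv_eq_X_pow_sub_C p M) :)
  have h2 : (M ^ p).charpoly = M.charpoly.map (frobenius R p) := by
    apply expand_injective hp.pos
    rw [h1, ← map_frobenius_expand, map_expand]
  rw [trace_eq_neg_charpoly_coeff, trace_eq_neg_charpoly_coeff, h2, coeff_map, ← frobenius_def, map_neg]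

lemma Matrix.rank_map_algebraMap {F L n : Type} [Field F] [Field L] [Algebra F L] [Fintype n] [DecidableEq n]
    (M : Matrix n n F) : (M.map (algebraMap F L)).rank = M.rank := by
  classical
  obtain ⟨l, l', D, rfl⟩ := Pivot.exists_list_transvec_mul_diagonal_mul_list_transvec M
  have h := TransvectionStruct.det_toMatrix_prod l
  have h' := TransvectionStruct.det_toMatrix_prod l'
  set U := (l.map TransvectionStruct.toMatrix).prod
  set V := (l'.map TransvectionStruct.toMatrix).prod
  have hdet : ∀ W : Matrix n n F, W.det = 1 → IsUnit (W.map (algebraMap F L)).det := by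
    intro W hW
    have := (algebraMap F L).map_det W
    rw [RingHom.mapMatrix_apply, hW, map_one] at this
    rw [← this]
    exact isUnit_one
  rw [Matrix.map_mul, Matrix.map_mul, rank_mul_eq_left_of_isUnit_det _ _ (hdet V h'),
    rank_mul_eq_right_of_isUnit_det _ _ (hdet U h),
    rank_mul_eq_left_of_isUnit_det _ _ (by rw [h']; exact isUnit_one),
    rank_mul_eq_right_of_isUnit_det _ _ (by rw [h]; exact isUnit_one), diagonal_map (map_zero _), rank_diagonal,
    rank_diagonal]
  refine Fintype.card_congr (Equiv.subtypeEquivRight fun i ↦ ?_)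
  simp

/-- A representation of a matrix algebra on a space of the same size is isomorphic to the standard one. -/
lemma Matrix.exists_intertwiner {F L n : Type} [Field F] [Field L] [Algebra F L] [Fintype n] [DecidableEq n]
    [Nonempty n] (f : Matrix n n F →ₐ[F] Matrix n n L) :
    ∃ Q : Matrix n n L, IsUnit Q.det ∧ ∀ b, f b * Q = Q * b.map (algebraMap F L) := by
  obtain ⟨o⟩ := ‹Nonempty n›
  have : Nonempty n := ⟨o⟩
  have hinj : Function.Injective f := f.toRingHom.injective
  have hne : f (single o o 1) ≠ 0 := by
    rw [Ne, ← map_zero f, hinj.eq_iff]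
    intro h
    have := congrFun (congrFun h o) o
    simp at this
  obtain ⟨u, hu⟩ : ∃ u, f (single o o 1) *ᵥ u ≠ 0 := by
    by_contra! h
    exact hne (Matrix.ext_of_mulVec_single fun i ↦ by rw [h, zero_mulVec])
  let Q : Matrix n n L := fun x i ↦ (f (single i o 1) *ᵥ u) x
  have hQ : ∀ c : n → L, Q *ᵥ c = ∑ i, c i • (f (single i o 1) *ᵥ u) := by
    intro c
    ext x
    simp [Q, mulVec, dotProduct, mul_comm]
  refine ⟨Q, ?_, ?_⟩
  · rw [← Matrix.isUnit_iff_isUnit_det, ← Matrix.mulVec_injective_iff_isUnit,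
      ← Matrix.coe_mulVecLin, injective_iff_map_eq_zero]
    intro c hc
    rw [Matrix.mulVecLin_apply, hQ] at hc
    ext j
    have h1 := congrArg (f (single o j 1) *ᵥ ·) hc
    simp only [mulVec_sum, mulVec_smul, mulVec_mulVec, ← map_mul, mulVec_zero] at h1
    rw [Finset.sum_eq_single j] at h1
    · rw [single_mul_single_same, mul_one] at h1
      exact (smul_eq_zero.1 h1).resolve_right hu
    · intro i _ hij
      rw [single_mul_single_of_ne _ _ _ _ hij.symm, map_zero, zero_mulVec, smul_zero]
    · simp
  · intro b
    ext x i
    have h1 : b * single i o 1 = ∑ k, b k i • single k o (1 : F) := by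
      ext y z
      by_cases hz : o = z <;> simp [Matrix.sum_apply, single_apply, Matrix.mul_apply, hz]
    have h2 : (f b * Q) x i = (f b *ᵥ (f (single i o 1) *ᵥ u)) x := rfl
    rw [h2, mulVec_mulVec, ← map_mul, h1, map_sum, Matrix.sum_mulVec, Finset.sum_apply, Matrix.mul_apply]
    refine Finset.sum_congr rfl fun k _ ↦ ?_
    rw [map_smul, smul_mulVec, Pi.smul_apply, Algebra.smul_def, mul_comm, map_apply]

end MatrixFacts

section CyclicPermutation

open Matrix
open scoped Fin.CommRing

variable {p : ℕ} [Fact p.Prime] {L : Type} [Field L] {d : ℕ}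

lemma sum_range_shift {M : Type*} [AddCommMonoid M] (g : Fin p → M) (i : Fin p) :
    ∑ k ∈ Finset.range p, g (i - (k : Fin p)) = ∑ j, g j := by
  rw [Finset.sum_range, ← Equiv.sum_comp (Equiv.subLeft i) g]
  refine Finset.sum_congr rfl fun k _ ↦ ?_
  rw [Fin.cast_val_eq_self, Equiv.subLeft_apply]

/-- The weight of `s` concentrated at the sets containing `0`. Its sum over the translates of a proper
nonempty set is `1`. -/
noncomputable def cyclicWeight (L : Type) [Field L] (s : Finset (Fin p)) : L := if 0 ∈ s then (s.card : L)⁻¹ else 0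

lemma sum_cyclicWeight [CharP L p] (s : Finset (Fin p)) (h0 : s.Nonempty) (h1 : s ≠ Finset.univ)
    (T : ℕ → Finset (Fin p)) (hT : ∀ k i, i ∈ T k ↔ i - (k : Fin p) ∈ s) :
    ∑ k ∈ Finset.range p, cyclicWeight L (T k) = 1 := by
  have hcard : ∀ k, (T k).card = s.card := by
    intro k
    refine Finset.card_bij (fun i _ ↦ i - (k : Fin p)) (fun i hi ↦ (hT k i).1 hi)
      (fun i _ j _ h ↦ by simpa using h) fun j hj ↦ ⟨j + (k : Fin p), (hT _ _).2 (by simpa using hj), by simp⟩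
  have hne : (s.card : L) ≠ 0 := by
    rw [Ne, CharP.cast_eq_zero_iff L p]
    intro h
    have h2 : s.card < p := by
      simpa using (Finset.card_lt_iff_ne_univ s).2 h1
    exact absurd (Nat.le_of_dvd h0.card_pos h) (by omega)
  have : ∀ k, cyclicWeight L (T k) = if (0 : Fin p) - (k : Fin p) ∈ s then (s.card : L)⁻¹ else 0 := by
    intro k
    simp only [cyclicWeight, hT, hcard]
  simp_rw [this]
  rw [sum_range_shift (fun j ↦ if j ∈ s then (s.card : L)⁻¹ else 0) 0]
  simp [hne]

/-- The cyclic rotation of words. -/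
def wordRot (p : ℕ) [Fact p.Prime] (d : ℕ) : Equiv.Perm (Fin p → Fin d) :=
  (Equiv.addRight 1).arrowCongr (Equiv.refl _)

lemma wordRot_apply (x : Fin p → Fin d) (i : Fin p) : wordRot p d x i = x (i - 1) := by
  simp [wordRot, Equiv.arrowCongr_apply, sub_eq_add_neg]

lemma wordRot_symm_apply (x : Fin p → Fin d) (i : Fin p) : (wordRot p d).symm x i = x (i + 1) := by
  simp [wordRot, Equiv.arrowCongr_symm]

lemma wordRot_iterate (k : ℕ) (x : Fin p → Fin d) (i : Fin p) :
    (wordRot p d)^[k] x i = x (i - (k : Fin p)) := by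
  induction k generalizing i with
  | zero => simp
  | succ k ih =>
    rw [Function.iterate_succ_apply', wordRot_apply, ih]
    congr 1
    push_cast
    ring

/-- The permutation matrix of the cyclic rotation of words. -/
def rotMatrix (p : ℕ) [Fact p.Prime] (d : ℕ) (L : Type) [Field L] :
    Matrix (Fin p → Fin d) (Fin p → Fin d) L :=
  (1 : Matrix _ _ L).submatrix (wordRot p d) id

lemma rotMatrix_mul (M : Matrix (Fin p → Fin d) (Fin p → Fin d) L) (x y) :
    (rotMatrix p d L * M) x y = M (wordRot p d x) y := by
  have := one_submatrix_mul (wordRot p d) (Equiv.refl _) M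
  exact congrFun (congrFun this x) y

lemma mul_rotMatrix (M : Matrix (Fin p → Fin d) (Fin p → Fin d) L) (x y) :
    (M * rotMatrix p d L) x y = M x ((wordRot p d).symm y) := by
  have := mul_submatrix_one (wordRot p d) id M
  exact congrFun (congrFun this x) y

lemma rotMatrix_mulVec (f : (Fin p → Fin d) → L) (x) :
    (rotMatrix p d L *ᵥ f) x = f (wordRot p d x) := by
  simp [rotMatrix, mulVec, dotProduct, Matrix.one_apply]

lemma rotMatrix_pow_mulVec (k : ℕ) (f : (Fin p → Fin d) → L) (x) :
    (rotMatrix p d L ^ k *ᵥ f) x = f ((wordRot p d)^[k] x) := by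
  induction k generalizing f with
  | zero => simp
  | succ k ih =>
    rw [pow_succ, ← mulVec_mulVec, ih, rotMatrix_mulVec, Function.iterate_succ_apply']

lemma wordRot_iterate_prime (x : Fin p → Fin d) : (wordRot p d)^[p] x = x := by
  ext i
  rw [wordRot_iterate]
  simp

lemma rotMatrix_pow_prime : rotMatrix p d L ^ p = 1 := by
  refine Matrix.ext_of_mulVec_single fun i ↦ funext fun x ↦ ?_
  rw [rotMatrix_pow_mulVec, wordRot_iterate_prime, one_mulVec]

lemma rotMatrix_rank [CharP L p] :
    (rotMatrix p d L - 1).rank + (∑ k ∈ Finset.range p, rotMatrix p d L ^ k).rank + d =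
      Fintype.card (Fin p → Fin d) := by
  classical
  set P := rotMatrix p d L
  set S := ∑ k ∈ Finset.range p, P ^ k with hS
  let K := LinearMap.ker (P - 1).mulVecLin
  have hK : ∀ f, f ∈ K ↔ ∀ x, f (wordRot p d x) = f x := by
    intro f
    rw [LinearMap.mem_ker, mulVecLin_apply, sub_mulVec, one_mulVec, sub_eq_zero, funext_iff]
    simp_rw [P, rotMatrix_mulVec]
  have hSf : ∀ f x, (S *ᵥ f) x = ∑ k ∈ Finset.range p, f ((wordRot p d)^[k] x) := by
    intro f x
    rw [hS, sum_mulVec, Finset.sum_apply]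
    simp_rw [P, rotMatrix_pow_mulVec]
  have hconst : ∀ (k : ℕ) (c : Fin d), (wordRot p d)^[k] (fun _ ↦ c) = fun _ ↦ c := by
    intro k c
    ext i
    rw [wordRot_iterate]
  let res : ((Fin p → Fin d) → L) →ₗ[L] (Fin d → L) := LinearMap.funLeft L L fun c _ ↦ c
  have hres : ∀ f c, res f c = f fun _ ↦ c := fun f c ↦ rfl
  have hsurj : Function.Surjective (res.domRestrict K) := by
    intro g
    refine ⟨⟨fun x ↦ if ∀ i, x i = x 0 then g (x 0) else 0, (hK _).2 fun x ↦ ?_⟩, ?_⟩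
    · simp only [wordRot_apply]
      by_cases h : ∀ i, x i = x 0
      · simp [h]
      · rw [if_neg h, if_neg]
        intro h'
        apply h
        have key : ∀ i, x i = x (0 - 1) := fun i ↦ by simpa using h' (i + 1)
        exact fun i ↦ (key i).trans (key 0).symm
    · ext c
      simp [hres]
  have hker : K ⊓ LinearMap.ker res = LinearMap.range S.mulVecLin := by
    apply le_antisymm
    · rintro f ⟨hf, hf'⟩
      rw [SetLike.mem_coe, hK] at hf
      rw [SetLike.mem_coe, LinearMap.mem_ker, funext_iff] at hf'
      simp only [hres, Pi.zero_apply] at hf'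
      let m : (Fin p → Fin d) → Finset (Fin p) := fun x ↦ {i | ∀ j, x j ≤ x i}
      have hfk : ∀ k x, f ((wordRot p d)^[k] x) = f x := by
        intro k
        induction k with
        | zero => simp
        | succ k ih => exact fun x ↦ by rw [Function.iterate_succ_apply', hf, ih]
      refine ⟨fun x ↦ cyclicWeight L (m x) * f x, funext fun x ↦ ?_⟩
      rw [mulVecLin_apply, hSf]
      simp_rw [hfk, ← Finset.sum_mul]
      by_cases hx : ∃ c, x = fun _ ↦ c
      · obtain ⟨c, rfl⟩ := hx
        rw [hf', mul_zero]
      rw [sum_cyclicWeight (m x), one_mul]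
      · obtain ⟨i, -, hi⟩ := Finset.exists_max_image Finset.univ x ⟨0, Finset.mem_univ 0⟩
        exact ⟨i, by simpa [m] using fun j ↦ hi j (Finset.mem_univ j)⟩
      · intro h
        apply hx
        have h' : ∀ i j, x j ≤ x i := by
          intro i
          have : i ∈ m x := h ▸ Finset.mem_univ i
          simpa [m] using this
        exact ⟨x 0, funext fun i ↦ le_antisymm (h' _ _) (h' _ _)⟩
      · intro k i
        simp only [m, Finset.mem_filter, Finset.mem_univ, true_and, wordRot_iterate]
        exact ⟨fun h j ↦ by simpa using h (j + (k : Fin p)), fun h j ↦ h _⟩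
    · rintro _ ⟨g, rfl⟩
      refine ⟨(hK _).2 fun x ↦ ?_, ?_⟩
      · rw [mulVecLin_apply, hSf, hSf]
        have h2 := Finset.sum_range_succ (fun k ↦ g ((wordRot p d)^[k] x)) p
        rw [Finset.sum_range_succ', wordRot_iterate_prime] at h2
        exact add_right_cancel h2
      · rw [SetLike.mem_coe, LinearMap.mem_ker]
        ext c
        rw [hres, mulVecLin_apply, hSf]
        simp [hconst]
  have h1 := LinearMap.finrank_range_add_finrank_ker (P - 1).mulVecLin
  have h2 := LinearMap.finrank_range_add_finrank_ker (res.domRestrict K)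
  rw [LinearMap.range_eq_top.2 hsurj, finrank_top] at h2
  have h3 : Module.finrank L (LinearMap.ker (res.domRestrict K)) = S.rank := by
    have h4 : Submodule.map K.subtype (LinearMap.ker (res.domRestrict K)) =
        K ⊓ LinearMap.ker res := by
      ext f
      simp [LinearMap.domRestrict_apply, and_comm]
    rw [Matrix.rank, ← hker, ← h4, Submodule.finrank_map_subtype_eq K]
  rw [h3] at h2
  simp only [Module.finrank_fintype_fun_eq_card, Fintype.card_fin] at h1 h2
  rw [← h1]
  change _ = (P - 1).rank + Module.finrank L K
  omega

end CyclicPermutation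

section TensorPower

open Matrix
open scoped Fin.CommRing

variable {p : ℕ} [Fact p.Prime] {F : Type} [Field F] {A : Type} [Ring A] [Algebra F A]

variable (p F A) in
/-- The cyclic rotation of the factors of the `p`-th tensor power of an algebra. -/
noncomputable def tensorRot : (⨂[F] _ : Fin p, A) →ₐ[F] ⨂[F] _ : Fin p, A :=
  PiTensorProduct.liftAlgHom
    ((PiTensorProduct.tprod F).domDomCongr (Equiv.addRight (1 : Fin p)))
    (by simp [PiTensorProduct.one_def, Pi.one_def])
    (fun x y ↦ by
      simp only [MultilinearMap.domDomCongr_apply, PiTensorProduct.tprod_mul_tprod]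
      rfl)

lemma tensorRot_tprod (a : Fin p → A) :
    tensorRot p F A (PiTensorProduct.tprod F a) = PiTensorProduct.tprod F fun i ↦ a (i + 1) := by
  simp [tensorRot]

lemma tensorRot_iterate_tprod (k : ℕ) (a : Fin p → A) :
    (tensorRot p F A)^[k] (PiTensorProduct.tprod F a) =
      PiTensorProduct.tprod F fun i ↦ a (i + (k : Fin p)) := by
  induction k with
  | zero => simp
  | succ k ih =>
    rw [Function.iterate_succ_apply', ih, tensorRot_tprod]
    congr 1
    ext i
    congr 1
    push_cast
    ring

variable {L : Type} [Field L] [Algebra F L] {d : ℕ}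

/-- The entries of the Kronecker product of the matrices `ρ (a i)`, as a function of `a`. -/
noncomputable def tensorMatEntry (p : ℕ) (ρ : A →ₐ[F] Matrix (Fin d) (Fin d) L)
    (x y : Fin p → Fin d) : MultilinearMap F (fun _ : Fin p ↦ A) L :=
  (MultilinearMap.mkPiAlgebra F (Fin p) L).compLinearMap fun i ↦
    Matrix.entryLinearMap F L (x i) (y i) ∘ₗ ρ.toLinearMap

lemma tensorMatEntry_apply {p : ℕ} (ρ : A →ₐ[F] Matrix (Fin d) (Fin d) L)
    (x y : Fin p → Fin d) (a : Fin p → A) :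
    tensorMatEntry p ρ x y a = ∏ i, ρ (a i) (x i) (y i) := by
  simp [tensorMatEntry]

/-- The tensor power of a matrix representation. -/
noncomputable def tensorMat (p : ℕ) [Fact p.Prime] (ρ : A →ₐ[F] Matrix (Fin d) (Fin d) L) :
    (⨂[F] _ : Fin p, A) →ₐ[F] Matrix (Fin p → Fin d) (Fin p → Fin d) L :=
  PiTensorProduct.liftAlgHom
    { toFun := fun a ↦ Matrix.of fun x y ↦ tensorMatEntry p ρ x y a
      map_update_add' := fun a i b c ↦ by
        ext x y
        exact (tensorMatEntry p ρ x y).map_update_add a i b c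
      map_update_smul' := fun a i b c ↦ by
        ext x y
        exact (tensorMatEntry p ρ x y).map_update_smul a i b c }
    (by
      ext x y
      simp [tensorMatEntry_apply, Matrix.one_apply, Finset.prod_ite_zero, funext_iff])
    (fun a b ↦ by
      ext x y
      simp only [MultilinearMap.coe_mk, Matrix.of_apply, tensorMatEntry_apply, Pi.mul_apply, map_mul,
        Matrix.mul_apply, Finset.prod_univ_sum, Fintype.piFinset_univ, Finset.prod_mul_distrib])

lemma tensorMat_tprod (ρ : A →ₐ[F] Matrix (Fin d) (Fin d) L) (a : Fin p → A)
    (x y : Fin p → Fin d) :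
    tensorMat p ρ (PiTensorProduct.tprod F a) x y = ∏ i, ρ (a i) (x i) (y i) := by
  rw [← tensorMatEntry_apply]
  simp [tensorMat]

lemma rotMatrix_mul_tensorMat (ρ : A →ₐ[F] Matrix (Fin d) (Fin d) L) (z : ⨂[F] _ : Fin p, A) :
    rotMatrix p d L * tensorMat p ρ z = tensorMat p ρ (tensorRot p F A z) * rotMatrix p d L := by
  induction z using PiTensorProduct.induction_on with
  | smul_tprod r a =>
    rw [map_smul, map_smul, map_smul, mul_smul_comm, smul_mul_assoc]
    congr 1
    ext x y
    rw [rotMatrix_mul, mul_rotMatrix, tensorRot_tprod, tensorMat_tprod, tensorMat_tprod,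
      ← Equiv.prod_comp (Equiv.addRight (1 : Fin p))]
    simp [wordRot_apply, wordRot_symm_apply]
  | add z w hz hw => simp only [map_add, mul_add, add_mul, hz, hw]

lemma trace_rotMatrix_mul_tensorMat (ρ : A →ₐ[F] Matrix (Fin d) (Fin d) L) (a : A) :
    (rotMatrix p d L * tensorMat p ρ (PiTensorProduct.tprod F (Pi.mulSingle 0 a))).trace =
      (ρ a).trace := by
  simp only [trace, diag_apply, rotMatrix_mul, tensorMat_tprod, wordRot_apply]
  symm
  refine Finset.sum_of_injOn (fun c _ ↦ c) (fun c _ c' _ h ↦ congrFun h 0) (by simp)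
    (fun x _ hx ↦ ?_) fun c _ ↦ ?_
  · by_contra h
    rw [← ne_eq, Finset.prod_ne_zero_iff] at h
    have h1 : ∀ i : Fin p, i ≠ 0 → x (i - 1) = x i := by
      intro i hi
      by_contra hne
      have := h i (Finset.mem_univ i)
      rw [Pi.mulSingle_eq_of_ne hi, map_one, Matrix.one_apply_ne hne] at this
      exact this rfl
    have h2 : ∀ k : ℕ, k < p → x (k : Fin p) = x 0 := by
      intro k
      induction k with
      | zero => simp
      | succ k ih =>
        intro hk
        rw [← ih (by omega), ← h1]
        · simp
        · intro h0
          have := congrArg Fin.val h0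
          rw [Fin.val_natCast, Nat.mod_eq_of_lt hk] at this
          simp at this
    refine hx ⟨x 0, by simp, funext fun i ↦ ?_⟩
    have := h2 i.val i.isLt
    rw [Fin.cast_val_eq_self] at this
    exact this.symm
  · rw [← Finset.mul_prod_erase _ _ (Finset.mem_univ (0 : Fin p)), Pi.mulSingle_eq_same,
      Finset.prod_eq_one, mul_one]
    intro i hi
    rw [Pi.mulSingle_eq_of_ne (Finset.ne_of_mem_erase hi), map_one, Matrix.one_apply_eq]

end TensorPower

section RotationMatrix

open Matrix

variable {p : ℕ} [Fact p.Prime] {F : Type} [Field F] {A : Type} [Ring A] [Algebra F A]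

lemma Matrix.exists_smul_of_intertwiner {L n : Type} [Field L] [Algebra F L] [Fintype n]
    [DecidableEq n] {Q P : Matrix n n L} (hQ : IsUnit Q.det) {t : Matrix n n F} (ht : IsUnit t.det)
    (hPt : ∀ b : Matrix n n F, ∃ b' : Matrix n n F, ∃ m m' : Matrix n n L,
      m * Q = Q * b.map (algebraMap F L) ∧ m' * Q = Q * b'.map (algebraMap F L) ∧
      P * m = m' * P ∧ b' * t = t * b) :
    ∃ z : L, P * Q = Q * (z • t.map (algebraMap F L)) := by
  let T : Matrix n n L := t.map (algebraMap F L)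
  have hT : IsUnit T.det := by
    have := ht.map (algebraMap F L)
    rwa [RingHom.map_det] at this
  have hQT : IsUnit (Q * T).det := by rw [det_mul]; exact hQ.mul hT
  have hcomm : ∀ b : Matrix n n F, Commute (b.map (algebraMap F L)) ((Q * T)⁻¹ * (P * Q)) := by
    intro b
    obtain ⟨b', m, m', h1, h2, h3, h4⟩ := hPt b
    have h4' : b'.map (algebraMap F L) * T = T * b.map (algebraMap F L) := by
      rw [← Matrix.map_mul, h4, Matrix.map_mul]
    have h5 : (Q * T) * b.map (algebraMap F L) = m' * (Q * T) := by
      rw [mul_assoc, ← h4', ← mul_assoc, ← h2, mul_assoc]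
    have h6 : (Q * T)⁻¹ * m' = b.map (algebraMap F L) * (Q * T)⁻¹ := by
      calc (Q * T)⁻¹ * m' = (Q * T)⁻¹ * (m' * (Q * T)) * (Q * T)⁻¹ := by
            rw [mul_assoc, mul_assoc m', mul_nonsing_inv _ hQT, mul_one]
        _ = _ := by rw [← h5, ← mul_assoc, nonsing_inv_mul _ hQT, one_mul]
    change _ = _
    rw [← mul_assoc, ← h6, mul_assoc, ← mul_assoc m', ← h3, mul_assoc P, h1]
    simp only [mul_assoc]
  obtain ⟨z, hz⟩ := Matrix.mem_range_scalar_of_commute_single (M := (Q * T)⁻¹ * (P * Q))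
    (fun i j _ ↦ by
      have := hcomm (single i j 1)
      rwa [Matrix.map_single, map_one] at this)
  refine ⟨z, ?_⟩
  calc P * Q = (Q * T) * ((Q * T)⁻¹ * (P * Q)) := by
        rw [← mul_assoc, mul_nonsing_inv _ hQT, one_mul]
    _ = _ := by
        rw [← hz, scalar_apply, ← smul_one_eq_diagonal, Matrix.mul_smul, Matrix.mul_smul, mul_one]

lemma exists_rotation_matrix [CharP F p] (hA : IsCSA F A)
    (hs : IsSplitAlg F (⨂[F] _ : Fin p, A)) :
    ∃ d : ℕ, 0 < d ∧ Module.finrank F A = d ^ 2 ∧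
      ∃ (β : (⨂[F] _ : Fin p, A) →ₐ[F] Matrix (Fin p → Fin d) (Fin p → Fin d) F)
        (t : Matrix (Fin p → Fin d) (Fin p → Fin d) F),
        t ^ p = 1 ∧ (∀ y, t * β y = β (tensorRot p F A y) * t) ∧
        (t - 1).rank + (∑ k ∈ Finset.range p, t ^ k).rank + d =
          Fintype.card (Fin p → Fin d) := by
  let Ω := AlgebraicClosure F
  have : CharP Ω p := charP_of_injective_algebraMap (algebraMap F Ω).injective p
  have hΩ := hA.baseChange Ω
  have := hΩ.2.1
  have := hΩ.2.2
  have := hA.2.2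
  obtain ⟨d, hd, ⟨e⟩⟩ := IsSimpleRing.exists_algEquiv_matrix_of_isAlgClosed Ω (Ω ⊗[F] A)
  have hdA : Module.finrank F A = d ^ 2 := by
    rw [← Module.finrank_baseChange (R := Ω), e.toLinearEquiv.finrank_eq]
    simp [Module.finrank_matrix, sq]
  refine ⟨d, Nat.pos_of_ne_zero hd.out, hdA, ?_⟩
  let ρ : A →ₐ[F] Matrix (Fin d) (Fin d) Ω :=
    (e.toAlgHom.restrictScalars F).comp Algebra.TensorProduct.includeRight
  have hρ : ∀ a, ρ a = e (1 ⊗ₜ a) := fun a ↦ rfl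
  have htr : ∃ y, (ρ y).trace ≠ 0 := by
    by_contra! h
    have h0 : (Matrix.traceLinearMap (Fin d) Ω Ω) ∘ₗ e.toLinearMap = 0 := by
      ext a
      simpa [hρ] using h a
    have := LinearMap.congr_fun h0 (e.symm (single 0 0 1))
    simp at this
  obtain ⟨m, hm, ⟨e₀⟩⟩ := hs
  obtain ⟨hB, hBd⟩ := finrank_piTensorProduct (F := F) fun _ : Fin p ↦ A
  have hmd : m = d ^ p := by
    rw [e₀.toLinearEquiv.finrank_eq] at hBd
    simp only [Module.finrank_matrix, Fintype.card_fin, Module.finrank_self, mul_one, hdA,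
      Finset.prod_const, Finset.card_univ] at hBd
    rw [← sq, ← pow_mul, mul_comm, pow_mul] at hBd
    exact Nat.pow_left_injective two_ne_zero hBd
  let σ : Fin m ≃ (Fin p → Fin d) := Fintype.equivOfCardEq (by simp [hmd])
  let β : (⨂[F] _ : Fin p, A) ≃ₐ[F] Matrix (Fin p → Fin d) (Fin p → Fin d) F :=
    e₀.trans (Matrix.reindexAlgEquiv F F σ)
  obtain ⟨t, ht, htβ⟩ := Matrix.exists_intertwiner (L := F)
    ((β.toAlgHom.comp (tensorRot p F A)).comp β.symm.toAlgHom)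
  obtain ⟨Q, hQ, hQβ⟩ := Matrix.exists_intertwiner
    ((tensorMat p ρ).comp β.symm.toAlgHom)
  have htβ' : ∀ y, β (tensorRot p F A y) * t = t * β y := by
    intro y
    simpa [Matrix.map_id'] using htβ (β y)
  have hQβ' : ∀ y, tensorMat p ρ y * Q = Q * (β y).map (algebraMap F Ω) := by
    intro y
    simpa using hQβ (β y)
  set P := rotMatrix p d Ω
  obtain ⟨z, hz⟩ := Matrix.exists_smul_of_intertwiner (P := P) hQ ht fun b ↦
    ⟨β (tensorRot p F A (β.symm b)), tensorMat p ρ (β.symm b),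
      tensorMat p ρ (tensorRot p F A (β.symm b)), by simpa using hQβ' (β.symm b), hQβ' _,
      rotMatrix_mul_tensorMat ρ _, by simpa using htβ' (β.symm b)⟩
  have hpow : ∀ T : Matrix (Fin p → Fin d) (Fin p → Fin d) Ω, P * Q = Q * T →
      ∀ k, P ^ k * Q = Q * T ^ k := by
    intro T hT k
    exact ((show SemiconjBy Q T P from hT.symm).pow_right k).eq.symm
  have hcancel : ∀ M N : Matrix (Fin p → Fin d) (Fin p → Fin d) Ω, Q * M = Q * N → M = N := by
    intro M N h
    simpa [← mul_assoc, nonsing_inv_mul _ hQ] using congrArg (Q⁻¹ * ·) h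
  have hone : ∀ T : Matrix (Fin p → Fin d) (Fin p → Fin d) Ω, P * Q = Q * T → T ^ p = 1 := by
    intro T hT
    have h := hpow T hT p
    rw [rotMatrix_pow_prime, one_mul] at h
    exact hcancel _ _ (by rw [← h, mul_one])
  obtain ⟨ζ, rfl⟩ : ∃ ζ : F, algebraMap F Ω ζ = z := by
    have htrace : ∀ y, (ρ y).trace = z * algebraMap F Ω
        (t * β (PiTensorProduct.tprod F (Pi.mulSingle 0 y))).trace := by
      intro y
      rw [← trace_rotMatrix_mul_tensorMat (p := p)]
      set w := PiTensorProduct.tprod F (Pi.mulSingle (0 : Fin p) y : Fin p → A)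
      have h1 : P * tensorMat p ρ w * Q =
          Q * ((z • t.map (algebraMap F Ω)) * (β w).map (algebraMap F Ω)) := by
        rw [mul_assoc, hQβ', ← mul_assoc, hz, mul_assoc]
      have h2 : P * tensorMat p ρ w =
          Q * ((z • t.map (algebraMap F Ω)) * (β w).map (algebraMap F Ω)) * Q⁻¹ := by
        rw [← h1, mul_assoc, mul_nonsing_inv _ hQ, mul_one]
      rw [h2, trace_mul_comm, ← mul_assoc, nonsing_inv_mul _ hQ, one_mul, smul_mul_assoc,
        trace_smul, smul_eq_mul, ← Matrix.map_mul, AddMonoidHom.map_trace (algebraMap F Ω)]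
    let x : Fin p → Fin d := fun _ ↦ 0
    have hzp : z ^ p * algebraMap F Ω ((t ^ p) x x) = 1 := by
      have h := congrFun (congrFun (hone _ hz) x) x
      rw [smul_pow, Matrix.smul_apply, one_apply_eq, ← Matrix.map_pow] at h
      exact h
    obtain ⟨y, hy⟩ := htr
    have h1 := htrace (y ^ p)
    rw [map_pow, trace_pow_char, htrace y, mul_pow] at h1
    rw [htrace y] at hy
    set u := (t * β (PiTensorProduct.tprod F (Pi.mulSingle 0 y))).trace
    set u' := (t * β (PiTensorProduct.tprod F (Pi.mulSingle 0 (y ^ p)))).trace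
    set v := (t ^ p) x x
    have hz0 : z ≠ 0 := left_ne_zero_of_mul hy
    have hu0 : algebraMap F Ω u ≠ 0 := right_ne_zero_of_mul hy
    have hu' : algebraMap F Ω u' ≠ 0 := by
      intro h
      rw [h, mul_zero] at h1
      exact mul_ne_zero (pow_ne_zero p hz0) (pow_ne_zero p hu0) h1
    have hv : algebraMap F Ω v ≠ 0 := right_ne_zero_of_mul (hzp.trans_ne one_ne_zero)
    refine ⟨v⁻¹ * u ^ p / u', ?_⟩
    rw [map_div₀, map_mul, map_inv₀, map_pow, div_eq_iff hu', ← h1, ← eq_inv_of_mul_eq_one_left hzp]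
  have hmap : (ζ • t).map (algebraMap F Ω) = algebraMap F Ω ζ • t.map (algebraMap F Ω) := by
    ext x y
    simp
  rw [← hmap] at hz
  have hinj : Function.Injective fun M : Matrix (Fin p → Fin d) (Fin p → Fin d) F ↦
      M.map (algebraMap F Ω) := Matrix.map_injective (algebraMap F Ω).injective
  have hrank : ∀ M N, M * Q = Q * N → N.rank = M.rank := by
    intro M N h
    rw [← rank_mul_eq_right_of_isUnit_det Q N hQ, ← h, rank_mul_eq_left_of_isUnit_det Q M hQ]
  refine ⟨β.toAlgHom, ζ • t, ?_, fun y ↦ ?_, ?_⟩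
  · apply hinj
    have h := hone _ hz
    rw [← Matrix.map_pow] at h
    simpa using h
  · rw [smul_mul_assoc, mul_smul_comm]
    exact congrArg (ζ • ·) (htβ' y).symm
  · rw [← rotMatrix_rank (L := Ω)]
    congr 2
    · rw [← rank_map_algebraMap (L := Ω)]
      apply hrank
      rw [sub_mul, hz, Matrix.map_sub _ (map_sub _), mul_sub]
      simp
    · rw [← rank_map_algebraMap (L := Ω)]
      apply hrank
      have : (∑ k ∈ Finset.range p, (ζ • t) ^ k).map (algebraMap F Ω) =
          ∑ k ∈ Finset.range p, ((ζ • t).map (algebraMap F Ω)) ^ k := by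
        refine (map_sum (algebraMap F Ω).mapMatrix (fun k ↦ (ζ • t) ^ k) (Finset.range p)).trans ?_
        exact Finset.sum_congr rfl fun k _ ↦ map_pow (algebraMap F Ω).mapMatrix _ k
      rw [this, Finset.sum_mul, Finset.mul_sum]
      exact Finset.sum_congr rfl fun k _ ↦ hpow _ hz k

end RotationMatrix

section Frobenius

open Matrix
open scoped Fin.CommRing

variable {p : ℕ} [Fact p.Prime] {F : Type} [Field F] {A : Type} [Ring A] [Algebra F A]

lemma tprod_const_add [CharP F p] (a b : A) : ∃ y : ⨂[F] _ : Fin p, A,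
    PiTensorProduct.tprod F (fun _ : Fin p ↦ a + b) = PiTensorProduct.tprod F (fun _ ↦ a) +
      PiTensorProduct.tprod F (fun _ ↦ b) + ∑ k ∈ Finset.range p, (tensorRot p F A)^[k] y := by
  classical
  let v : Finset (Fin p) → ⨂[F] _ : Fin p, A := fun s ↦
    PiTensorProduct.tprod F (s.piecewise (fun _ ↦ a) fun _ ↦ b)
  let M : Finset (Finset (Fin p)) := (Finset.univ.erase ∅).erase Finset.univ
  let sh : ℕ → Finset (Fin p) ≃ Finset (Fin p) := fun k ↦
    (Equiv.addRight (k : Fin p)).finsetCongr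
  have hsh : ∀ k s i, i ∈ sh k s ↔ i - (k : Fin p) ∈ s := by
    intro k s i
    simp [sh, sub_eq_add_neg, Finset.mem_map_equiv]
  have hsh' : ∀ k s, sh k s ∈ M ↔ s ∈ M := by
    intro k s
    have h1 : sh k ∅ = ∅ := by ext; simp [hsh]
    have h2 : sh k Finset.univ = Finset.univ := by ext; simp [hsh]
    simp only [M, Finset.mem_erase, Finset.mem_univ, and_true]
    rw [← (sh k).injective.ne_iff (x := s) (y := Finset.univ), h2, ← (sh k).injective.ne_iff (x := s) (y := ∅), h1]
  have hv : ∀ k s, (tensorRot p F A)^[k] (v (sh k s)) = v s := by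
    intro k s
    rw [tensorRot_iterate_tprod]
    congr 1
    ext i
    simp [Finset.piecewise, hsh]
  refine ⟨∑ s ∈ M, cyclicWeight F s • v s, ?_⟩
  have hsum : ∀ k, (tensorRot p F A)^[k] (∑ s ∈ M, cyclicWeight F s • v s) =
      ∑ s ∈ M, cyclicWeight F (sh k s) • v s := by
    intro k
    rw [← AlgHom.coe_pow, map_sum]
    refine (Finset.sum_equiv (sh k) (fun s ↦ (hsh' k s).symm) fun s _ ↦ ?_).symm
    rw [map_smul, AlgHom.coe_pow, hv]
  simp_rw [hsum]
  rw [Finset.sum_comm]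
  have hM : ∑ s ∈ M, ∑ k ∈ Finset.range p, cyclicWeight F (sh k s) • v s = ∑ s ∈ M, v s := by
    refine Finset.sum_congr rfl fun s hs ↦ ?_
    simp only [M, Finset.mem_erase, Finset.mem_univ, and_true] at hs
    rw [← Finset.sum_smul, sum_cyclicWeight s (Finset.nonempty_iff_ne_empty.2 hs.2) hs.1 _
      fun k ↦ hsh k s, one_smul]
  rw [hM]
  have hadd := (PiTensorProduct.tprod F (s := fun _ : Fin p ↦ A)).map_add_univ
    (fun _ ↦ a) (fun _ ↦ b)
  change PiTensorProduct.tprod F (fun _ : Fin p ↦ a + b) = ∑ s, v s at hadd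
  rw [hadd, ← Finset.add_sum_erase _ _ (Finset.mem_univ ∅), ← Finset.add_sum_erase _ _
    (a := Finset.univ) (by simp [Finset.univ_eq_empty_iff])]
  have h1 : v ∅ = PiTensorProduct.tprod F (fun _ ↦ b) := by simp [v]
  have h2 : v Finset.univ = PiTensorProduct.tprod F (fun _ ↦ a) := by simp [v]
  rw [h1, h2]
  abel

/-- The field `F`, viewed as an extension of itself by the Frobenius endomorphism. -/
def FrobTwist (_ : ℕ) (F : Type) : Type := F

instance : Field (FrobTwist p F) := inferInstanceAs (Field F)

noncomputable instance [CharP F p] : Algebra F (FrobTwist p F) :=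
  (frobenius F p).toAlgebra

lemma FrobTwist.algebraMap_apply [CharP F p] (c : F) :
    algebraMap F (FrobTwist p F) c = (show FrobTwist p F from c ^ p) := rfl

lemma isSplitAlg_of_ringHom_end {E : Type} [Field E] [Algebra F E] (hA : IsCSA F A)
    {V : Type} [AddCommGroup V] [Module E V] [FiniteDimensional E V] [Nontrivial V]
    (g : A →+* Module.End E V)
    (hg : ∀ c, g (algebraMap F A c) = algebraMap E (Module.End E V) (algebraMap F E c))
    (hd : Module.finrank E V ^ 2 ≤ Module.finrank F A) : IsSplitAlg E (E ⊗[F] A) := by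
  have := (hA.baseChange E).2.1
  have := hA.2.2
  let : Algebra F (Module.End E V) := Algebra.compHom _ (algebraMap F E)
  have : IsScalarTower F E (Module.End E V) := .of_algebraMap_eq fun _ ↦ rfl
  let g' : A →ₐ[F] Module.End E V := { g with commutes' := hg }
  refine isSplitAlg_of_algHom_end (Algebra.TensorProduct.lift (Algebra.ofId E _) g'
    fun c a ↦ Algebra.commutes c (g' a)) (hd.trans_eq (Module.finrank_baseChange (R := E)).symm)

lemma isSplitAlg_frobTwist_of_ringHom_end [CharP F p] (hA : IsCSA F A)
    {V : Type} [AddCommGroup V] [Module F V] [FiniteDimensional F V] [Nontrivial V]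
    (g : A →+* Module.End F V) (hg : ∀ c : F, g (algebraMap F A c) = c ^ p • 1)
    (hd : Module.finrank F V ^ 2 ≤ Module.finrank F A) :
    IsSplitAlg (FrobTwist p F) (FrobTwist p F ⊗[F] A) := by
  let : Module (FrobTwist p F) V := ‹Module F V›
  have : FiniteDimensional (FrobTwist p F) V := ‹FiniteDimensional F V›
  exact isSplitAlg_of_ringHom_end (E := FrobTwist p F) hA g hg hd

lemma isSplitAlg_frobTwist [CharP F p] (hA : IsCSA F A)
    (hs : IsSplitAlg F (⨂[F] _ : Fin p, A)) :
    IsSplitAlg (FrobTwist p F) (FrobTwist p F ⊗[F] A) := by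
  obtain ⟨d, hd, hdA, β, t, htp, htβ, hrank⟩ := exists_rotation_matrix hA hs
  set S := ∑ k ∈ Finset.range p, t ^ k with hS
  let V := (Fin p → Fin d) → F
  let K : Submodule F V := LinearMap.ker (t - 1).mulVecLin
  let R : Submodule F V := LinearMap.range S.mulVecLin
  have hK : ∀ f, f ∈ K ↔ t *ᵥ f = f := by
    intro f
    rw [LinearMap.mem_ker, mulVecLin_apply, sub_mulVec, one_mulVec, sub_eq_zero]
  have htS : t * S = S := by
    have := mul_geom_sum t p
    rwa [htp, sub_self, sub_mul, one_mul, sub_eq_zero] at this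
  have hRK : R ≤ K := by
    rintro _ ⟨f, rfl⟩
    rw [hK, mulVecLin_apply, mulVec_mulVec, htS]
  let N : Submodule F K := R.submoduleOf K
  let H := K ⧸ N
  have hHd : Module.finrank F H = d := by
    have h1 := Submodule.finrank_quotient_add_finrank N
    have h2 := LinearMap.finrank_range_add_finrank_ker (t - 1).mulVecLin
    have h3 : Module.finrank F N = S.rank := (Submodule.submoduleOfEquivOfLe hRK).finrank_eq
    have h4 : Module.finrank F V = Fintype.card (Fin p → Fin d) :=
      Module.finrank_fintype_fun_eq_card F
    change (t - 1).rank + Module.finrank F K = Module.finrank F V at h2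
    change Module.finrank F H + _ = _ at h1
    omega
  let m : A → Matrix (Fin p → Fin d) (Fin p → Fin d) F := fun a ↦
    β (PiTensorProduct.tprod F fun _ ↦ a)
  have hmt : ∀ a, t * m a = m a * t := by
    intro a
    rw [htβ, tensorRot_tprod]
  have hmS : ∀ a, S * m a = m a * S := fun a ↦
    (Commute.sum_left _ _ _ fun k _ ↦ Commute.pow_left (hmt a) k)
  have hmK : ∀ a, ∀ f ∈ K, (m a).mulVecLin f ∈ K := by
    intro a f hf
    rw [hK] at hf ⊢
    rw [mulVecLin_apply, mulVec_mulVec, hmt, ← mulVec_mulVec, hf]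
  have hmR : ∀ a, ∀ f ∈ R, (m a).mulVecLin f ∈ R := by
    rintro a _ ⟨f, rfl⟩
    refine ⟨m a *ᵥ f, ?_⟩
    rw [mulVecLin_apply, mulVecLin_apply, mulVecLin_apply, mulVec_mulVec, mulVec_mulVec, hmS]
  have hm1 : m 1 = 1 := by
    have : (1 : ⨂[F] _ : Fin p, A) = PiTensorProduct.tprod F (fun _ ↦ 1) := rfl
    simp only [m]
    rw [← this, map_one]
  have hmm : ∀ a b, m (a * b) = m a * m b := by
    intro a b
    simp only [m]
    rw [← map_mul, PiTensorProduct.tprod_mul_tprod]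
    rfl
  have hms : ∀ c : F, m (algebraMap F A c) = c ^ p • 1 := by
    intro c
    have := (PiTensorProduct.tprod F (s := fun _ : Fin p ↦ A)).map_smul_univ (fun _ ↦ c) fun _ ↦ 1
    rw [Finset.prod_const, Finset.card_univ, Fintype.card_fin] at this
    rw [← hm1, ← map_smul, ← this, ← Algebra.algebraMap_eq_smul_one]
  have hma : ∀ a b, ∀ f ∈ K,
      (m (a + b)).mulVecLin f - ((m a).mulVecLin f + (m b).mulVecLin f) ∈ R := by
    intro a b f hf
    obtain ⟨y, hy⟩ := tprod_const_add (p := p) (F := F) a b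
    refine ⟨β y *ᵥ f, ?_⟩
    have hk : ∀ k, t ^ k * β y = β ((tensorRot p F A)^[k] y) * t ^ k := by
      intro k
      induction k with
      | zero => simp
      | succ k ih =>
        rw [pow_succ', mul_assoc, ih, ← mul_assoc, htβ, Function.iterate_succ_apply', mul_assoc]
    have hf' : ∀ k, t ^ k *ᵥ f = f := by
      intro k
      induction k with
      | zero => simp
      | succ k ih => rw [pow_succ, ← mulVec_mulVec, (hK f).1 hf, ih]
    rw [mulVecLin_apply, mulVecLin_apply, mulVecLin_apply, mulVecLin_apply]
    simp only [m]
    rw [hy, map_add, map_add, map_sum, add_mulVec, add_mulVec, add_sub_cancel_left, hS,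
      sum_mulVec, sum_mulVec]
    refine Finset.sum_congr rfl fun k _ ↦ ?_
    rw [mulVec_mulVec, hk, ← mulVec_mulVec, hf']
  let g₀ : A → Module.End F K := fun a ↦ (m a).mulVecLin.restrict (hmK a)
  have hg₀ : ∀ a, N ≤ N.comap (g₀ a) := fun a f hf ↦ hmR a f hf
  let g₁ : A → Module.End F H := fun a ↦ N.mapQ N (g₀ a) (hg₀ a)
  have hg₁ : ∀ a (f : K), g₁ a (N.mkQ f) = N.mkQ (g₀ a f) := fun a f ↦
    N.mapQ_apply N (g₀ a) (h := hg₀ a) f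
  have key : ∀ u v : Module.End F H, (∀ f : K, u (N.mkQ f) = v (N.mkQ f)) → u = v := by
    intro u v h
    refine LinearMap.ext fun x ↦ ?_
    obtain ⟨f, rfl⟩ := N.mkQ_surjective x
    exact h f
  have h1 : g₁ 1 = 1 := key _ _ fun f ↦ by
    rw [hg₁]
    refine congrArg N.mkQ (Subtype.ext ?_)
    change m 1 *ᵥ f.1 = f.1
    rw [hm1, one_mulVec]
  have h2 : ∀ a b, g₁ (a * b) = g₁ a * g₁ b := fun a b ↦ key _ _ fun f ↦ by
    rw [Module.End.mul_apply, hg₁, hg₁, hg₁]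
    refine congrArg N.mkQ (Subtype.ext ?_)
    change m (a * b) *ᵥ f.1 = m a *ᵥ (m b *ᵥ f.1)
    rw [hmm, mulVec_mulVec]
  have h3 : ∀ a b, g₁ (a + b) = g₁ a + g₁ b := fun a b ↦ key _ _ fun f ↦ by
    rw [LinearMap.add_apply, hg₁, hg₁, hg₁, ← map_add, Submodule.mkQ_apply, Submodule.mkQ_apply,
      Submodule.Quotient.eq]
    exact hma a b f.1 f.2
  have h4 : ∀ c : F, g₁ (algebraMap F A c) = c ^ p • 1 := fun c ↦ key _ _ fun f ↦ by
    rw [hg₁, LinearMap.smul_apply, Module.End.one_apply, ← map_smul]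
    refine congrArg N.mkQ (Subtype.ext ?_)
    change m _ *ᵥ f.1 = c ^ p • f.1
    rw [hms, smul_mulVec, one_mulVec]
  let g : A →+* Module.End F H := RingHom.mk' ⟨⟨g₁, h1⟩, h2⟩ h3
  have hnt : Nontrivial H := Module.nontrivial_of_finrank_pos (R := F) (by omega)
  exact isSplitAlg_frobTwist_of_ringHom_end hA g h4 (by rw [hHd, hdA])

end Frobenius

section Main

open Polynomial

variable {p : ℕ} [Fact p.Prime]

instance {F : Type} [Field F] [CharP F p] : CharP (FrobTwist p F) p := inferInstanceAs (CharP F p)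

lemma X_pow_sub_X_eq_prod (K : Type) [Field K] [CharP K p] :
    (X ^ p - X : K[X]) = ∏ k : ZMod p, (X - C (k.cast : K)) := by
  have hp := (Fact.out : p.Prime)
  have h1 : (X ^ p - X : (ZMod p)[X]) = ∏ k : ZMod p, (X - C k) := by
    have hroots := FiniteField.roots_X_pow_card_sub_X (ZMod p)
    rw [ZMod.card] at hroots
    have := prod_multiset_X_sub_C_of_monic_of_roots_card_eq (p := (X ^ p - X : (ZMod p)[X]))
      (monic_X_pow_sub (by rw [degree_X]; exact_mod_cast hp.one_lt)) (by
        rw [hroots, FiniteField.X_pow_card_sub_X_natDegree_eq _ hp.one_lt]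
        simp [ZMod.card])
    rw [hroots] at this
    exact this.symm
  have h2 := congrArg (Polynomial.map (ZMod.castHom (dvd_refl p) K)) h1
  simpa [Polynomial.map_prod] using h2

lemma IsCyclicAlgWith.pow_sub_ne {K D : Type} [Field K] [CharP K p] [DivisionRing D] [Algebra K D]
    {a b : K} (h : IsCyclicAlgWith p K D a b) (z : K) : z ^ p - z ≠ a := by
  rintro rfl
  have hp := (Fact.out : p.Prime)
  have := h.finiteDimensional hp.one_lt
  have : CharP D p := charP_of_injective_algebraMap (algebraMap K D).injective p
  obtain ⟨i, j, hr, -⟩ := h.exists_symRel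
  have hj : j ≠ 0 := by
    rintro rfl
    have := hr.pow_eq
    rw [zero_pow hp.ne_zero, eq_comm, map_eq_zero] at this
    exact h.1 this
  have hi : ∀ c : K, i ≠ algebraMap K D c := by
    rintro c rfl
    have := hr.comm
    rw [sub_mul, one_mul, ← Algebra.commutes, eq_comm, sub_eq_self] at this
    exact hj this
  set w := i - algebraMap K D z with hw
  have hwp : aeval w (X ^ p - X : K[X]) = 0 := by
    have : (i - algebraMap K D z) ^ p = i ^ p - algebraMap K D z ^ p :=
      sub_pow_char_of_commute _ (Algebra.commutes z i).symm
    have h2 := hr.pow_sub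
    rw [map_sub, map_pow] at h2
    simp only [map_sub, map_pow, aeval_X, hw, this]
    rw [sub_sub_sub_comm, h2, sub_self]
  have hdvd := minpoly.dvd K w hwp
  rw [X_pow_sub_X_eq_prod] at hdvd
  obtain ⟨k, -, q, hq⟩ := (minpoly.prime (.of_finite K w)).exists_mem_finset_dvd hdvd
  have h3 := congrArg (aeval w) hq
  rw [map_mul, minpoly.aeval, zero_mul, map_sub, aeval_X, aeval_C, sub_eq_zero, hw,
    sub_eq_iff_eq_add, ← map_add] at h3
  exact hi _ h3

/-- An extension `K` of `F` with `K ^ p ⊆ F` embeds into the Frobenius extension of `F`. -/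
lemma nonempty_algHom_frobTwist {F K : Type} [Field F] [CharP F p] [Field K] [Algebra F K]
    (hK : ∀ z : K, z ^ p ∈ (algebraMap F K).range) : Nonempty (K →ₐ[F] FrobTwist p F) := by
  have : CharP K p := charP_of_injective_algebraMap (algebraMap F K).injective p
  choose ψ hψ using hK
  have hinj := (algebraMap F K).injective
  exact ⟨{
    toFun := ψ
    map_one' := hinj ((hψ _).trans (by
      rw [one_pow]; exact (map_one (algebraMap F K)).symm))
    map_mul' := fun x y ↦ hinj ((hψ _).trans (by
      rw [mul_pow, ← hψ x, ← hψ y]; exact (map_mul (algebraMap F K) _ _).symm))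
    map_zero' := hinj ((hψ _).trans (by
      rw [zero_pow (Fact.out : p.Prime).ne_zero]; exact (map_zero (algebraMap F K)).symm))
    map_add' := fun x y ↦ hinj ((hψ _).trans (by
      rw [add_pow_char, ← hψ x, ← hψ y]; exact (map_add (algebraMap F K) _ _).symm))
    commutes' := fun c ↦ hinj ((hψ _).trans (map_pow (algebraMap F K) c p).symm) }⟩

lemma exists_eq_mul_of_res_eq_sym {F K : Type} [Field F] [CharP F p] [Field K] [Algebra F K]
    [CharP K p] (hK : ∀ z : K, z ^ p ∈ (algebraMap F K).range) {α : Br F}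
    (hα : Br.res (FrobTwist p F) α = 1) {a b : K} (hb : b ≠ 0) (h : Br.res K α = sym p a b)
    (ha : ∀ z : K, z ^ p - z ≠ a) :
    ∃ k ≤ p - 1, ∃ s, IsSymProd p k s ∧ Br.res K (α * s⁻¹) = 1 := by
  obtain ⟨a', ha'⟩ := hK a
  have hsym : sym p (algebraMap F K a') b = sym p a b := by
    rw [ha', ← sym_add_pow_sub a b a, add_sub_cancel]
  have hroot : ∀ z : F, z ^ p - z ≠ a' := by
    rintro z rfl
    rw [map_sub, map_pow] at ha'
    refine ha (algebraMap F K z - a) ?_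
    rw [sub_pow_char, ← ha']
    ring
  obtain ⟨ψ⟩ := nonempty_algHom_frobTwist hK
  let e := ψ.equivFieldRange
  let : Algebra K ψ.fieldRange := e.toAlgHom.toRingHom.toAlgebra
  have : IsScalarTower F K ψ.fieldRange := .of_algHom e.toAlgHom
  have : CharP ψ.fieldRange p := charP_of_injective_algebraMap (algebraMap F _).injective p
  have hE : ∀ z : FrobTwist p F, z ^ p ∈ (algebraMap F (FrobTwist p F)).range :=
    fun z ↦ ⟨z, rfl⟩
  obtain ⟨k, hk, s, hs, hs'⟩ := exists_isSymProd_of_res_eq_sym (p := p) hE ψ.fieldRange hα (a := a') (b := algebraMap K _ b)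
    (by simpa using hb)
    (by rw [← Br.res_res K, h, ← hsym, Br.res_sym, ← IsScalarTower.algebraMap_apply]) hroot
  exact ⟨k, hk, s, hs, Br.res_eq_one_of_algHom e.symm.toAlgHom hs'⟩

end Main

/-- If `A` is central simple of exponent `p` over `F` of characteristic `p`,
`K/F` is purely inseparable with `K ^ p ⊆ F` and `[K:F] = p ^ n`, and `A_K` is Brauer
equivalent to a cyclic `K`-division algebra of degree `p`, then `λ_p(A) ≤ n + p - 1`;
more precisely `A ∼ B ⊗ B'` with `B_K` split and `λ_p(B') ≤ p - 1`. -/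
theorem statement1 (p : ℕ) (hp : p.Prime) (F : Type) [Field F] [CharP F p]
    (A : Type) [Ring A] [Algebra F A] (hA : IsCSA F A) (hexp : HasExponent F A p)
    (n : ℕ) (hn : 0 < n)
    (K : Type) [Field K] [Algebra F K] [IsPurelyInseparable F K]
    (hKp : ∀ z : K, z ^ p ∈ (algebraMap F K).range)
    (hKd : Module.finrank F K = p ^ n)
    (hAK : ∃ (D : Type) (_ : DivisionRing D) (_ : Algebra K D),
      IsCyclicPAlg p K D ∧ IsBrauerEquiv K (K ⊗[F] A) D) :
    SymbolLengthLE p F A (n + p - 1) ∧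
    ∃ (B B' : Type) (_ : Ring B) (_ : Algebra F B) (_ : Ring B') (_ : Algebra F B'),
      IsCSA F B ∧ IsCSA F B' ∧ IsBrauerEquiv F A (B ⊗[F] B') ∧
      IsSplitAlg K (K ⊗[F] B) ∧ SymbolLengthLE p F B' (p - 1) := by
  have : Fact p.Prime := ⟨hp⟩
  have : CharP K p := charP_of_injective_algebraMap (algebraMap F K).injective p
  obtain ⟨D, _, _, ⟨a, b, hD⟩, hBr⟩ := hAK
  have hDc := hD.isCSA hp.one_lt
  have hres : Br.res K hA.br = sym p a b := by
    rw [Br.res_br, ← hD.br_eq_sym hDc]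
    exact (IsCSA.br_eq_iff _ _).2 hBr
  obtain ⟨k, hk, s, hs, hs'⟩ := exists_eq_mul_of_res_eq_sym hKp
    ((Br.res_br_eq_one_iff hA _).2 (isSplitAlg_frobTwist hA hexp.2.1)) hD.1 hres hD.pow_sub_ne
  have hβ := isSymProd_of_res_eq_one hKp hKd hs'
  obtain ⟨B, _, _, hB, hBbr⟩ := Br.exists_rep (hA.br * s⁻¹)
  obtain ⟨B', _, _, hB', hBbr'⟩ := Br.exists_rep s
  constructor
  · have h : IsSymProd p (n + k) hA.br := by simpa using hβ.mul hs
    have := hp.one_lt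
    exact (h.symbolLengthLE hA).mono (m := n + p - 1) (by omega)
  · refine ⟨B, B', _, _, _, _, hB, hB', ?_, ?_, ?_⟩
    · rw [← IsCSA.br_eq_iff hA (hB.tensor hB'), hB.tensor_br hB', hBbr, hBbr', inv_mul_cancel_right]
    · rwa [← Br.res_br_eq_one_iff hB, hBbr]
    · exact (IsSymProd.symbolLengthLE hB' (hBbr' ▸ hs)).mono hk
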